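/- arXiv:2208.10288 — 2 statements merged into one kernel-verified Lean document; each statement's English description precedes it below -/
import Mathlib

section
/- Let A ≥ 240. There exist constants c₀ ≥ 1 and C > 0, depending only on A, with the following property. Let X be any real Banach space, let E ⊆ X be a nonempty set with diam E < ∞, and let G be a multiresolution family for E with inflation factor A. If diam E + Σ_{Q ∈ G, diam Q ≤ c₀·diam E} β_E(Q)·diam Q < ∞, then E is contained in a rectifiable curve Γ ⊆ X with H^1(Γ) ≤ C·(diam E + Σ_{Q ∈ G, diam Q ≤ c₀·diam E} β_E(Q)·diam Q). -/
open Metric MeasureTheory Set Bornology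
open scoped ENNReal NNReal Classical

universe u

noncomputable section

/-- The affine line through `a` with direction `v`. -/
def lineThrough {X : Type u} [AddCommGroup X] [Module ℝ X] (a v : X) : Set X :=
  {y | ∃ t : ℝ, y = a + t • v}

/-- The Jones beta number of `E` in the window `Q`:
`β_E(Q) = inf_L sup_{x ∈ E ∩ Q} dist(x,L)/diam Q`, with value `0` if `E ∩ Q = ∅`. -/
def jonesBeta {X : Type u} [NormedAddCommGroup X] [NormedSpace ℝ X] (E Q : Set X) : ℝ :=
  if E ∩ Q = ∅ then 0
  else sInf {r : ℝ | ∃ a v : X, v ≠ 0 ∧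
    r = sSup ((fun x => infDist x (lineThrough a v) / Metric.diam Q) '' (E ∩ Q))}

/-- `net` encodes a partial multiresolution family for `E`: a nested family of
`2^{-k}`-separated subsets of `E`. -/
def IsPartialMultiresolution {X : Type u} [NormedAddCommGroup X]
    (E : Set X) (net : ℤ → Set X) : Prop :=
  (∀ k, net k ⊆ E) ∧ (∀ k, net k ⊆ net (k + 1)) ∧
    (∀ k : ℤ, ∀ x ∈ net k, ∀ y ∈ net k, x ≠ y → (2 : ℝ) ^ (-k) ≤ dist x y)

/-- `net` encodes a multiresolution family for `E`: a nested family of `2^{-k}`-nets for `E`. -/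
def IsMultiresolution {X : Type u} [NormedAddCommGroup X]
    (E : Set X) (net : ℤ → Set X) : Prop :=
  IsPartialMultiresolution E net ∧ ∀ k : ℤ, ∀ e ∈ E, ∃ x ∈ net k, dist e x ≤ (2 : ℝ) ^ (-k)

/-- The sum `Σ_{Q ∈ G} β_E(Q)^p · diam Q` over the (partial) multiresolution family
`G = {B(x, A·2^{-k}) : x ∈ net k, k ∈ ℤ}` with inflation factor `A`. -/
def betaSum {X : Type u} [NormedAddCommGroup X] [NormedSpace ℝ X]
    (E : Set X) (net : ℤ → Set X) (A p : ℝ) : ℝ≥0∞ :=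
  ∑' (k : ℤ), ∑' (x : net k),
    ENNReal.ofReal (jonesBeta E (closedBall (x : X) (A * (2 : ℝ) ^ (-k))) ^ p *
      Metric.diam (closedBall (x : X) (A * (2 : ℝ) ^ (-k))))

/-- `S_{E,p}(G) = diam E + Σ_{Q ∈ G} β_E(Q)^p · diam Q`. -/
def SEp {X : Type u} [NormedAddCommGroup X] [NormedSpace ℝ X]
    (E : Set X) (net : ℤ → Set X) (A p : ℝ) : ℝ≥0∞ :=
  ENNReal.ofReal (Metric.diam E) + betaSum E net A p

/-- `Γ` is a rectifiable curve: the image of a continuous map `[0,1] → X` with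
finite one-dimensional Hausdorff measure. -/
def IsRectifiableCurve {X : Type u} [NormedAddCommGroup X]
    [MeasurableSpace X] [BorelSpace X] (Γ : Set X) : Prop :=
  (∃ f : ℝ → X, ContinuousOn f (Set.Icc (0 : ℝ) 1) ∧ Γ = f '' Set.Icc (0 : ℝ) 1) ∧
    μH[1] Γ < ⊤

/-- The truncated sum `Σ_{Q ∈ G, diam Q ≤ c₀ diam E} β_E(Q) · diam Q`. -/
def truncBetaSum {X : Type u} [NormedAddCommGroup X] [NormedSpace ℝ X]
    (E : Set X) (net : ℤ → Set X) (A c₀ : ℝ) : ℝ≥0∞ :=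
  ∑' (k : ℤ), ∑' (x : net k),
    if Metric.diam (closedBall (x : X) (A * (2 : ℝ) ^ (-k))) ≤ c₀ * Metric.diam E then
      ENNReal.ofReal (jonesBeta E (closedBall (x : X) (A * (2 : ℝ) ^ (-k))) *
        Metric.diam (closedBall (x : X) (A * (2 : ℝ) ^ (-k))))
    else 0

/-! ### Packing and closed Lipschitz loops -/

/-- A packing bound on the real line: separated points `f i` carrying weights `ρ i`. -/
lemma sum_le_of_separated {ι : Type*} (Z : Finset ι) (f ρ : ι → ℝ) (κ lo m : ℝ) (hκ : 0 ≤ κ)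
    (hm : 0 ≤ m) :
    ∀ hi : ℝ, lo ≤ hi → (∀ i ∈ Z, lo ≤ f i) → (∀ i ∈ Z, f i ≤ hi) → (∀ i ∈ Z, ρ i ≤ m) →
      (∀ i ∈ Z, 0 ≤ ρ i) →
      (∀ i ∈ Z, ∀ j ∈ Z, i ≠ j → κ * ρ i ≤ |f i - f j|) →
      κ * ∑ i ∈ Z, ρ i ≤ hi - lo + κ * m := by
  induction Z using Finset.induction_on_max_value f with
  | empty =>
    intro hi h _ _ _ _ _
    have := mul_nonneg hκ hm
    simp only [Finset.sum_empty, mul_zero]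
    linarith
  | insert a s has hmax ih =>
    intro hi hlh hlo hhi hρ hρ0 hsep
    rw [Finset.sum_insert has, mul_add]
    have ha := Finset.mem_insert_self a s
    rcases s.eq_empty_or_nonempty with rfl | ⟨b, hb⟩
    · simp only [Finset.sum_empty, mul_zero, add_zero]
      have := mul_le_mul_of_nonneg_left (hρ a ha) hκ
      linarith
    · have key : ∀ i ∈ s, f i ≤ f a - κ * ρ a := by
        intro i hi'
        have hne : a ≠ i := fun h => has (h ▸ hi')
        have h1 := hsep a ha i (Finset.mem_insert_of_mem hi') hne
        rw [abs_of_nonneg (sub_nonneg.2 (hmax i hi'))] at h1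
        linarith
      have := ih (f a - κ * ρ a) ((hlo b (Finset.mem_insert_of_mem hb)).trans (key b hb))
        (fun i hi' => hlo i (Finset.mem_insert_of_mem hi')) key
        (fun i hi' => hρ i (Finset.mem_insert_of_mem hi'))
        (fun i hi' => hρ0 i (Finset.mem_insert_of_mem hi'))
        (fun i hi' j hj hij =>
          hsep i (Finset.mem_insert_of_mem hi') j (Finset.mem_insert_of_mem hj) hij)
      linarith [hhi a ha]

lemma lipschitzWith_one_glue {X : Type u} [PseudoMetricSpace X] {f g : ℝ → X} {a : ℝ}
    (hf : LipschitzWith 1 f) (hg : LipschitzWith 1 g) (h : f a = g a) :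
    LipschitzWith 1 (fun t => if t ≤ a then f t else g t) := by
  have key : ∀ s t : ℝ, s ≤ a → a < t → dist (f s) (g t) ≤ dist s t := by
    intro s t hs ht
    have h1 : dist (f s) (f a) ≤ dist s a := by simpa using hf.dist_le_mul s a
    have h2 : dist (g a) (g t) ≤ dist a t := by simpa using hg.dist_le_mul a t
    have h3 := dist_triangle (f s) (f a) (g t)
    rw [h] at h3
    rw [h] at h1
    rw [Real.dist_eq, abs_of_nonpos (by linarith)] at h1 h2 ⊢
    linarith
  refine LipschitzWith.of_dist_le_mul fun s t => ?_
  simp only [NNReal.coe_one, one_mul]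
  by_cases hs : s ≤ a <;> by_cases ht : t ≤ a <;> simp only [hs, ht, if_true, if_false]
  · simpa using hf.dist_le_mul s t
  · exact key s t hs (not_le.1 ht)
  · rw [dist_comm, dist_comm s]
    exact key t s ht (not_le.1 hs)
  · simpa using hg.dist_le_mul s t

/-- From every point of `S` there starts a closed `1`-Lipschitz loop of duration at most `L`
in `K` that visits all of `S`. -/
def HasLoop {X : Type u} [PseudoMetricSpace X] (K S : Set X) (L : ℝ) : Prop :=
  0 ≤ L ∧ ∀ x ∈ S, ∃ f : ℝ → X, LipschitzWith 1 f ∧ (∀ t ≤ 0, f t = x) ∧ (∀ t ≥ L, f t = x) ∧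
    S ⊆ f '' Icc 0 L ∧ ∀ t, f t ∈ K

namespace HasLoop

section Metric

variable {X : Type u} [PseudoMetricSpace X] {K S T : Set X} {L M : ℝ}

lemma mono (h : HasLoop K S L) (hLM : L ≤ M) : HasLoop K S M := by
  refine ⟨h.1.trans hLM, fun x hx => ?_⟩
  obtain ⟨f, h1, h2, h3, h4, h5⟩ := h.2 x hx
  exact ⟨f, h1, h2, fun t ht => h3 t (hLM.trans ht),
    h4.trans (image_mono (Icc_subset_Icc_right hLM)), h5⟩

lemma singleton {x : X} (hx : x ∈ K) : HasLoop K {x} 0 := by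
  refine ⟨le_rfl, ?_⟩
  rintro y rfl
  exact ⟨fun _ => y, LipschitzWith.const' y, fun _ _ => rfl, fun _ _ => rfl,
    by rintro z rfl; exact ⟨0, by simp, rfl⟩, fun _ => hx⟩

lemma union_aux {x : X} (hS : HasLoop K S L) (hT : HasLoop K T M) (hxS : x ∈ S) (hxT : x ∈ T)
    {s : X} (hs : s ∈ S) :
    ∃ f : ℝ → X, LipschitzWith 1 f ∧ (∀ t ≤ 0, f t = s) ∧ (∀ t ≥ L + M, f t = s) ∧
      S ∪ T ⊆ f '' Icc 0 (L + M) ∧ ∀ t, f t ∈ K := by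
  obtain ⟨hL, hS⟩ := hS
  obtain ⟨hM, hT⟩ := hT
  obtain ⟨f, f1, f2, f3, f4, f5⟩ := hS s hs
  obtain ⟨g, g1, g2, g3, g4, g5⟩ := hT x hxT
  obtain ⟨t₀, ⟨ht0, htL⟩, hft⟩ := f4 hxS
  have lipshift : ∀ (u : ℝ → X) (c : ℝ), LipschitzWith 1 u →
      LipschitzWith 1 (fun t => u (t - c)) := by
    intro u c hu
    refine LipschitzWith.of_dist_le_mul fun a b => ?_
    simpa using hu.dist_le_mul (a - c) (b - c)
  set h₁ : ℝ → X := fun t => if t ≤ t₀ + M then g (t - t₀) else f (t - M) with hh₁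
  have hh₁L : LipschitzWith 1 h₁ := by
    apply lipschitzWith_one_glue (lipshift g t₀ g1) (lipshift f M f1)
    simp [hft, g3 M le_rfl]
  have hfh : f t₀ = h₁ t₀ := by
    simp [hh₁, hM, hft, g2 0 le_rfl]
  refine ⟨fun t => if t ≤ t₀ then f t else h₁ t, lipschitzWith_one_glue f1 hh₁L hfh, ?_, ?_, ?_, ?_⟩
  · intro t ht
    have : t ≤ t₀ := ht.trans ht0
    simp [this, f2 t ht]
  · intro t ht
    by_cases h1 : t ≤ t₀
    · have h2 : t = L := by linarith
      have h3 : M = 0 := by linarith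
      simp only [h1, if_true]
      exact f3 t (by linarith)
    · simp only [h1, if_false, hh₁]
      by_cases h2 : t ≤ t₀ + M
      · have h4 : t₀ = L := by linarith
        have h3 : t - t₀ = M := by linarith
        simp only [h2, if_true, h3]
        rw [g3 M le_rfl, ← hft, f3 t₀ h4.ge]
      · simp only [h2, if_false]
        exact f3 _ (by linarith)
  · rintro y (hy | hy)
    · obtain ⟨t, ⟨ht, ht'⟩, rfl⟩ := f4 hy
      by_cases h1 : t ≤ t₀
      · exact ⟨t, ⟨ht, by linarith⟩, by simp [h1]⟩
      · push Not at h1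
        refine ⟨t + M, ⟨by linarith, by linarith⟩, ?_⟩
        have h2 : ¬ (t + M ≤ t₀) := by linarith
        have h3 : ¬ (t + M ≤ t₀ + M) := by linarith
        simp [h2, hh₁, h1]
    · obtain ⟨t, ⟨ht, ht'⟩, rfl⟩ := g4 hy
      rcases ht.eq_or_lt with rfl | ht
      · exact ⟨t₀, ⟨ht0, by linarith⟩, by simp [hft, g2]⟩
      · refine ⟨t + t₀, ⟨by linarith, by linarith⟩, ?_⟩
        have h2 : ¬ (t + t₀ ≤ t₀) := by linarith
        have h3 : t + t₀ ≤ t₀ + M := by linarith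
        simp only [h2, if_false, hh₁, h3, if_true, add_sub_cancel_right]
  · intro t
    by_cases h1 : t ≤ t₀
    · simp [h1, f5]
    · by_cases h2 : t ≤ t₀ + M <;> simp [h1, h2, hh₁, f5, g5]

lemma union {x : X} (hS : HasLoop K S L) (hT : HasLoop K T M) (hxS : x ∈ S) (hxT : x ∈ T) :
    HasLoop K (S ∪ T) (L + M) := by
  refine ⟨add_nonneg hS.1 hT.1, ?_⟩
  rintro s (hs | hs)
  · exact union_aux hS hT hxS hxT hs
  · rw [union_comm, add_comm]
    exact union_aux hT hS hxT hxS hs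

/-- Loops hanging together in a well-founded way combine into a single loop. -/
lemma biUnion {ι : Type*} (rank : ι → ℕ) (V : ι → Set X) (ℓ : ι → ℝ) (o : ι) (T : Finset ι) :
    o ∈ T → (∀ t ∈ T, HasLoop K (V t) (ℓ t)) →
    (∀ t ∈ T, t = o ∨ ∃ t' ∈ T, rank t' < rank t ∧ (V t' ∩ V t).Nonempty) →
      HasLoop K (⋃ t ∈ T, V t) (∑ t ∈ T, ℓ t) := by
  induction T using Finset.induction_on_max_value rank with
  | empty => simp
  | insert a s has hmax ih =>
    intro ho hloop hconn
    have hst : ∀ t ∈ s, t = o ∨ ∃ t' ∈ s, rank t' < rank t ∧ (V t' ∩ V t).Nonempty := by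
      intro t ht
      refine (hconn t (Finset.mem_insert_of_mem ht)).imp_right ?_
      rintro ⟨t', ht', hlt, hne⟩
      rcases Finset.mem_insert.1 ht' with rfl | h
      · exact absurd (hmax t ht) (not_le.2 hlt)
      · exact ⟨t', h, hlt, hne⟩
    have hs1 : ∀ t ∈ s, HasLoop K (V t) (ℓ t) := fun t ht => hloop t (Finset.mem_insert_of_mem ht)
    have ha := hloop a (Finset.mem_insert_self a s)
    rw [Finset.sum_insert has]
    have hun : (⋃ t ∈ insert a s, V t) = V a ∪ ⋃ t ∈ s, V t := by
      simp
    rw [hun]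
    by_cases hos : o ∈ s
    · rcases hconn a (Finset.mem_insert_self a s) with rfl | ⟨t', ht', hlt, x, hx, hx'⟩
      · exact absurd hos has
      · have ht's : t' ∈ s := by
          rcases Finset.mem_insert.1 ht' with rfl | h
          · exact absurd hlt (lt_irrefl _)
          · exact h
        exact ha.union (ih hos hs1 hst) hx' (mem_biUnion ht's hx)
    · have hao : a = o := by
        rcases Finset.mem_insert.1 ho with h | h
        · exact h.symm
        · exact absurd h hos
      have hse : s = ∅ := by
        by_contra hne
        obtain ⟨b, hb, hbmin⟩ := s.exists_min_image rank (Finset.nonempty_iff_ne_empty.2 hne)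
        rcases hst b hb with rfl | ⟨t', ht', hlt, -⟩
        · exact hos hb
        · exact absurd (hbmin t' ht') (not_le.2 hlt)
      subst hse
      simpa using ha

end Metric

variable {X : Type u} [NormedAddCommGroup X] [NormedSpace ℝ X] {K : Set X}

lemma pair_aux (hK : Convex ℝ K) {x y : X} (hx : x ∈ K) (hy : y ∈ K) :
    ∃ f : ℝ → X, LipschitzWith 1 f ∧ (∀ t ≤ 0, f t = x) ∧ (∀ t ≥ 2 * dist x y, f t = x) ∧
      {x, y} ⊆ f '' Icc 0 (2 * dist x y) ∧ ∀ t, f t ∈ K := by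
  set d := dist x y with hd
  have hd0 : 0 ≤ d := dist_nonneg
  set τ : ℝ → ℝ := fun t => max 0 (min t (2 * d - t)) with hτ
  have hτd : ∀ t, τ t ≤ d := by
    intro t
    apply max_le hd0
    rcases le_total t d with h | h
    · exact (min_le_left _ _).trans h
    · exact (min_le_right _ _).trans (by linarith)
  have hτ0 : ∀ t, 0 ≤ τ t := fun t => le_max_left _ _
  have hyx : ‖y - x‖ = d := by rw [hd, dist_comm, dist_eq_norm]
  refine ⟨fun t => x + (τ t / d) • (y - x), ?_, ?_, ?_, ?_, ?_⟩
  · refine LipschitzWith.of_dist_le_mul fun s t => ?_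
    simp only [NNReal.coe_one, one_mul]
    rw [dist_eq_norm, add_sub_add_left_eq_sub, ← sub_smul, norm_smul, hyx, ← sub_div, norm_div,
      Real.norm_eq_abs, Real.norm_eq_abs, abs_of_nonneg hd0]
    have h1 : |τ s - τ t| / d * d ≤ |τ s - τ t| := by
      rw [div_mul_eq_mul_div, mul_div_assoc]
      exact mul_le_of_le_one_right (abs_nonneg _) (div_self_le_one d)
    refine h1.trans ?_
    rw [Real.dist_eq]
    have h2 : |τ s - τ t| ≤ |min s (2 * d - s) - min t (2 * d - t)| := by
      simpa using abs_max_sub_max_le_max 0 (min s (2 * d - s)) 0 (min t (2 * d - t))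
    refine h2.trans ((abs_min_sub_min_le_max _ _ _ _).trans ?_)
    rw [show 2 * d - s - (2 * d - t) = -(s - t) by ring, abs_neg, max_self]
  · intro t ht
    have : τ t = 0 := max_eq_left ((min_le_left _ _).trans ht)
    simp [this]
  · intro t ht
    have : τ t = 0 := max_eq_left ((min_le_right _ _).trans (by linarith))
    simp [this]
  · rintro z (rfl | rfl)
    · refine ⟨0, ⟨le_rfl, by linarith⟩, ?_⟩
      have : τ 0 = 0 := max_eq_left (min_le_left _ _)
      simp [this]
    · refine ⟨d, ⟨hd0, by linarith⟩, ?_⟩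
      have : τ d = d := by
        simp only [hτ]
        rw [show 2 * d - d = d by ring, min_self, max_eq_right hd0]
      simp only [this]
      rcases hd0.eq_or_lt with h | h
      · have : z - x = 0 := by rw [← norm_eq_zero, hyx, ← h]
        have : z = x := sub_eq_zero.1 this
        simp [this]
      · simp [h.ne']
  · intro t
    have h := hK.add_smul_sub_mem hx hy (t := τ t / d)
      ⟨div_nonneg (hτ0 t) hd0, div_le_one_of_le₀ (hτd t) hd0⟩
    exact h

lemma pair (hK : Convex ℝ K) {x y : X} (hx : x ∈ K) (hy : y ∈ K) :
    HasLoop K {x, y} (2 * dist x y) := by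
  refine ⟨by positivity, ?_⟩
  rintro z (rfl | rfl)
  · exact pair_aux hK hx hy
  · rw [pair_comm, dist_comm]
    exact pair_aux hK hy hx

/-- A finite set on which `φ` is bi-Lipschitz has a loop no longer than four times the
spread of `φ`. -/
lemma of_bilipschitz (hK : Convex ℝ K) (φ : X → ℝ) (lo : ℝ) (V : Finset X) :
    ∀ hi : ℝ, lo ≤ hi → (∀ z ∈ V, z ∈ K) → (∀ z ∈ V, lo ≤ φ z) → (∀ z ∈ V, φ z ≤ hi) →
      (∀ z ∈ V, ∀ w ∈ V, dist z w ≤ 2 * |φ z - φ w|) → HasLoop K (V : Set X) (4 * (hi - lo)) := by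
  induction V using Finset.induction_on_max_value φ with
  | empty =>
    intro hi h _ _ _ _
    exact ⟨by linarith, by simp⟩
  | insert a s has hmax ih =>
    intro hi hlh hVK hlo hhi hV
    have haK := hVK a (Finset.mem_insert_self a s)
    have hφa := hhi a (Finset.mem_insert_self a s)
    rcases s.eq_empty_or_nonempty with rfl | hs
    · simpa using (singleton haK).mono (by linarith)
    · obtain ⟨b, hb, hbmax⟩ := s.exists_max_image φ hs
      have hbi : b ∈ insert a s := Finset.mem_insert_of_mem hb
      have h1 := ih (φ b) (hlo b hbi) (fun z hz => hVK z (Finset.mem_insert_of_mem hz))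
        (fun z hz => hlo z (Finset.mem_insert_of_mem hz)) hbmax
        (fun z hz w hw => hV z (Finset.mem_insert_of_mem hz) w (Finset.mem_insert_of_mem hw))
      have h2 := pair hK (hVK b hbi) haK
      have h3 := h1.union h2 (Finset.mem_coe.2 hb) (by simp)
      have h4 : (s : Set X) ∪ {b, a} = ((insert a s : Finset X) : Set X) := by
        ext z
        simp only [mem_union, Finset.mem_coe, mem_insert_iff, mem_singleton_iff, Finset.coe_insert]
        constructor
        · rintro (h | rfl | rfl) <;> simp [*]
        · rintro (rfl | h) <;> simp [*]
      rw [h4] at h3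
      refine h3.mono ?_
      have h5 := hV b hbi a (Finset.mem_insert_self a s)
      rw [abs_of_nonpos (by linarith [hmax b hb])] at h5
      linarith

/-- A star has a loop of twice its length. -/
lemma star (hK : Convex ℝ K) {y : X} (hy : y ∈ K) (V : Finset X) (hV : ∀ z ∈ V, z ∈ K) :
    HasLoop K (insert y (V : Set X)) (∑ z ∈ V, 2 * dist y z) := by
  induction V using Finset.induction_on with
  | empty => simpa using singleton hy
  | insert a s has ih =>
    have h1 := ih fun z hz => hV z (Finset.mem_insert_of_mem hz)
    have h2 := pair hK hy (hV a (Finset.mem_insert_self a s))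
    have h3 := h2.union h1 (x := y) (by simp) (by simp)
    rw [Finset.sum_insert has]
    convert h3 using 1
    ext z
    simp only [Finset.coe_insert, mem_insert_iff, mem_union, mem_singleton_iff]
    tauto

end HasLoop

/-! ### Towers of nets and the stopping-time regions -/

lemma window_le {X : Type u} [NormedAddCommGroup X] [NormedSpace ℝ X] (φ : X →L[ℝ] ℝ)
    (hφ : ∀ x, |φ x| ≤ ‖x‖) {v w : X} {s e : ℝ} (hv : ‖v‖ = 1) (h : ‖w - s • v‖ ≤ e) :
    ‖w‖ * |φ v| - 2 * e ≤ |φ w| ∧ |φ w| ≤ ‖w‖ * |φ v| + 2 * e := by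
  have hφv : |φ v| ≤ 1 := hv ▸ hφ v
  have hs : ‖s • v‖ = |s| := by rw [norm_smul, hv, mul_one, Real.norm_eq_abs]
  have h1 : ‖w‖ ≤ |s| + e := by
    have := norm_add_le (w - s • v) (s • v)
    rw [sub_add_cancel, hs] at this
    linarith
  have h2 : |s| ≤ ‖w‖ + e := by
    have := norm_sub_le w (w - s • v)
    rw [sub_sub_cancel, hs] at this
    linarith
  have h3 : |φ w - s * φ v| ≤ e := by
    have := (hφ (w - s • v)).trans h
    simpa using this
  have he : 0 ≤ e := (abs_nonneg _).trans h3
  have h4 : |s * φ v| = |s| * |φ v| := abs_mul _ _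
  have h5 := abs_sub_abs_le_abs_sub (φ w) (s * φ v)
  have h6 := abs_sub_abs_le_abs_sub (s * φ v) (φ w)
  rw [abs_sub_comm] at h6
  have h0 := abs_nonneg (φ v)
  have h7 : e * |φ v| ≤ e := mul_le_of_le_one_right he hφv
  constructor
  · have : ‖w‖ * |φ v| ≤ (|s| + e) * |φ v| := by gcongr
    linarith
  · have : |s| * |φ v| ≤ (‖w‖ + e) * |φ v| := by gcongr
    linarith

lemma exists_norming {X : Type u} [NormedAddCommGroup X] [NormedSpace ℝ X] {v : X}
    (hv : ‖v‖ = 1) : ∃ φ : X →L[ℝ] ℝ, (∀ x, |φ x| ≤ ‖x‖) ∧ φ v = 1 := by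
  obtain ⟨g, hg, hgv⟩ := exists_dual_vector'' ℝ v
  refine ⟨g, fun x => ?_, by simpa [hv] using hgv⟩
  have := g.le_of_opNorm_le hg x
  simpa using this

/-- A finite-level description of a set: nested `ρ / 16 ^ i`-separated sets `net i`, with a
nearest-point map to the previous level, and at every node `(i, x)` a direction `dir` and a
relative deviation `dev` of the set from lines in this direction. -/
structure Tower (X : Type u) [NormedAddCommGroup X] [NormedSpace ℝ X] where
  E : Set X
  ρ : ℝ
  net : ℕ → Finset X
  root : X
  parent : ℕ → X → X
  dev : ℕ × X → ℝ
  dir : ℕ × X → X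
  ρ_pos : 0 < ρ
  net_zero : net 0 = {root}
  net_subset : ∀ i, ∀ x ∈ net i, x ∈ E
  net_mono : ∀ i, net i ⊆ net (i + 1)
  net_sep : ∀ i, ∀ x ∈ net i, ∀ y ∈ net i, x ≠ y → ρ / 16 ^ i ≤ dist x y
  parent_mem : ∀ i, ∀ z ∈ net (i + 1), parent i z ∈ net i
  parent_dist : ∀ i, ∀ z ∈ net (i + 1), dist z (parent i z) ≤ ρ / 16 ^ i
  parent_nearest : ∀ i, ∀ z ∈ net (i + 1), ∀ x ∈ net i, dist z (parent i z) ≤ dist z x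
  dev_nonneg : ∀ q, 0 ≤ dev q
  dir_norm : ∀ i, ∀ x ∈ net i, ‖dir (i, x)‖ = 1
  flat : ∀ i, ∀ x ∈ net i, ∀ p ∈ E, ∀ z ∈ E, dist p x ≤ 240 * (ρ / 16 ^ i) →
    dist z x ≤ 240 * (ρ / 16 ^ i) → ∃ s : ℝ, ‖p - z - s • dir (i, x)‖ ≤ dev (i, x) * (ρ / 16 ^ i)

namespace Tower

variable {X : Type u} [NormedAddCommGroup X] [NormedSpace ℝ X] (T : Tower X)

/-- The scale of level `i`. -/
def r (i : ℕ) : ℝ := T.ρ / 16 ^ i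

lemma r_pos (i : ℕ) : 0 < T.r i := div_pos T.ρ_pos (by positivity)

lemma r_succ (i : ℕ) : T.r (i + 1) = T.r i / 16 := by
  rw [r, r, pow_succ, div_div]

lemma r_anti {i j : ℕ} (h : i ≤ j) : T.r j ≤ T.r i := by
  induction j, h using Nat.le_induction with
  | base => exact le_rfl
  | succ j _ ih =>
    rw [r_succ]
    linarith [T.r_pos j]

lemma r_lt {i j : ℕ} (h : i < j) : T.r j ≤ T.r i / 16 := by
  rw [← r_succ]
  exact T.r_anti h

lemma net_le {i j : ℕ} (h : i ≤ j) : T.net i ⊆ T.net j := by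
  induction j, h using Nat.le_induction with
  | base => exact Finset.Subset.refl _
  | succ j _ ih => exact ih.trans (T.net_mono j)

/-- Some point of the set lies at distance comparable to the scale from `z`. -/
def Spread (j : ℕ) (z : X) : Prop :=
  ∃ p ∈ T.E, T.r j / 4 ≤ dist p z ∧ dist p z ≤ 240 * T.r j

/-- The part of the ancestry of a node that belongs to the same stopping-time region. -/
def path : ℕ → X → Finset (ℕ × X)
  | 0, x => {(0, x)}
  | i + 1, z =>
    if ∑ q ∈ path i (T.parent i z), T.dev q + T.dev (i + 1, z) ≤ 1 / 1000 ∧ T.Spread (i + 1) z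
    then insert (i + 1, z) (path i (T.parent i z)) else {(i + 1, z)}

/-- The node `(i + 1, z)` stays in the region of its parent. -/
def Stays (i : ℕ) (z : X) : Prop :=
  ∑ q ∈ T.path i (T.parent i z), T.dev q + T.dev (i + 1, z) ≤ 1 / 1000 ∧ T.Spread (i + 1) z

/-- The top node of the stopping-time region of a node. -/
def top : ℕ → X → ℕ × X
  | 0, x => (0, x)
  | i + 1, z => if T.Stays i z then top i (T.parent i z) else (i + 1, z)

variable {T}

lemma path_zero (x : X) : T.path 0 x = {(0, x)} := rfl

lemma top_zero (x : X) : T.top 0 x = (0, x) := rfl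

lemma path_of_stays {i : ℕ} {z : X} (h : T.Stays i z) :
    T.path (i + 1) z = insert (i + 1, z) (T.path i (T.parent i z)) := by
  rw [path]; exact if_pos h

lemma path_of_not_stays {i : ℕ} {z : X} (h : ¬ T.Stays i z) :
    T.path (i + 1) z = {(i + 1, z)} := by
  rw [path]; exact if_neg h

lemma top_of_stays {i : ℕ} {z : X} (h : T.Stays i z) :
    T.top (i + 1) z = T.top i (T.parent i z) := by
  rw [top]; exact if_pos h

lemma top_of_not_stays {i : ℕ} {z : X} (h : ¬ T.Stays i z) :
    T.top (i + 1) z = (i + 1, z) := by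
  rw [top]; exact if_neg h

lemma self_mem_path (j : ℕ) (z : X) : (j, z) ∈ T.path j z := by
  cases j with
  | zero => simp [path_zero]
  | succ j =>
    by_cases h : T.Stays j z
    · simp [path_of_stays h]
    · simp [path_of_not_stays h]

lemma top_mem_path (j : ℕ) (z : X) : T.top j z ∈ T.path j z := by
  induction j generalizing z with
  | zero => simp [path_zero, top_zero]
  | succ j ih =>
    by_cases h : T.Stays j z
    · rw [path_of_stays h, top_of_stays h]
      exact Finset.mem_insert_of_mem (ih _)
    · simp [path_of_not_stays h, top_of_not_stays h]

/-- The basic geometry of a path. -/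
lemma of_mem_path {j : ℕ} {z : X} (hz : z ∈ T.net j) {q : ℕ × X} (hq : q ∈ T.path j z) :
    q.1 ≤ j ∧ q.2 ∈ T.net q.1 ∧ T.top q.1 q.2 = T.top j z ∧
      dist q.2 z ≤ 16 / 15 * (T.r q.1 - T.r j) := by
  induction j generalizing z with
  | zero =>
    rw [path_zero, Finset.mem_singleton] at hq
    subst hq
    simp [hz]
  | succ j ih =>
    by_cases h : T.Stays j z
    · rw [path_of_stays h, Finset.mem_insert] at hq
      rcases hq with rfl | hq
      · simp [hz]
      · obtain ⟨h1, h2, h3, h4⟩ := ih (T.parent_mem j z hz) hq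
        refine ⟨by omega, h2, by rw [h3, top_of_stays h], ?_⟩
        have h5 : dist z (T.parent j z) ≤ T.r j := T.parent_dist j z hz
        have h6 := dist_triangle_right q.2 z (T.parent j z)
        rw [r_succ]
        linarith
    · rw [path_of_not_stays h, Finset.mem_singleton] at hq
      subst hq
      simp [hz]

lemma eq_of_mem_path_self {j : ℕ} {z x : X} (hz : z ∈ T.net j) (h : (j, x) ∈ T.path j z) :
    x = z := by
  have := (of_mem_path hz h).2.2.2
  simp only [sub_self, mul_zero] at this
  exact dist_le_zero.1 this

lemma not_mem_path_parent {j : ℕ} {z : X} (hz : z ∈ T.net (j + 1)) (x : X) :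
    (j + 1, x) ∉ T.path j (T.parent j z) := fun h => by
  have := (of_mem_path (T.parent_mem j z hz) h).1
  simp at this

lemma exists_mem_path {j : ℕ} {z : X} (hz : z ∈ T.net j) {l : ℕ} (h1 : (T.top j z).1 ≤ l)
    (h2 : l ≤ j) : ∃ x, (l, x) ∈ T.path j z := by
  induction j generalizing z with
  | zero =>
    obtain rfl : l = 0 := by omega
    exact ⟨z, self_mem_path 0 z⟩
  | succ j ih =>
    rcases h2.eq_or_lt with rfl | h2
    · exact ⟨z, self_mem_path _ z⟩
    · by_cases h : T.Stays j z
      · rw [top_of_stays h] at h1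
        obtain ⟨x, hx⟩ := ih (T.parent_mem j z hz) h1 (by omega)
        exact ⟨x, by rw [path_of_stays h]; exact Finset.mem_insert_of_mem hx⟩
      · rw [top_of_not_stays h] at h1
        simp only at h1
        omega

/-- An ancestor coincides with any net point of its level that is close to the node. -/
lemma eq_of_dist_lt {m l : ℕ} {w' x z : X} (hw : w' ∈ T.net (m + 1)) (hz : z ∈ T.net l)
    (hx : (l, x) ∈ T.path m (T.parent m w'))
    (hd : dist z w' < T.r l / 2 - (T.r l - T.r m) / 15) : x = z := by
  induction m generalizing w' with
  | zero =>
    have hp := T.parent_mem 0 w' hw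
    have hl := (of_mem_path hp hx).1
    obtain rfl : l = 0 := by simpa using hl
    obtain rfl := eq_of_mem_path_self hp hx
    have h1 := T.parent_nearest 0 w' hw z hz
    rw [dist_comm] at hd
    by_contra hne
    have h2 : T.r 0 ≤ _ := T.net_sep 0 _ hp z hz hne
    have h3 := dist_triangle_left (T.parent 0 w') z w'
    linarith
  | succ m ih =>
    have hp := T.parent_mem (m + 1) w' hw
    have hl : l ≤ m + 1 := (of_mem_path hp hx).1
    rcases hl.eq_or_lt with rfl | hl
    · obtain rfl := eq_of_mem_path_self hp hx
      have h1 := T.parent_nearest _ w' hw z hz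
      rw [dist_comm] at hd
      by_contra hne
      have h2 : T.r (m + 1) ≤ _ := T.net_sep _ _ hp z hz hne
      have h3 := dist_triangle_left (T.parent (m + 1) w') z w'
      linarith
    · have hstay : T.Stays m (T.parent (m + 1) w') := by
        by_contra h
        rw [path_of_not_stays h, Finset.mem_singleton, Prod.mk.injEq] at hx
        omega
      rw [path_of_stays hstay, Finset.mem_insert, Prod.mk.injEq] at hx
      rcases hx with ⟨h, -⟩ | hx
      · omega
      · refine ih hp hx ?_
        have h1 : _ ≤ T.r (m + 1) := T.parent_dist _ w' hw
        have h2 := dist_triangle z w' (T.parent (m + 1) w')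
        rw [r_succ] at h1 hd
        linarith

lemma sum_path_le {j : ℕ} {z : X} (h : T.dev (j, z) ≤ 1 / 1000) (hz : z ∈ T.net j) :
    ∑ q ∈ T.path j z, T.dev q ≤ 1 / 1000 := by
  cases j with
  | zero => simpa [path_zero] using h
  | succ j =>
    by_cases hs : T.Stays j z
    · rw [path_of_stays hs, Finset.sum_insert (not_mem_path_parent hz z), add_comm]
      exact hs.1
    · simpa [path_of_not_stays hs] using h

lemma dev_le_sum_path {j : ℕ} {z : X} {q : ℕ × X} (hq : q ∈ T.path j z) :
    T.dev q ≤ ∑ q ∈ T.path j z, T.dev q :=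
  Finset.single_le_sum (fun q _ => T.dev_nonneg q) hq

lemma dev_le_of_top {j : ℕ} {z : X} (hz : z ∈ T.net j) (h : T.dev (T.top j z) ≤ 1 / 1000) :
    ∑ q ∈ T.path j z, T.dev q ≤ 1 / 1000 := by
  cases j with
  | zero => exact sum_path_le h hz
  | succ j =>
    by_cases hs : T.Stays j z
    · rw [path_of_stays hs, Finset.sum_insert (not_mem_path_parent hz z), add_comm]
      exact hs.1
    · rw [top_of_not_stays hs] at h
      exact sum_path_le h hz

lemma tilt {j : ℕ} {z : X} (hz : z ∈ T.net j) (φ : X →L[ℝ] ℝ) (hφ : ∀ x, |φ x| ≤ ‖x‖)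
    (hφt : φ (T.dir (T.top j z)) = 1) :
    1 - 136 * ∑ q ∈ T.path j z, T.dev q + 128 * T.dev (j, z) ≤ |φ (T.dir (j, z))| := by
  have base : ∀ q, φ (T.dir q) = 1 → 1 - 136 * T.dev q + 128 * T.dev q ≤ |φ (T.dir q)| := by
    intro q hq
    rw [hq, abs_one]
    linarith [T.dev_nonneg q]
  induction j generalizing z with
  | zero =>
    rw [top_zero] at hφt
    rw [path_zero, Finset.sum_singleton]
    exact base _ hφt
  | succ j ih =>
    by_cases hs : T.Stays j z
    · rw [top_of_stays hs] at hφt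
      have hp := T.parent_mem j z hz
      have h0 := ih hp hφt
      rw [path_of_stays hs, Finset.sum_insert (not_mem_path_parent hz z)]
      obtain ⟨p, hpE, hp1, hp2⟩ := hs.2
      set x := T.parent j z
      have hr := T.r_pos j
      rw [r_succ] at hp1 hp2
      have hzx : dist z x ≤ T.r j := T.parent_dist j z hz
      have hzE := T.net_subset _ z hz
      obtain ⟨s, hs1⟩ := T.flat j x hp p hpE z hzE
        (by change _ ≤ 240 * T.r j; linarith [dist_triangle p z x])
        (by change _ ≤ 240 * T.r j; linarith)
      obtain ⟨s', hs2⟩ := T.flat (j + 1) z hz p hpE z hzE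
        (by change _ ≤ 240 * T.r (j + 1); rw [r_succ]; linarith)
        (by change _ ≤ 240 * T.r (j + 1); rw [r_succ, dist_self]; linarith)
      have h1 := (window_le φ hφ (T.dir_norm j x hp) hs1).1
      have h2 := (window_le φ hφ (T.dir_norm _ z hz) hs2).2
      change _ - 2 * (_ * T.r j) ≤ _ at h1
      change _ ≤ _ + 2 * (_ * T.r (j + 1)) at h2
      rw [r_succ] at h2
      rw [← dist_eq_norm] at h1 h2
      set D := dist p z
      have hD : 0 < D := by linarith
      have h3 : D * |φ (T.dir (j, x))| ≤
          D * (|φ (T.dir (j + 1, z))| + 128 * T.dev (j, x) + 8 * T.dev (j + 1, z)) := by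
        have e1 : T.dev (j, x) * T.r j ≤ T.dev (j, x) * (64 * D) :=
          mul_le_mul_of_nonneg_left (by linarith) (T.dev_nonneg _)
        have e2 : T.dev (j + 1, z) * (T.r j / 16) ≤ T.dev (j + 1, z) * (4 * D) :=
          mul_le_mul_of_nonneg_left (by linarith) (T.dev_nonneg _)
        linarith
      have h4 := le_of_mul_le_mul_left h3 hD
      linarith
    · rw [top_of_not_stays hs] at hφt
      rw [path_of_not_stays hs, Finset.sum_singleton]
      exact base _ hφt

lemma sees {j : ℕ} {x : X} (hx : x ∈ T.net j) (φ : X →L[ℝ] ℝ) (hφ : ∀ x, |φ x| ≤ ‖x‖)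
    (hφt : φ (T.dir (T.top j x)) = 1) (ht : T.dev (T.top j x) ≤ 1 / 1000) {z p : X}
    (hz : z ∈ T.E) (hp : p ∈ T.E) (hzx : dist z x ≤ 2 * T.r j) (h1 : T.r j / 64 ≤ dist p z)
    (h2 : dist p z ≤ 3 * T.r (T.top j x).1) : dist p z / 2 ≤ |φ (p - z)| := by
  have near : ∀ j x, x ∈ T.net j → φ (T.dir (T.top j x)) = 1 → T.dev (T.top j x) ≤ 1 / 1000 →
      dist z x ≤ 2 * T.r j → T.r j / 64 ≤ dist p z → dist p z ≤ 3 * T.r j →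
      dist p z / 2 ≤ |φ (p - z)| := by
    intro j x hx hφt ht hzx h1 h2
    have hr := T.r_pos j
    have h3 := tilt hx φ hφ hφt
    have h4 := dev_le_of_top hx ht
    have h5 := (dev_le_sum_path (self_mem_path j x)).trans h4
    obtain ⟨s, hs⟩ := T.flat j x hx p hp z hz
      (by change _ ≤ 240 * T.r j; linarith [dist_triangle p z x])
      (by change _ ≤ 240 * T.r j; linarith)
    have h6 := (window_le φ hφ (T.dir_norm j x hx) hs).1
    change _ - 2 * (_ * T.r j) ≤ _ at h6
    rw [← dist_eq_norm] at h6
    set D := dist p z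
    have h7 : D * (1 - 136 / 1000) ≤ D * |φ (T.dir (j, x))| :=
      mul_le_mul_of_nonneg_left (by linarith [T.dev_nonneg (j, x)]) (by linarith)
    have h8 : T.dev (j, x) * T.r j ≤ 1 / 1000 * (64 * D) :=
      mul_le_mul h5 (by linarith) hr.le (by norm_num)
    linarith
  induction j generalizing x with
  | zero => exact near 0 x hx hφt ht hzx h1 h2
  | succ j ih =>
    rcases le_total (dist p z) (3 * T.r (j + 1)) with h3 | h3
    · exact near _ x hx hφt ht hzx h1 h3
    · by_cases hs : T.Stays j x
      · rw [top_of_stays hs] at hφt ht h2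
        have h4 : dist x (T.parent j x) ≤ T.r j := T.parent_dist j x hx
        have hr := T.r_pos j
        rw [r_succ] at hzx h3
        exact ih (T.parent_mem j x hx) hφt ht
          (by linarith [dist_triangle z x (T.parent j x)]) (by linarith) h2
      · rw [top_of_not_stays hs] at h2
        exact near _ x hx hφt ht hzx h1 h2

variable (T)

/-- All nodes up to level `n`. -/
def nodes (n : ℕ) : Finset (ℕ × X) :=
  (Finset.range (n + 1)).biUnion fun i => (T.net i).image (Prod.mk i)

/-- The top of the region containing the parent of a node. -/
def parentTop (q : ℕ × X) : ℕ × X := T.top (q.1 - 1) (T.parent (q.1 - 1) q.2)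

/-- The top nodes of the stopping-time regions up to level `n`. -/
def tops (n : ℕ) : Finset (ℕ × X) := (T.nodes n).filter fun q => T.top q.1 q.2 = q

/-- The nodes up to level `n` at which the region with top `t` ends. -/
def ends (n : ℕ) (t : ℕ × X) : Finset (ℕ × X) :=
  (T.nodes n).filter fun q => q.1 ≠ 0 ∧ T.parentTop q = t ∧ (q ∈ T.tops n ∨ q.1 = n)

variable {T}

lemma mem_nodes {n : ℕ} {q : ℕ × X} : q ∈ T.nodes n ↔ q.1 ≤ n ∧ q.2 ∈ T.net q.1 := by
  obtain ⟨i, x⟩ := q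
  simp [nodes]

lemma mem_tops {n : ℕ} {q : ℕ × X} : q ∈ T.tops n ↔ q ∈ T.nodes n ∧ T.top q.1 q.2 = q := by
  simp [tops]

lemma mem_tops_succ {n j : ℕ} {z : X} (h : (j + 1, z) ∈ T.nodes n) :
    (j + 1, z) ∈ T.tops n ↔ ¬ T.Stays j z := by
  rw [mem_tops]
  refine ⟨fun h1 hs => ?_, fun hs => ⟨h, top_of_not_stays hs⟩⟩
  have h2 := h1.2
  simp only [top_of_stays hs] at h2
  have h3 := (of_mem_path (T.parent_mem j z (mem_nodes.1 h).2) (top_mem_path j _)).1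
  rw [h2] at h3
  simp at h3

lemma mem_ends {n j : ℕ} {z : X} {t : ℕ × X} : (j + 1, z) ∈ T.ends n t ↔
    (j + 1, z) ∈ T.nodes n ∧ T.top j (T.parent j z) = t ∧ (¬ T.Stays j z ∨ j + 1 = n) := by
  rw [ends, Finset.mem_filter]
  constructor
  · rintro ⟨h1, -, h2, h3⟩
    exact ⟨h1, h2, h3.imp_left (mem_tops_succ h1).1⟩
  · rintro ⟨h1, h2, h3⟩
    exact ⟨h1, by simp, h2, h3.imp_left (mem_tops_succ h1).2⟩

lemma exists_succ_of_mem_ends {n : ℕ} {t q : ℕ × X} (h : q ∈ T.ends n t) :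
    ∃ j z, q = (j + 1, z) := by
  obtain ⟨j, z⟩ := q
  have := (Finset.mem_filter.1 h).2.1
  exact ⟨j - 1, z, by simp only [Prod.mk.injEq, and_true]; simp only at this; omega⟩

lemma top_mem_nodes {n j : ℕ} {x : X} (hx : x ∈ T.net j) (hj : j ≤ n) :
    T.top j x ∈ T.tops n := by
  obtain ⟨h1, h2, h3, -⟩ := of_mem_path hx (top_mem_path j x)
  exact mem_tops.2 ⟨mem_nodes.2 ⟨h1.trans hj, h2⟩, h3⟩

lemma dist_le_of_mem_path {j : ℕ} {z : X} (hz : z ∈ T.net (j + 1)) {q : ℕ × X}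
    (hq : q ∈ T.path j (T.parent j z)) : dist q.2 z ≤ 16 / 15 * T.r q.1 := by
  have h1 := (of_mem_path (T.parent_mem j z hz) hq).2.2.2
  have h2 : _ ≤ T.r j := T.parent_dist j z hz
  have h3 := dist_triangle_right q.2 z (T.parent j z)
  linarith [T.r_pos j]

/-- Distinct end nodes of a region are separated at the scale of the larger one. -/
lemma separated_ends_aux {n j j' : ℕ} {z z' : X} {t : ℕ × X} (h : (j + 1, z) ∈ T.ends n t)
    (h' : (j' + 1, z') ∈ T.ends n t) (hjj : j ≤ j') (hne : (j + 1, z) ≠ (j' + 1, z')) :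
    T.r (j + 1) / 4 ≤ dist z z' := by
  obtain ⟨h1, h2, h3⟩ := mem_ends.1 h
  obtain ⟨h1', h2', h3'⟩ := mem_ends.1 h'
  have hz := (mem_nodes.1 h1).2
  have hz' := (mem_nodes.1 h1').2
  have hjn := (mem_nodes.1 h1').1
  simp only at hz hz' hjn
  have hr := T.r_pos (j + 1)
  rcases hjj.eq_or_lt with rfl | hlt
  · have hzz : z ≠ z' := fun h => hne (by rw [h])
    have : T.r (j + 1) ≤ _ := T.net_sep _ z hz z' hz' hzz
    linarith
  · have hs : ¬ T.Stays j z := h3.resolve_right (by omega)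
    by_contra hd
    push Not at hd
    have hk : (T.top j (T.parent j z)).1 ≤ j :=
      (of_mem_path (T.parent_mem j z hz) (top_mem_path j _)).1
    have hp' := T.parent_mem j' z' hz'
    obtain ⟨x, hx⟩ := exists_mem_path hp' (l := j + 1)
      (by rw [h2', ← h2]; omega) (by omega)
    have hxz := eq_of_dist_lt hz' hz hx (by linarith [T.r_pos j'])
    subst hxz
    have h4 := (of_mem_path hp' hx).2.2.1
    simp only [top_of_not_stays hs] at h4
    rw [h2', ← h2] at h4
    rw [← h4] at hk
    simp at hk

lemma exists_functional {n : ℕ} {t : ℕ × X} (ht : t ∈ T.nodes n) (hdev : T.dev t ≤ 1 / 1000) :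
    ∃ φ : X →L[ℝ] ℝ, (∀ x, |φ x| ≤ ‖x‖) ∧
      (∀ q ∈ T.ends n t, dist t.2 q.2 / 2 ≤ |φ t.2 - φ q.2|) ∧
      ∀ q ∈ T.ends n t, ∀ q' ∈ T.ends n t, q ≠ q' →
        T.r q.1 / 4 ≤ dist q.2 q'.2 ∧ dist q.2 q'.2 / 2 ≤ |φ q.2 - φ q'.2| := by
  obtain ⟨φ, hφ, hφt⟩ := exists_norming (T.dir_norm t.1 t.2 (mem_nodes.1 ht).2)
  have ends_near : ∀ j z, (j + 1, z) ∈ T.ends n t → dist t.2 z ≤ 16 / 15 * T.r t.1 := by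
    intro j z h
    obtain ⟨h1, h2, -⟩ := mem_ends.1 h
    have h3 := dist_le_of_mem_path (mem_nodes.1 h1).2 (top_mem_path j (T.parent j z))
    rwa [h2] at h3
  have key : ∀ j z, (j + 1, z) ∈ T.ends n t → ∀ p ∈ T.E, T.r (j + 1) / 4 ≤ dist p z →
      dist p z ≤ 3 * T.r t.1 → dist p z / 2 ≤ |φ p - φ z| := by
    intro j z h p hp h1 h2
    obtain ⟨h3, h4, -⟩ := mem_ends.1 h
    have hz := (mem_nodes.1 h3).2
    have h5 : _ ≤ T.r j := T.parent_dist j z hz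
    rw [← map_sub]
    rw [r_succ] at h1
    exact sees (T.parent_mem j z hz) φ hφ (by rw [h4]; exact hφt) (by rw [h4]; exact hdev)
      (T.net_subset _ z hz) hp (by linarith [T.r_pos j]) (by linarith) (by rw [h4]; exact h2)
  have hr := T.r_pos t.1
  refine ⟨φ, hφ, ?_, ?_⟩
  · intro q hq
    obtain ⟨j, z, rfl⟩ := exists_succ_of_mem_ends hq
    have hdist := ends_near j z hq
    rcases eq_or_ne t.2 z with h | h
    · simp [h]
    · obtain ⟨h1, h2, -⟩ := mem_ends.1 hq
      have hk := (of_mem_path (T.parent_mem j z (mem_nodes.1 h1).2) (top_mem_path j _)).1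
      rw [h2] at hk
      have htn := (mem_nodes.1 ht).2
      have h3 : T.r (j + 1) ≤ _ := T.net_sep (j + 1) t.2 (T.net_le (by omega) htn) z
        (mem_nodes.1 h1).2 h
      exact key j z hq _ (T.net_subset _ _ htn) (by linarith [T.r_pos (j + 1)]) (by linarith)
  · intro q hq q' hq' hne
    obtain ⟨j, z, rfl⟩ := exists_succ_of_mem_ends hq
    obtain ⟨j', z', rfl⟩ := exists_succ_of_mem_ends hq'
    have hdist := ends_near j z hq
    have hdist' := ends_near j' z' hq'
    have h3 := dist_triangle_left z z' t.2
    have hE := T.net_subset _ _ (mem_nodes.1 (mem_ends.1 hq).1).2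
    have hE' := T.net_subset _ _ (mem_nodes.1 (mem_ends.1 hq').1).2
    simp only at hE hE' ⊢
    have hsep : T.r (j + 1) / 4 ≤ dist z z' ∧ T.r (j' + 1) / 4 ≤ dist z z' := by
      rcases le_total j j' with h | h
      · have h4 := separated_ends_aux hq hq' h hne
        exact ⟨h4, by linarith [T.r_anti (Nat.succ_le_succ h)]⟩
      · have h4 := separated_ends_aux hq' hq h hne.symm
        rw [dist_comm] at h4
        exact ⟨by linarith [T.r_anti (Nat.succ_le_succ h)], h4⟩
    refine ⟨hsep.1, ?_⟩
    exact dist_comm z z' ▸ abs_sub_comm (φ z) (φ z') ▸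
      key j z hq z' hE' (dist_comm z z' ▸ hsep.1) (dist_comm z z' ▸ by linarith)

lemma mem_path_nodes {n j : ℕ} {z : X} (hz : z ∈ T.net j) (hj : j ≤ n) :
    T.path j z ⊆ T.nodes n := fun q hq => by
  obtain ⟨h1, h2, -⟩ := of_mem_path hz hq
  exact mem_nodes.2 ⟨h1.trans hj, h2⟩

lemma dev_top_le {j : ℕ} {z : X} (hz : z ∈ T.net j) (h : T.dev (j, z) ≤ 1 / 1000) :
    T.dev (T.top j z) ≤ 1 / 1000 :=
  (dev_le_sum_path (top_mem_path j z)).trans (sum_path_le h hz)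

lemma top_eq_self_of_dev {j : ℕ} {z : X} (hz : z ∈ T.net j) (h : 1 / 1000 < T.dev (T.top j z)) :
    T.top j z = (j, z) := by
  cases j with
  | zero => rfl
  | succ j =>
    by_cases hs : T.Stays j z
    · have h1 := dev_le_sum_path (T := T) (top_mem_path (j + 1) z)
      rw [path_of_stays hs, Finset.sum_insert (not_mem_path_parent hz z)] at h1
      linarith [hs.1]
    · exact top_of_not_stays hs

/-- Packing of separated end nodes of a region inside a ball. -/
lemma packing {n : ℕ} {t : ℕ × X} (ht : t ∈ T.nodes n) (hdev : T.dev t ≤ 1 / 1000)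
    {Z : Finset (ℕ × X)} (hZ : Z ⊆ T.ends n t) {x : X} {R m c : ℝ} (hR : 0 ≤ R) (hm : 0 ≤ m)
    (hc : 0 ≤ c) (hx : ∀ q ∈ Z, dist x q.2 ≤ R) (hr : ∀ q ∈ Z, T.r q.1 ≤ m)
    (hsep : ∀ q ∈ Z, ∀ q' ∈ Z, q ≠ q' → 2 * c * T.r q.1 ≤ dist q.2 q'.2) :
    c * ∑ q ∈ Z, T.r q.1 ≤ 2 * R + c * m := by
  obtain ⟨φ, hφ, -, h2⟩ := exists_functional ht hdev
  have hφx : ∀ q ∈ Z, |φ x - φ q.2| ≤ R := by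
    intro q hq
    rw [← map_sub]
    exact (hφ _).trans (by rw [← dist_eq_norm]; exact hx q hq)
  have h := sum_le_of_separated Z (fun q => φ q.2) (fun q => T.r q.1) c (φ x - R) m hc hm
    (φ x + R) (by linarith) (fun q hq => by linarith [(abs_le.1 (hφx q hq)).2])
    (fun q hq => by linarith [(abs_le.1 (hφx q hq)).1]) hr (fun q _ => (T.r_pos _).le)
    (fun q hq q' hq' hne => by
      have h3 := (h2 q (hZ hq) q' (hZ hq') hne).2
      have h4 := hsep q hq q' hq' hne
      linarith)
  linarith

end Tower

/-- Packing of separated points in a ball in which they are close to a line. -/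
lemma sum_le_of_flat {X : Type u} [NormedAddCommGroup X] [NormedSpace ℝ X] {v c : X}
    (hv : ‖v‖ = 1) (W : Finset X) {δ R : ℝ} (hδ : 0 ≤ δ) (hR : 0 ≤ R)
    (hW : ∀ z ∈ W, dist c z ≤ R) (hsep : ∀ z ∈ W, ∀ w ∈ W, z ≠ w → δ ≤ dist z w)
    (hflat : ∀ z ∈ W, ∀ w ∈ W, ∃ s : ℝ, ‖z - w - s • v‖ ≤ δ / 4) :
    ∑ _z ∈ W, δ ≤ 4 * R + δ := by
  obtain ⟨φ, hφ, hφv⟩ := exists_norming hv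
  have hφx : ∀ q ∈ W, |φ c - φ q| ≤ R := by
    intro q hq
    rw [← map_sub]
    exact (hφ _).trans (by rw [← dist_eq_norm]; exact hW q hq)
  have h := sum_le_of_separated W φ (fun _ => δ) (1 / 2) (φ c - R) δ (by norm_num) hδ
    (φ c + R) (by linarith) (fun q hq => by linarith [(abs_le.1 (hφx q hq)).2])
    (fun q hq => by linarith [(abs_le.1 (hφx q hq)).1]) (fun _ _ => le_rfl) (fun _ _ => hδ)
    (fun z hz w hw hne => by
      obtain ⟨s, hs⟩ := hflat z hz w hw
      have h3 := (window_le φ hφ hv hs).1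
      rw [hφv, abs_one, mul_one, ← dist_eq_norm, map_sub] at h3
      linarith [hsep z hz w hw hne])
  linarith

namespace Tower

variable {X : Type u} [NormedAddCommGroup X] [NormedSpace ℝ X] (T : Tower X)

/-- The parent of a node. -/
def parentNode (q : ℕ × X) : ℕ × X := (q.1 - 1, T.parent (q.1 - 1) q.2)

/-- The top nodes other than the root. -/
def lowerTops (n : ℕ) : Finset (ℕ × X) := (T.tops n).filter fun q => q.1 ≠ 0

variable {T}

lemma mem_lowerTops {n : ℕ} {q : ℕ × X} (hq : q ∈ T.lowerTops n) :
    ∃ j z, q = (j + 1, z) ∧ (j + 1, z) ∈ T.nodes n ∧ z ∈ T.net (j + 1) ∧ j + 1 ≤ n ∧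
      ¬ T.Stays j z := by
  obtain ⟨j, z⟩ := q
  obtain ⟨h1, h2⟩ := Finset.mem_filter.1 hq
  obtain ⟨j, rfl⟩ := Nat.exists_eq_succ_of_ne_zero h2
  have h3 := (mem_tops.1 h1).1
  exact ⟨j, z, rfl, h3, (mem_nodes.1 h3).2, (mem_nodes.1 h3).1, (mem_tops_succ h3).1 h1⟩

lemma parentTop_mem {n : ℕ} {q : ℕ × X} (hq : q ∈ T.lowerTops n) :
    T.parentTop q ∈ T.tops n := by
  obtain ⟨j, z, rfl, -, hz, hjn, -⟩ := mem_lowerTops hq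
  exact top_mem_nodes (T.parent_mem j z hz) (by omega)

lemma mem_ends_of_lowerTops {n : ℕ} {q : ℕ × X} (hq : q ∈ T.lowerTops n) :
    q ∈ T.ends n (T.parentTop q) := by
  obtain ⟨j, z, rfl, h1, hz, hjn, hs⟩ := mem_lowerTops hq
  exact mem_ends.2 ⟨h1, rfl, Or.inl hs⟩

/-- Total weight of the tops whose parent has large deviation. -/
lemma sum_bad_parent (n : ℕ) :
    ∑ q ∈ (T.lowerTops n).filter (fun q => 1 / 1000 < T.dev (T.parentNode q)), T.r q.1 ≤
      6000 * ∑ q ∈ T.nodes n, T.dev q * T.r q.1 := by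
  set Z := (T.lowerTops n).filter (fun q => 1 / 1000 < T.dev (T.parentNode q)) with hZ
  have hZsub : Z ⊆ T.nodes n := fun q hq =>
    (mem_tops.1 (Finset.mem_filter.1 (Finset.mem_filter.1 hq).1).1).1
  have hnn : ∀ q, 0 ≤ T.dev q * T.r q.1 := fun q => mul_nonneg (T.dev_nonneg q) (T.r_pos _).le
  have hmaps : ∀ q ∈ Z, T.parentNode q ∈ T.nodes n := by
    intro q hq
    obtain ⟨j, z, rfl, h1, hz, hjn, hs⟩ := mem_lowerTops (Finset.mem_filter.1 hq).1
    exact mem_nodes.2 ⟨by simp only [parentNode]; omega, T.parent_mem j z hz⟩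
  have key : ∀ p ∈ T.nodes n, ∑ q ∈ Z with T.parentNode q = p, T.r q.1 ≤
      5000 * (T.dev p * T.r p.1) +
        1000 * ∑ q ∈ Z with T.parentNode q = p, T.dev q * T.r q.1 := by
    intro p hp
    set F := Z.filter (fun q => T.parentNode q = p) with hF
    have hFm : ∀ q ∈ F, ∃ z, q = (p.1 + 1, z) ∧ z ∈ T.net (p.1 + 1) ∧ dist p.2 z ≤ T.r p.1 ∧
        1 / 1000 < T.dev p := by
      intro q hq
      obtain ⟨h1, h2⟩ := Finset.mem_filter.1 hq
      obtain ⟨h3, h4⟩ := Finset.mem_filter.1 h1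
      obtain ⟨j, z, rfl, -, hz, -, -⟩ := mem_lowerTops h3
      rw [h2] at h4
      subst h2
      refine ⟨z, rfl, hz, ?_, h4⟩
      rw [dist_comm]
      exact T.parent_dist j z hz
    have hs0 : 0 ≤ ∑ q ∈ F, T.dev q * T.r q.1 := Finset.sum_nonneg fun q _ => hnn q
    by_cases hbad : ∀ q ∈ F, 1 / 1000 < T.dev q
    · have : ∑ q ∈ F, T.r q.1 ≤ 1000 * ∑ q ∈ F, T.dev q * T.r q.1 := by
        rw [Finset.mul_sum]
        refine Finset.sum_le_sum fun q hq => ?_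
        nlinarith [hbad q hq, T.r_pos q.1]
      linarith [hnn p]
    · push Not at hbad
      obtain ⟨q₀, hq₀, hq₀'⟩ := hbad
      obtain ⟨z₀, rfl, hz₀, hd₀, hdev⟩ := hFm q₀ hq₀
      have hr := T.r_pos p.1
      have hsum : ∑ q ∈ F, T.r q.1 = ∑ _z ∈ F.image Prod.snd, T.r (p.1 + 1) := by
        rw [Finset.sum_image]
        · refine Finset.sum_congr rfl fun q hq => ?_
          obtain ⟨z, rfl, -⟩ := hFm q hq
          rfl
        · intro q hq q' hq' h
          obtain ⟨z, rfl, -⟩ := hFm q hq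
          obtain ⟨z', rfl, -⟩ := hFm q' hq'
          simp only at h
          rw [h]
      have hFz : ∀ z ∈ F.image Prod.snd, z ∈ T.net (p.1 + 1) ∧ dist p.2 z ≤ T.r p.1 := by
        intro z hz
        obtain ⟨q, hq, rfl⟩ := Finset.mem_image.1 hz
        obtain ⟨z, rfl, h1, h2, -⟩ := hFm q hq
        exact ⟨h1, h2⟩
      have hnear : ∀ z ∈ F.image Prod.snd, dist z z₀ ≤ 240 * T.r (p.1 + 1) := by
        intro z hz
        have := dist_triangle_left z z₀ p.2
        rw [r_succ]
        linarith [(hFz z hz).2]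
      have h1 := sum_le_of_flat (T.dir_norm _ z₀ hz₀) (F.image Prod.snd)
        (T.r_pos (p.1 + 1)).le hr.le (fun z hz => (hFz z hz).2)
        (fun z hz w hw hne => T.net_sep _ z (hFz z hz).1 w (hFz w hw).1 hne)
        (fun z hz w hw => by
          obtain ⟨s, hs⟩ := T.flat _ z₀ hz₀ z (T.net_subset _ z (hFz z hz).1) w
            (T.net_subset _ w (hFz w hw).1) (hnear z hz) (hnear w hw)
          refine ⟨s, hs.trans ?_⟩
          change _ * T.r (p.1 + 1) ≤ _
          nlinarith [T.r_pos (p.1 + 1)])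
      rw [hsum]
      rw [r_succ] at h1 ⊢
      nlinarith
  rw [← Finset.sum_fiberwise_of_maps_to hmaps]
  refine (Finset.sum_le_sum key).trans ?_
  rw [Finset.sum_add_distrib, ← Finset.mul_sum, ← Finset.mul_sum,
    Finset.sum_fiberwise_of_maps_to hmaps]
  have := Finset.sum_le_sum_of_subset_of_nonneg hZsub (fun q _ _ => hnn q)
  linarith

/-- Total weight of the tops at which the accumulated deviation is large. -/
lemma sum_large_deviation (n : ℕ) :
    ∑ q ∈ (T.lowerTops n).filter (fun q => T.dev (T.parentNode q) ≤ 1 / 1000 ∧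
      1 / 1000 < ∑ c ∈ T.path (T.parentNode q).1 (T.parentNode q).2, T.dev c + T.dev q), T.r q.1 ≤
      19000 * ∑ q ∈ T.nodes n, T.dev q * T.r q.1 := by
  set P : ℕ × X → Finset (ℕ × X) := fun q => T.path (T.parentNode q).1 (T.parentNode q).2 with hP
  set Z := (T.lowerTops n).filter (fun q => T.dev (T.parentNode q) ≤ 1 / 1000 ∧
      1 / 1000 < ∑ c ∈ P q, T.dev c + T.dev q) with hZ
  have hZsub : Z ⊆ T.nodes n := fun q hq =>
    (mem_tops.1 (Finset.mem_filter.1 (Finset.mem_filter.1 hq).1).1).1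
  have hnn : ∀ q, 0 ≤ T.dev q * T.r q.1 := fun q => mul_nonneg (T.dev_nonneg q) (T.r_pos _).le
  have hPsub : ∀ q ∈ Z, P q ⊆ T.nodes n := by
    intro q hq
    obtain ⟨j, z, rfl, h1, hz, hjn, hs⟩ := mem_lowerTops (Finset.mem_filter.1 hq).1
    exact mem_path_nodes (T.parent_mem j z hz) (by simp only [parentNode]; omega)
  have h1 : ∑ q ∈ Z, T.r q.1 ≤
      1000 * (∑ q ∈ Z, ∑ c ∈ P q, T.dev c * T.r q.1 + ∑ q ∈ Z, T.dev q * T.r q.1) := by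
    rw [← Finset.sum_add_distrib, Finset.mul_sum]
    refine Finset.sum_le_sum fun q hq => ?_
    rw [← Finset.sum_mul]
    have := (Finset.mem_filter.1 hq).2.2
    nlinarith [T.r_pos q.1]
  have h2 : ∑ q ∈ Z, ∑ c ∈ P q, T.dev c * T.r q.1 =
      ∑ c ∈ T.nodes n, ∑ q ∈ Z with c ∈ P q, T.dev c * T.r q.1 := by
    refine Finset.sum_comm' fun q c => ?_
    exact ⟨fun h => ⟨Finset.mem_filter.2 ⟨h.1, h.2⟩, hPsub q h.1 h.2⟩,
      fun h => Finset.mem_filter.1 h.1⟩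
  have h3 : ∀ c ∈ T.nodes n, ∑ q ∈ Z with c ∈ P q, T.dev c * T.r q.1 ≤
      18 * (T.dev c * T.r c.1) := by
    intro c hc
    set F := Z.filter (fun q => c ∈ P q) with hF
    rw [← Finset.mul_sum]
    suffices h : ∑ q ∈ F, T.r q.1 ≤ 18 * T.r c.1 by
      nlinarith [T.dev_nonneg c]
    have hrc := T.r_pos c.1
    rcases F.eq_empty_or_nonempty with h0 | ⟨q₀, hq₀⟩
    · rw [h0, Finset.sum_empty]
      positivity
    have hFm : ∀ q ∈ F, q ∈ T.ends n (T.top c.1 c.2) ∧ dist c.2 q.2 ≤ 16 / 15 * T.r c.1 ∧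
        T.r q.1 ≤ T.r c.1 / 16 ∧ T.dev (T.top c.1 c.2) ≤ 1 / 1000 := by
      intro q hq
      obtain ⟨hqZ, hcq⟩ := Finset.mem_filter.1 hq
      obtain ⟨hql, hdev, -⟩ := Finset.mem_filter.1 hqZ
      have hends := mem_ends_of_lowerTops hql
      obtain ⟨j, z, rfl, -, hz, hjn, hs⟩ := mem_lowerTops hql
      have hp := T.parent_mem j z hz
      obtain ⟨g1, g2, g3, g4⟩ := of_mem_path hp hcq
      refine ⟨by rw [g3]; exact hends, dist_le_of_mem_path hz hcq,
        T.r_lt (Nat.lt_succ_of_le g1), ?_⟩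
      rw [g3]
      exact dev_top_le hp hdev
    have hdev := (hFm q₀ hq₀).2.2.2
    have htop := (mem_tops.1 (top_mem_nodes (mem_nodes.1 hc).2 (mem_nodes.1 hc).1)).1
    have hpack := packing htop hdev (Z := F) (x := c.2) (R := 16 / 15 * T.r c.1)
      (m := T.r c.1 / 16) (c := 1 / 8) (fun q hq => (hFm q hq).1) (by positivity) (by positivity)
      (by norm_num) (fun q hq => (hFm q hq).2.1) (fun q hq => (hFm q hq).2.2.1)
      (fun q hq q' hq' hne => by
        obtain ⟨φ, -, -, h⟩ := exists_functional htop hdev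
        linarith [(h q (hFm q hq).1 q' (hFm q' hq').1 hne).1])
    linarith
  have h4 := Finset.sum_le_sum h3
  rw [← Finset.mul_sum, ← h2] at h4
  have h5 := Finset.sum_le_sum_of_subset_of_nonneg hZsub (fun q _ _ => hnn q)
  linarith

/-- Total weight of the tops that have no neighbours at comparable distances. -/
lemma sum_isolated (n : ℕ) :
    ∑ q ∈ (T.lowerTops n).filter (fun q => T.dev (T.parentNode q) ≤ 1 / 1000 ∧
      ¬ T.Spread q.1 q.2), T.r q.1 ≤ (∑ q ∈ T.tops n, T.r q.1) / 8 := by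
  set Z := (T.lowerTops n).filter (fun q => T.dev (T.parentNode q) ≤ 1 / 1000 ∧
      ¬ T.Spread q.1 q.2) with hZ
  have hmaps : ∀ q ∈ Z, T.parentTop q ∈ T.tops n := fun q hq =>
    parentTop_mem (Finset.mem_filter.1 hq).1
  rw [← Finset.sum_fiberwise_of_maps_to hmaps, Finset.sum_div]
  refine Finset.sum_le_sum fun t ht => ?_
  set F := Z.filter (fun q => T.parentTop q = t) with hF
  have hrt := T.r_pos t.1
  rcases F.eq_empty_or_nonempty with h0 | ⟨q₀, hq₀⟩
  · rw [h0, Finset.sum_empty]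
    positivity
  have htn := (mem_tops.1 ht).1
  have hFm : ∀ q ∈ F, q ∈ T.ends n t ∧ dist t.2 q.2 ≤ 16 / 15 * T.r t.1 ∧
      T.r q.1 ≤ T.r t.1 / 16 ∧ T.dev t ≤ 1 / 1000 ∧ q.2 ∈ T.E ∧ ¬ T.Spread q.1 q.2 := by
    intro q hq
    obtain ⟨hqZ, rfl⟩ := Finset.mem_filter.1 hq
    obtain ⟨hql, hdev, hsp⟩ := Finset.mem_filter.1 hqZ
    have hends := mem_ends_of_lowerTops hql
    obtain ⟨j, z, rfl, -, hz, hjn, hs⟩ := mem_lowerTops hql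
    have hp := T.parent_mem j z hz
    have hmem := top_mem_path (T := T) j (T.parent j z)
    exact ⟨hends, dist_le_of_mem_path hz hmem,
      T.r_lt (Nat.lt_succ_of_le (of_mem_path hp hmem).1), dev_top_le hp hdev,
      T.net_subset _ z hz, hsp⟩
  have hdev := (hFm q₀ hq₀).2.2.2.1
  have hpack := packing htn hdev (Z := F) (x := t.2) (R := 16 / 15 * T.r t.1)
    (m := T.r t.1 / 16) (c := 120) (fun q hq => (hFm q hq).1) (by positivity) (by positivity)
    (by norm_num) (fun q hq => (hFm q hq).2.1) (fun q hq => (hFm q hq).2.2.1)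
    (fun q hq q' hq' hne => by
      obtain ⟨φ, -, -, h⟩ := exists_functional htn hdev
      have h1 := (h q (hFm q hq).1 q' (hFm q' hq').1 hne).1
      by_contra h2
      push Not at h2
      rw [dist_comm] at h1 h2
      exact (hFm q hq).2.2.2.2.2 ⟨q'.2, (hFm q' hq').2.2.2.2.1, h1, by linarith⟩)
  linarith

lemma sum_tops_le (n : ℕ) :
    ∑ q ∈ T.tops n, T.r q.1 ≤ 2 * T.ρ + 60000 * ∑ q ∈ T.nodes n, T.dev q * T.r q.1 := by
  have h1 := T.sum_bad_parent n
  have h2 := T.sum_large_deviation n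
  have h3 := T.sum_isolated n
  have h4 : ∑ q ∈ (T.tops n).filter (fun q => ¬ q.1 ≠ 0), T.r q.1 ≤ T.ρ := by
    have hsub : (T.tops n).filter (fun q => ¬ q.1 ≠ 0) ⊆ {(0, T.root)} := by
      rintro ⟨i, x⟩ hq
      obtain ⟨h, h'⟩ := Finset.mem_filter.1 hq
      have hx := (mem_nodes.1 (mem_tops.1 h).1).2
      simp only [ne_eq, not_not] at h' hx
      subst h'
      rw [T.net_zero, Finset.mem_singleton] at hx
      simp [hx]
    refine (Finset.sum_le_sum_of_subset_of_nonneg hsub fun q _ _ => (T.r_pos _).le).trans ?_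
    simp [r]
  have h5 : ∑ q ∈ T.lowerTops n, T.r q.1 + _ = _ :=
    Finset.sum_filter_add_sum_filter_not (T.tops n) (fun q => q.1 ≠ 0) (fun q => T.r q.1)
  set P : ℕ × X → Prop := fun q => 1 / 1000 < T.dev (T.parentNode q)
  set Q : ℕ × X → Prop := fun q => T.dev (T.parentNode q) ≤ 1 / 1000 ∧
    1 / 1000 < ∑ c ∈ T.path (T.parentNode q).1 (T.parentNode q).2, T.dev c + T.dev q
  set R : ℕ × X → Prop := fun q => T.dev (T.parentNode q) ≤ 1 / 1000 ∧ ¬ T.Spread q.1 q.2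
  have h6 : T.lowerTops n ⊆ (T.lowerTops n).filter P ∪ (T.lowerTops n).filter Q ∪
      (T.lowerTops n).filter R := by
    intro q hq
    simp only [Finset.mem_union, Finset.mem_filter, hq, true_and]
    by_contra hcon
    simp only [P, Q, R, not_or, not_and, not_lt, not_not] at hcon
    obtain ⟨⟨g1, g2⟩, g3⟩ := hcon
    have g2 := g2 g1
    have g3 := g3 g1
    obtain ⟨j, z, rfl, -, -, -, hs⟩ := mem_lowerTops hq
    exact hs ⟨g2, g3⟩
  have hpos : ∀ q ∈ (T.lowerTops n).filter P ∪ (T.lowerTops n).filter Q ∪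
      (T.lowerTops n).filter R, 0 ≤ T.r q.1 := fun q _ => (T.r_pos _).le
  have h7 := Finset.sum_le_sum_of_subset_of_nonneg (f := fun q => T.r q.1) h6
    (fun q _ _ => (T.r_pos _).le)
  have h8 := Finset.sum_union_inter (s₁ := (T.lowerTops n).filter P ∪ (T.lowerTops n).filter Q)
    (s₂ := (T.lowerTops n).filter R) (f := fun q => T.r q.1)
  have h9 := Finset.sum_union_inter (s₁ := (T.lowerTops n).filter P)
    (s₂ := (T.lowerTops n).filter Q) (f := fun q => T.r q.1)
  have h10 : ∀ s : Finset (ℕ × X), 0 ≤ ∑ q ∈ s, T.r q.1 := fun s =>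
    Finset.sum_nonneg fun q _ => (T.r_pos _).le
  have h11 : 0 ≤ ∑ q ∈ T.nodes n, T.dev q * T.r q.1 :=
    Finset.sum_nonneg fun q _ => mul_nonneg (T.dev_nonneg q) (T.r_pos _).le
  linarith [h10 (((T.lowerTops n).filter P ∪ (T.lowerTops n).filter Q) ∩ (T.lowerTops n).filter R),
    h10 ((T.lowerTops n).filter P ∩ (T.lowerTops n).filter Q), T.ρ_pos]

/-- The points at which a region is bounded. -/
def regionSet (T : Tower X) (n : ℕ) (t : ℕ × X) : Finset X :=
  insert t.2 ((T.ends n t).image Prod.snd)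

lemma hasLoop_region {K : Set X} (hK : Convex ℝ K) (hEK : T.E ⊆ K) {n : ℕ} {t : ℕ × X}
    (ht : t ∈ T.tops n) :
    HasLoop K (T.regionSet n t : Set X)
      (9 * T.r t.1 + 32 * ∑ q ∈ T.lowerTops n with T.parentTop q = t, T.r q.1) := by
  have htn := (mem_tops.1 ht).1
  have hrt := T.r_pos t.1
  have hsum : 0 ≤ ∑ q ∈ T.lowerTops n with T.parentTop q = t, T.r q.1 :=
    Finset.sum_nonneg fun q _ => (T.r_pos _).le
  have htK : t.2 ∈ K := hEK (T.net_subset _ _ (mem_nodes.1 htn).2)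
  have hqK : ∀ q ∈ T.ends n t, q.2 ∈ K := fun q hq =>
    hEK (T.net_subset _ _ (mem_nodes.1 (Finset.mem_filter.1 hq).1).2)
  have hclose : ∀ q ∈ T.ends n t, dist t.2 q.2 ≤ 16 / 15 * T.r t.1 := by
    intro q hq
    obtain ⟨j, z, rfl⟩ := exists_succ_of_mem_ends hq
    obtain ⟨h1, h2, -⟩ := mem_ends.1 hq
    have h3 := dist_le_of_mem_path (mem_nodes.1 h1).2 (top_mem_path j (T.parent j z))
    rwa [h2] at h3
  rcases le_or_gt (T.dev t) (1 / 1000) with hdev | hdev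
  · obtain ⟨φ, hφ, h1, h2⟩ := exists_functional htn hdev
    have hφt : ∀ q ∈ T.ends n t, |φ t.2 - φ q.2| ≤ 16 / 15 * T.r t.1 := by
      intro q hq
      rw [← map_sub]
      exact (hφ _).trans (by rw [← dist_eq_norm]; exact hclose q hq)
    have hmem : ∀ z ∈ T.regionSet n t, z = t.2 ∨ ∃ q ∈ T.ends n t, q.2 = z := by
      intro z hz
      rcases Finset.mem_insert.1 hz with h | h
      · exact Or.inl h
      · exact Or.inr (Finset.mem_image.1 h)
    have h3 := HasLoop.of_bilipschitz hK φ (φ t.2 - 16 / 15 * T.r t.1) (T.regionSet n t)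
      (φ t.2 + 16 / 15 * T.r t.1) (by linarith)
      (fun z hz => by
        rcases hmem z hz with rfl | ⟨q, hq, rfl⟩
        exacts [htK, hqK q hq])
      (fun z hz => by
        rcases hmem z hz with rfl | ⟨q, hq, rfl⟩
        · linarith
        · linarith [(abs_le.1 (hφt q hq)).2])
      (fun z hz => by
        rcases hmem z hz with rfl | ⟨q, hq, rfl⟩
        · linarith
        · linarith [(abs_le.1 (hφt q hq)).1])
      (fun z hz w hw => by
        rcases hmem z hz with rfl | ⟨q, hq, rfl⟩ <;> rcases hmem w hw with rfl | ⟨q', hq', rfl⟩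
        · simp
        · linarith [h1 q' hq']
        · rw [dist_comm, abs_sub_comm]
          linarith [h1 q hq]
        · by_cases hne : q = q'
          · simp [hne]
          · linarith [(h2 q hq q' hq' hne).2])
    refine h3.mono ?_
    linarith
  · have hstar := HasLoop.star hK htK ((T.ends n t).image Prod.snd) (fun z hz => by
      obtain ⟨q, hq, rfl⟩ := Finset.mem_image.1 hz
      exact hqK q hq)
    have hch : ∀ q ∈ T.ends n t, ∃ z, q = (t.1 + 1, z) ∧ dist t.2 z ≤ T.r t.1 ∧
        q ∈ T.lowerTops n := by
      intro q hq
      obtain ⟨j, z, rfl⟩ := exists_succ_of_mem_ends hq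
      obtain ⟨h1, h2, -⟩ := mem_ends.1 hq
      have hz := (mem_nodes.1 h1).2
      have hp := T.parent_mem j z hz
      have h4 := top_eq_self_of_dev hp (by rw [h2]; exact hdev)
      have hns : ¬ T.Stays j z := fun hs => by
        have h5 := dev_le_sum_path (T := T) (top_mem_path j (T.parent j z))
        rw [h2] at h5
        linarith [hs.1, T.dev_nonneg (j + 1, z)]
      rw [← h2, h4]
      refine ⟨z, rfl, ?_, Finset.mem_filter.2 ⟨(mem_tops_succ h1).2 hns, by simp⟩⟩
      rw [dist_comm]
      exact T.parent_dist j z hz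
    have hset : (T.regionSet n t : Set X) =
        insert t.2 (((T.ends n t).image Prod.snd : Finset X) : Set X) := by
      rw [regionSet, Finset.coe_insert]
    rw [hset]
    refine hstar.mono ?_
    rw [Finset.sum_image]
    · have hsub : T.ends n t ⊆ (T.lowerTops n).filter (fun q => T.parentTop q = t) := by
        intro q hq
        obtain ⟨z, -, -, h⟩ := hch q hq
        exact Finset.mem_filter.2 ⟨h, (Finset.mem_filter.1 hq).2.2.1⟩
      have h1 : ∑ q ∈ T.ends n t, 2 * dist t.2 q.2 ≤ ∑ q ∈ T.ends n t, 32 * T.r q.1 := by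
        refine Finset.sum_le_sum fun q hq => ?_
        obtain ⟨z, rfl, h, -⟩ := hch q hq
        rw [r_succ]
        linarith
      have h2 := Finset.sum_le_sum_of_subset_of_nonneg hsub (f := fun q => 32 * T.r q.1)
        (fun q _ _ => by have := T.r_pos q.1; positivity)
      rw [Finset.mul_sum]
      linarith
    · intro q hq q' hq' h
      obtain ⟨z, rfl, -⟩ := hch q hq
      obtain ⟨z', rfl, -⟩ := hch q' hq'
      simp only at h
      rw [h]

/-- The points of a net of a tower lie on a Lipschitz loop of controlled duration. -/
theorem exists_loop {K : Set X} (hK : Convex ℝ K) (hEK : T.E ⊆ K) (n : ℕ) :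
    ∃ f : ℝ → X, LipschitzWith 1 f ∧ (∀ t, f t ∈ K) ∧
      (T.net n : Set X) ⊆
        f '' Icc 0 (82 * T.ρ + 3000000 * ∑ q ∈ T.nodes n, T.dev q * T.r q.1) := by
  have hroot : (0, T.root) ∈ T.tops n := by
    refine mem_tops.2 ⟨mem_nodes.2 ⟨Nat.zero_le n, ?_⟩, rfl⟩
    simp [T.net_zero]
  have hloop := HasLoop.biUnion (K := K) Prod.fst (fun t => (T.regionSet n t : Set X))
    (fun t => 9 * T.r t.1 + 32 * ∑ q ∈ T.lowerTops n with T.parentTop q = t, T.r q.1)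
    (0, T.root) (T.tops n) hroot (fun t ht => hasLoop_region hK hEK ht) (by
      rintro ⟨i, x⟩ ht
      rcases Nat.eq_zero_or_pos i with rfl | hi
      · left
        have := (mem_nodes.1 (mem_tops.1 ht).1).2
        simp only [T.net_zero, Finset.mem_singleton] at this
        rw [this]
      · right
        have hl : (i, x) ∈ T.lowerTops n := Finset.mem_filter.2 ⟨ht, hi.ne'⟩
        refine ⟨_, parentTop_mem hl, ?_, x, ?_, ?_⟩
        · obtain ⟨j, z, h, -, hz, -, -⟩ := mem_lowerTops hl
          rw [h]
          exact Nat.lt_succ_of_le (of_mem_path (T.parent_mem j z hz) (top_mem_path j _)).1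
        · exact Finset.mem_coe.2 (Finset.mem_insert_of_mem
            (Finset.mem_image_of_mem Prod.snd (mem_ends_of_lowerTops hl)))
        · exact Finset.mem_coe.2 (Finset.mem_insert_self x _))
  rw [Finset.sum_add_distrib, ← Finset.mul_sum, ← Finset.mul_sum,
    Finset.sum_fiberwise_of_maps_to fun q hq => parentTop_mem hq] at hloop
  have h1 : ∑ q ∈ T.lowerTops n, T.r q.1 ≤ ∑ q ∈ T.tops n, T.r q.1 :=
    Finset.sum_le_sum_of_subset_of_nonneg (Finset.filter_subset _ _)
      (fun q _ _ => (T.r_pos _).le)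
  have h2 := T.sum_tops_le n
  have h3 : 0 ≤ ∑ q ∈ T.nodes n, T.dev q * T.r q.1 :=
    Finset.sum_nonneg fun q _ => mul_nonneg (T.dev_nonneg q) (T.r_pos _).le
  obtain ⟨f, f1, -, -, f4, f5⟩ := (hloop.mono (M := 82 * T.ρ +
    3000000 * ∑ q ∈ T.nodes n, T.dev q * T.r q.1) (by linarith)).2 T.root
    (mem_biUnion hroot (Finset.mem_coe.2 (Finset.mem_insert_self _ _)))
  refine ⟨f, f1, f5, fun x hx => f4 ?_⟩
  have hx' := Finset.mem_coe.1 hx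
  cases n with
  | zero =>
    rw [T.net_zero, Finset.mem_singleton] at hx'
    subst hx'
    exact mem_biUnion hroot (Finset.mem_coe.2 (Finset.mem_insert_self _ _))
  | succ n =>
    have h4 : (n + 1, x) ∈ T.ends (n + 1) (T.top n (T.parent n x)) :=
      mem_ends.2 ⟨mem_nodes.2 ⟨le_rfl, hx'⟩, rfl, Or.inr rfl⟩
    exact mem_biUnion (top_mem_nodes (T.parent_mem n x hx') (Nat.le_succ n))
      (Finset.mem_coe.2 (Finset.mem_insert_of_mem (Finset.mem_image_of_mem Prod.snd h4)))

end Tower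

/-! ### Limits of loops -/

/-- A limit of `1`-Lipschitz curves through an increasing sequence of sets passes through all
of them. -/
lemma exists_lipschitz_limit {X : Type u} [MetricSpace X] {K : Set X} (hK : IsCompact K) {M : ℝ}
    {Y : ℕ → Set X} (hY : Monotone Y) (f : ℕ → ℝ → X) (hf : ∀ n, LipschitzWith 1 (f n))
    (hfK : ∀ n t, f n t ∈ K) (hfY : ∀ n, Y n ⊆ f n '' Icc 0 M) :
    ∃ F : ℝ → X, LipschitzWith 1 F ∧ ∀ n, Y n ⊆ F '' Icc 0 M := by
  have hlim : ∀ t, ∃ y, Filter.Tendsto (fun n => f n t) (Filter.hyperfilter ℕ) (nhds y) := by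
    intro t
    obtain ⟨y, -, hy⟩ := hK.ultrafilter_le_nhds
      (Ultrafilter.map (fun n => f n t) (Filter.hyperfilter ℕ))
      (Filter.le_principal_iff.2 (Filter.mem_map.2 (Filter.univ_mem' fun n => hfK n t)))
    exact ⟨y, hy⟩
  choose F hF using hlim
  refine ⟨F, LipschitzWith.of_dist_le_mul fun s t => ?_, ?_⟩
  · exact le_of_tendsto ((hF s).dist (hF t))
      (Filter.Eventually.of_forall fun n => (hf n).dist_le_mul s t)
  · intro k y hy
    have hs : ∀ n, ∃ s, k ≤ n → s ∈ Icc 0 M ∧ f n s = y := by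
      intro n
      by_cases h : k ≤ n
      · obtain ⟨s, hs⟩ := hfY n (hY h hy)
        exact ⟨s, fun _ => hs⟩
      · exact ⟨0, fun h' => absurd h' h⟩
    choose s hs using hs
    have hev : ∀ᶠ n in (Filter.hyperfilter ℕ : Filter ℕ), k ≤ n :=
      Nat.hyperfilter_le_atTop (Filter.eventually_ge_atTop k)
    obtain ⟨a, ha, has⟩ := (isCompact_Icc (a := (0 : ℝ)) (b := M)).ultrafilter_le_nhds
      (Ultrafilter.map s (Filter.hyperfilter ℕ))
      (Filter.le_principal_iff.2 (Filter.mem_map.2 (hev.mono fun n hn => (hs n hn).1)))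
    have has' : Filter.Tendsto s (Filter.hyperfilter ℕ) (nhds a) := has
    refine ⟨a, ha, ?_⟩
    have h1 : Filter.Tendsto (fun n => dist (f n a) y) (Filter.hyperfilter ℕ)
        (nhds (dist (F a) y)) := (hF a).dist tendsto_const_nhds
    have h2 : Filter.Tendsto (fun n => dist a (s n)) (Filter.hyperfilter ℕ)
        (nhds (dist a a)) := tendsto_const_nhds.dist has'
    have h3 := le_of_tendsto_of_tendsto h1 h2 (hev.mono fun n hn => by
      have h4 := (hf n).dist_le_mul a (s n)
      rw [(hs n hn).2] at h4
      simpa using h4)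
    rw [dist_self] at h3
    exact dist_le_zero.1 h3

/-! ### Flatness from beta numbers -/

section Beta

variable {X : Type u} [NormedAddCommGroup X] [NormedSpace ℝ X]

lemma jonesBeta_nonneg (E Q : Set X) : 0 ≤ jonesBeta E Q := by
  rw [jonesBeta]
  split_ifs
  · exact le_rfl
  · refine Real.sInf_nonneg ?_
    rintro _ ⟨a, v, -, rfl⟩
    refine Real.sSup_nonneg ?_
    rintro _ ⟨x, -, rfl⟩
    exact div_nonneg infDist_nonneg Metric.diam_nonneg

/-- A window with small beta number has a direction along which all secants nearly lie. -/
lemma exists_direction [Nontrivial X] {E : Set X} {x : X} {R η : ℝ} (hx : x ∈ E) (hR : 0 < R)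
    (hη : 0 < η) :
    ∃ v : X, ‖v‖ = 1 ∧ ∀ p ∈ E, ∀ z ∈ E, dist p x ≤ R → dist z x ≤ R →
      ∃ s : ℝ, ‖p - z - s • v‖ ≤
        2 * (jonesBeta E (closedBall x R) * Metric.diam (closedBall x R)) + 4 * η := by
  set Q := closedBall x R with hQ
  have hxQ : x ∈ E ∩ Q := ⟨hx, mem_closedBall_self hR.le⟩
  obtain ⟨e, he⟩ := exists_ne (0 : X)
  have hdiam : 0 < Metric.diam Q := by
    refine Metric.diam_pos ⟨x, hxQ.2, x + (R / ‖e‖) • e, ?_, ?_⟩ isBounded_closedBall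
    · have : ‖e‖ ≠ 0 := norm_ne_zero_iff.2 he
      rw [hQ, mem_closedBall, dist_eq_norm, add_sub_cancel_left, norm_smul, norm_div, norm_norm,
        div_mul_cancel₀ _ this, Real.norm_eq_abs, abs_of_pos hR]
    · have h1 : (R / ‖e‖) • e ≠ 0 :=
        smul_ne_zero (div_pos hR (norm_pos_iff.2 he)).ne' he
      exact fun h => h1 (left_eq_add.1 h)
  set S := {r : ℝ | ∃ a v : X, v ≠ 0 ∧
    r = sSup ((fun x => infDist x (lineThrough a v) / Metric.diam Q) '' (E ∩ Q))} with hS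
  have hβ : jonesBeta E Q = sInf S := by
    rw [jonesBeta, if_neg (Set.nonempty_iff_ne_empty.1 ⟨x, hxQ⟩)]
  have hSne : S.Nonempty := ⟨_, 0, e, he, rfl⟩
  have hlt : sInf S < jonesBeta E Q + η / Metric.diam Q := by
    rw [hβ]
    linarith [div_pos hη hdiam]
  obtain ⟨_, ⟨a, v, hv, rfl⟩, hr⟩ := exists_lt_of_csInf_lt hSne hlt
  have ha : a ∈ lineThrough a v := ⟨0, by simp⟩
  have hbdd : BddAbove ((fun x => infDist x (lineThrough a v) / Metric.diam Q) '' (E ∩ Q)) := by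
    refine ⟨(R + dist x a) / Metric.diam Q, ?_⟩
    rintro _ ⟨y, hy, rfl⟩
    refine div_le_div_of_nonneg_right ?_ hdiam.le
    refine (infDist_le_dist_of_mem ha).trans ((dist_triangle y x a).trans ?_)
    have := mem_closedBall.1 hy.2
    linarith
  have hnear : ∀ p ∈ E, dist p x ≤ R → ∃ s : ℝ, ‖p - (a + s • v)‖ <
      jonesBeta E Q * Metric.diam Q + 2 * η := by
    intro p hp hpx
    have h1 := le_csSup hbdd ⟨p, ⟨hp, mem_closedBall.2 hpx⟩, rfl⟩
    have h2 := h1.trans_lt hr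
    rw [div_lt_iff₀ hdiam, add_mul, div_mul_cancel₀ _ hdiam.ne'] at h2
    obtain ⟨_, ⟨s, rfl⟩, hy⟩ := (infDist_lt_iff ⟨a, ha⟩).1
      (h2.trans (show _ < jonesBeta E Q * Metric.diam Q + 2 * η by linarith))
    exact ⟨s, by rwa [← dist_eq_norm]⟩
  have hv0 : ‖v‖ ≠ 0 := norm_ne_zero_iff.2 hv
  refine ⟨‖v‖⁻¹ • v, by rw [norm_smul, norm_inv, norm_norm, inv_mul_cancel₀ hv0], ?_⟩
  intro p hp z hz hpx hzx
  obtain ⟨s, hs⟩ := hnear p hp hpx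
  obtain ⟨s', hs'⟩ := hnear z hz hzx
  refine ⟨(s - s') * ‖v‖, ?_⟩
  have h1 : p - z - ((s - s') * ‖v‖) • ‖v‖⁻¹ • v = (p - (a + s • v)) - (z - (a + s' • v)) := by
    rw [smul_smul, mul_assoc, mul_inv_cancel₀ hv0, mul_one, sub_smul]
    abel
  rw [h1]
  refine (norm_sub_le _ _).trans ?_
  linarith

/-- The summand `β_E(Q) · diam Q` of the window at a node. -/
def betaWeight (E : Set X) (A : ℝ) (k : ℤ) (x : X) : ℝ :=
  jonesBeta E (closedBall x (A * (2 : ℝ) ^ (-k))) *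
    Metric.diam (closedBall x (A * (2 : ℝ) ^ (-k)))

lemma betaWeight_nonneg (E : Set X) (A : ℝ) (k : ℤ) (x : X) : 0 ≤ betaWeight E A k x :=
  mul_nonneg (jonesBeta_nonneg _ _) Metric.diam_nonneg

lemma two_zpow_level (K : ℤ) (i : ℕ) : (2 : ℝ) ^ (-(K + 4 * i)) = 2 ^ (-K) / 16 ^ i := by
  rw [neg_add, zpow_add₀ (by norm_num), div_eq_mul_inv, zpow_neg 2 (4 * (i : ℤ)), zpow_mul,
    zpow_natCast]
  norm_num

lemma truncBetaSum_eq {E : Set X} {A c₀ : ℝ} (hA : 0 ≤ A) {K k : ℤ} {x : X}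
    (hk : K ≤ k) (hK : 2 * A * (2 : ℝ) ^ (-K) ≤ c₀ * Metric.diam E) :
    (if Metric.diam (closedBall x (A * (2 : ℝ) ^ (-k))) ≤ c₀ * Metric.diam E then
      ENNReal.ofReal (jonesBeta E (closedBall x (A * (2 : ℝ) ^ (-k))) *
        Metric.diam (closedBall x (A * (2 : ℝ) ^ (-k)))) else 0) =
      ENNReal.ofReal (betaWeight E A k x) := by
  have h1 : (2 : ℝ) ^ (-k) ≤ 2 ^ (-K) := zpow_le_zpow_right₀ (by norm_num) (by omega)
  have h2 : Metric.diam (closedBall x (A * (2 : ℝ) ^ (-k))) ≤ 2 * (A * (2 : ℝ) ^ (-k)) :=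
    Metric.diam_closedBall (by positivity)
  have h3 : A * (2 : ℝ) ^ (-k) ≤ A * 2 ^ (-K) := mul_le_mul_of_nonneg_left h1 hA
  rw [if_pos (by linarith)]
  rfl

variable {E : Set X} {net : ℤ → Set X} {A c₀ : ℝ} {K : ℤ}

/-- Only finitely many windows of a given scale fail to be flat, so the nets are finite. -/
lemma finite_net [Nontrivial X] (hA : 240 ≤ A) (hE : IsBounded E)
    (hnet : IsMultiresolution E net) (hdiam : Metric.diam E < (2 : ℝ) ^ (-K))
    (hK : 2 * A * (2 : ℝ) ^ (-K) ≤ c₀ * Metric.diam E)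
    (hfin : truncBetaSum E net A c₀ ≠ ⊤) (i : ℕ) : (net (K + 4 * i)).Finite := by
  obtain ⟨⟨hsub, hmono, hsep⟩, hcov⟩ := hnet
  induction i with
  | zero =>
    refine Set.Subsingleton.finite fun x hx y hy => ?_
    by_contra hne
    have h1 := hsep _ x hx y hy hne
    have h2 := dist_le_diam_of_mem hE (hsub _ hx) (hsub _ hy)
    simp only [Nat.cast_zero, mul_zero, add_zero] at h1
    linarith
  | succ i ih =>
    set k : ℤ := K + 4 * ((i + 1 : ℕ) : ℤ) with hk
    set δ : ℝ := (2 : ℝ) ^ (-k) with hδ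
    have hδ0 : 0 < δ := by positivity
    have hδ16 : (2 : ℝ) ^ (-(K + 4 * (i : ℤ))) = 16 * δ := by
      rw [hδ, hk, two_zpow_level, two_zpow_level, pow_succ]
      field_simp
    have hcover : net k ⊆ ⋃ x ∈ net (K + 4 * i), {z ∈ net k | dist x z ≤ 16 * δ} := by
      intro z hz
      obtain ⟨x, hx, hd⟩ := hcov (K + 4 * i) z (hsub _ hz)
      rw [hδ16, dist_comm] at hd
      exact mem_biUnion hx ⟨hz, hd⟩
    refine (Set.Finite.biUnion ih fun x hx => ?_).subset hcover
    by_contra hinf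
    set N := {z ∈ net k | dist x z ≤ 16 * δ} with hN
    have hbad : {z : net k | ENNReal.ofReal (δ / 16) ≤
        ENNReal.ofReal (betaWeight E A k z)}.Finite := by
      refine ENNReal.finite_const_le_of_tsum_ne_top ?_ (by simpa using hδ0)
      have h1 := ENNReal.ne_top_of_tsum_ne_top hfin k
      convert h1 using 3 with z
      exact (truncBetaSum_eq (by linarith) (by omega) hK).symm
    have hbad' : {z ∈ net k | δ / 16 ≤ betaWeight E A k z}.Finite := by
      refine (hbad.image Subtype.val).subset ?_
      rintro z ⟨hz, hz'⟩
      exact ⟨⟨z, hz⟩, ENNReal.ofReal_le_ofReal hz', rfl⟩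
    obtain ⟨z₀, hz₀, hgood⟩ : ∃ z₀ ∈ N, betaWeight E A k z₀ < δ / 16 := by
      by_contra hcon
      push Not at hcon
      exact hinf (hbad'.subset fun z hz => ⟨hz.1, hcon z hz⟩)
    obtain ⟨v, hv, hflat⟩ := exists_direction (R := A * δ) (η := δ / 64) (hsub _ hz₀.1)
      (by positivity) (by positivity)
    obtain ⟨W, hWN, hWc⟩ := Set.Infinite.exists_subset_card_eq hinf 66
    have hnear : ∀ z ∈ W, dist z z₀ ≤ A * δ := by
      intro z hz
      have h1 := dist_triangle_left z z₀ x
      have h2 := (hWN hz).2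
      have h3 := hz₀.2
      have h4 : 240 * δ ≤ A * δ := mul_le_mul_of_nonneg_right hA hδ0.le
      linarith
    have hpack := sum_le_of_flat hv W hδ0.le (by positivity) (fun z hz => (hWN hz).2)
      (fun z hz w hw hne => hsep k z (hWN hz).1 w (hWN hw).1 hne)
      (fun z hz w hw => by
        obtain ⟨s, hs⟩ := hflat z (hsub _ (hWN hz).1) w (hsub _ (hWN hw).1) (hnear z hz)
          (hnear w hw)
        refine ⟨s, hs.trans ?_⟩
        change betaWeight E A k z₀ < _ at hgood
        change 2 * betaWeight E A k z₀ + _ ≤ _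
        linarith)
    rw [Finset.sum_const, hWc, nsmul_eq_mul] at hpack
    push_cast at hpack
    linarith

/-- The nets of a multiresolution family form a tower. -/
lemma exists_tower [Nontrivial X] (hA : 240 ≤ A) (hE : IsBounded E) (hEne : E.Nonempty)
    (hnet : IsMultiresolution E net) (hdiam : Metric.diam E < (2 : ℝ) ^ (-K))
    (hfin : ∀ i : ℕ, (net (K + 4 * i)).Finite) {η : ℝ} (hη : 0 < η) :
    ∃ T : Tower X, T.E = E ∧ T.ρ = (2 : ℝ) ^ (-K) ∧ (∀ i, T.net i = (hfin i).toFinset) ∧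
      ∀ q : ℕ × X, T.dev q * T.r q.1 = 2 * betaWeight E A (K + 4 * q.1) q.2 + 4 * η := by
  obtain ⟨⟨hsub, hmono, hsep⟩, hcov⟩ := hnet
  obtain ⟨e, he⟩ := hEne
  have hne : ∀ i, (hfin i).toFinset.Nonempty := fun i => by
    obtain ⟨x, hx, -⟩ := hcov (K + 4 * i) e he
    exact ⟨x, (hfin i).mem_toFinset.2 hx⟩
  have hparent : ∀ (i : ℕ) (z : X), ∃ x ∈ (hfin i).toFinset,
      ∀ y ∈ (hfin i).toFinset, dist z x ≤ dist z y := fun i z =>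
    Finset.exists_min_image _ _ (hne i)
  choose parent hp1 hp2 using hparent
  have hdir : ∀ q : ℕ × X, ∃ v : X, q.2 ∈ E → ‖v‖ = 1 ∧ ∀ p ∈ E, ∀ z ∈ E,
      dist p q.2 ≤ A * (2 : ℝ) ^ (-(K + 4 * (q.1 : ℤ))) →
      dist z q.2 ≤ A * (2 : ℝ) ^ (-(K + 4 * (q.1 : ℤ))) →
      ∃ s : ℝ, ‖p - z - s • v‖ ≤ 2 * betaWeight E A (K + 4 * q.1) q.2 + 4 * η := by
    intro q
    by_cases hq : q.2 ∈ E
    · obtain ⟨v, hv⟩ := exists_direction (R := A * (2 : ℝ) ^ (-(K + 4 * (q.1 : ℤ)))) hq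
        (by positivity) hη
      exact ⟨v, fun _ => hv⟩
    · exact ⟨0, fun h => absurd h hq⟩
  choose dir hdir using hdir
  obtain ⟨o, ho⟩ := hne 0
  have hr : ∀ i : ℕ, (0 : ℝ) < 2 ^ (-K) / 16 ^ i := fun i => by positivity
  refine ⟨{ E := E
            ρ := 2 ^ (-K)
            net := fun i => (hfin i).toFinset
            root := o
            parent := parent
            dev := fun q => (2 * betaWeight E A (K + 4 * q.1) q.2 + 4 * η) /
              (2 ^ (-K) / 16 ^ q.1)
            dir := dir
            ρ_pos := by positivity
            net_zero := ?_
            net_subset := fun i x hx => hsub _ ((hfin i).mem_toFinset.1 hx)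
            net_mono := ?_
            net_sep := ?_
            parent_mem := fun i z _ => hp1 i z
            parent_dist := ?_
            parent_nearest := fun i z _ => hp2 i z
            dev_nonneg := fun q => div_nonneg
              (by linarith [betaWeight_nonneg E A (K + 4 * q.1) q.2]) (hr _).le
            dir_norm := fun i x hx => (hdir (i, x) (hsub _ ((hfin i).mem_toFinset.1 hx))).1
            flat := ?_ }, rfl, rfl, fun _ => rfl, fun q => div_mul_cancel₀ _ (hr _).ne'⟩
  · refine Finset.eq_singleton_iff_unique_mem.2 ⟨ho, fun x hx => ?_⟩
    have hx := (hfin 0).mem_toFinset.1 hx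
    have ho := (hfin 0).mem_toFinset.1 ho
    by_contra hxo
    have h1 := hsep _ x hx o ho hxo
    have h2 := dist_le_diam_of_mem hE (hsub _ hx) (hsub _ ho)
    simp only [Nat.cast_zero, mul_zero, add_zero] at h1
    linarith
  · intro i x hx
    have hx := (hfin i).mem_toFinset.1 hx
    refine (hfin (i + 1)).mem_toFinset.2 ?_
    have h := hmono _ (hmono _ (hmono _ (hmono _ hx)))
    convert h using 2
    push_cast
    ring
  · intro i x hx y hy hxy
    rw [← two_zpow_level]
    exact hsep _ x ((hfin i).mem_toFinset.1 hx) y ((hfin i).mem_toFinset.1 hy) hxy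
  · intro i z hz
    obtain ⟨x, hx, hd⟩ := hcov (K + 4 * i) z (hsub _ ((hfin _).mem_toFinset.1 hz))
    rw [two_zpow_level] at hd
    exact (hp2 i z x ((hfin i).mem_toFinset.2 hx)).trans hd
  · intro i x hx p hp z hz hpx hzx
    have h1 : 240 * ((2 : ℝ) ^ (-K) / 16 ^ i) ≤ A * (2 : ℝ) ^ (-(K + 4 * (i : ℤ))) := by
      rw [two_zpow_level]
      exact mul_le_mul_of_nonneg_right hA (hr i).le
    obtain ⟨s, hs⟩ := (hdir (i, x) (hsub _ ((hfin i).mem_toFinset.1 hx))).2 p hp z hz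
      (hpx.trans h1) (hzx.trans h1)
    refine ⟨s, hs.trans (le_of_eq ?_)⟩
    exact (div_mul_cancel₀ _ (hr i).ne').symm

/-- A finite part of the beta sum is bounded by the full one. -/
lemma sum_betaWeight_le (hA : 0 ≤ A) (hK : 2 * A * (2 : ℝ) ^ (-K) ≤ c₀ * Metric.diam E)
    (hfin : ∀ i : ℕ, (net (K + 4 * i)).Finite) (hsum : truncBetaSum E net A c₀ ≠ ⊤) (n : ℕ) :
    ∑ i ∈ Finset.range n, ∑ x ∈ (hfin i).toFinset, betaWeight E A (K + 4 * i) x ≤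
      (truncBetaSum E net A c₀).toReal := by
  rw [← ENNReal.ofReal_le_iff_le_toReal hsum,
    ENNReal.ofReal_sum_of_nonneg fun i _ => Finset.sum_nonneg fun x _ => betaWeight_nonneg _ _ _ _]
  have hinj : Function.Injective fun i : ℕ => K + 4 * (i : ℤ) := fun i j h => by
    simp only at h
    omega
  refine le_trans ?_ (ENNReal.sum_le_tsum ((Finset.range n).image fun i : ℕ => K + 4 * (i : ℤ)))
  rw [Finset.sum_image hinj.injOn]
  refine Finset.sum_le_sum fun i _ => le_of_eq ?_
  rw [ENNReal.ofReal_sum_of_nonneg fun x _ => betaWeight_nonneg _ _ _ _, ← Finset.tsum_subtype',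
    tsum_congr_set_coe (fun x => ENNReal.ofReal (betaWeight E A (K + 4 * i) x))
      (hfin i).coe_toFinset]
  exact tsum_congr fun x => (truncBetaSum_eq hA (by omega) hK).symm

end Beta

section Nets

variable {X : Type u} [NormedAddCommGroup X] {E : Set X} {net : ℤ → Set X} {K : ℤ}

lemma totallyBounded_of_nets (hnet : IsMultiresolution E net)
    (hfin : ∀ i : ℕ, (net (K + 4 * i)).Finite) : TotallyBounded E := by
  refine Metric.totallyBounded_iff.2 fun ε hε => ?_
  obtain ⟨i, hi⟩ := exists_pow_lt_of_lt_one (show 0 < ε / 2 ^ (-K) by positivity)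
    (show (1 / 16 : ℝ) < 1 by norm_num)
  refine ⟨net (K + 4 * i), hfin i, fun e he => ?_⟩
  obtain ⟨x, hx, hd⟩ := hnet.2 (K + 4 * i) e he
  refine mem_biUnion hx (mem_ball.2 (hd.trans_lt ?_))
  rw [two_zpow_level]
  rw [lt_div_iff₀ (by positivity), one_div, inv_pow] at hi
  rw [div_eq_inv_mul]
  exact hi

lemma subset_closure_nets (hnet : IsMultiresolution E net) :
    E ⊆ closure (⋃ i : ℕ, net (K + 4 * i)) := by
  intro e he
  refine Metric.mem_closure_iff.2 fun ε hε => ?_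
  obtain ⟨i, hi⟩ := exists_pow_lt_of_lt_one (show 0 < ε / 2 ^ (-K) by positivity)
    (show (1 / 16 : ℝ) < 1 by norm_num)
  obtain ⟨x, hx, hd⟩ := hnet.2 (K + 4 * i) e he
  refine ⟨x, mem_iUnion.2 ⟨i, hx⟩, hd.trans_lt ?_⟩
  rw [two_zpow_level]
  rw [lt_div_iff₀ (by positivity), one_div, inv_pow] at hi
  rw [div_eq_inv_mul]
  exact hi

end Nets

/-- The net at each level lies on a closed curve whose length is controlled by the beta sum. -/
lemma exists_loop_of_nets {X : Type u} [NormedAddCommGroup X] [NormedSpace ℝ X] [Nontrivial X]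
    {E : Set X} {net : ℤ → Set X} {A c₀ : ℝ} {K : ℤ} (hA : 240 ≤ A) (hEne : E.Nonempty)
    (hE : IsBounded E) (hnet : IsMultiresolution E net) (hdiam : Metric.diam E < (2 : ℝ) ^ (-K))
    (hK : 2 * A * (2 : ℝ) ^ (-K) ≤ c₀ * Metric.diam E)
    (hfin : ∀ i : ℕ, (net (K + 4 * i)).Finite) (hsum : truncBetaSum E net A c₀ ≠ ⊤) (n : ℕ) :
    ∃ f : ℝ → X, LipschitzWith 1 f ∧ (∀ t, f t ∈ closure (convexHull ℝ E)) ∧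
      net (K + 4 * n) ⊆ f '' Icc 0 (4000000 * (2 : ℝ) ^ (-K) +
        6000000 * (truncBetaSum E net A c₀).toReal) := by
  obtain ⟨ρ, hρdef⟩ : ∃ ρ : ℝ, ρ = (2 : ℝ) ^ (-K) := ⟨_, rfl⟩
  have hρ : 0 < ρ := by rw [hρdef]; positivity
  obtain ⟨B, hB⟩ : ∃ B, B = (truncBetaSum E net A c₀).toReal := ⟨_, rfl⟩
  obtain ⟨N, hN⟩ : ∃ N : ℕ, N = ∑ i ∈ Finset.range (n + 1), (hfin i).toFinset.card := ⟨_, rfl⟩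
  have hη : 0 < ρ / (4 * ((N : ℝ) + 1)) := by positivity
  obtain ⟨T, hTE, hTρ, hTnet, hTdev⟩ := exists_tower hA hE hEne hnet hdiam hfin hη
  have hdev : ∑ q ∈ T.nodes n, T.dev q * T.r q.1 ≤ 2 * B + ρ := by
    have h1 : ∑ q ∈ T.nodes n, T.dev q * T.r q.1 = ∑ i ∈ Finset.range (n + 1),
        ∑ x ∈ (hfin i).toFinset, (2 * betaWeight E A (K + 4 * i) x +
          4 * (ρ / (4 * (N + 1)))) := by
      rw [Tower.nodes, Finset.sum_biUnion]
      · refine Finset.sum_congr rfl fun i _ => ?_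
        rw [Finset.sum_image (fun x _ y _ h => (Prod.mk.inj h).2), hTnet]
        exact Finset.sum_congr rfl fun x _ => hTdev (i, x)
      · intro i _ j _ hij
        refine Finset.disjoint_left.2 fun q hq hq' => hij ?_
        obtain ⟨x, -, rfl⟩ := Finset.mem_image.1 hq
        obtain ⟨y, -, h⟩ := Finset.mem_image.1 hq'
        exact (Prod.mk.inj h).1.symm
    have h2 := sum_betaWeight_le (by linarith) hK hfin hsum (n + 1)
    rw [← hB] at h2
    have h3 : (N : ℝ) * (4 * (ρ / (4 * (N + 1)))) ≤ ρ := by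
      have hN1 : (0 : ℝ) < N + 1 := by positivity
      have h4 : 4 * (ρ / (4 * (N + 1))) = ρ / (N + 1) := by
        field_simp
      rw [h4, mul_div_assoc', div_le_iff₀ hN1]
      nlinarith
    rw [h1]
    simp only [Finset.sum_add_distrib, Finset.sum_const, nsmul_eq_mul, ← Finset.mul_sum,
      ← Finset.sum_mul]
    rw [← Nat.cast_sum, ← hN]
    linarith
  obtain ⟨f, f1, f2, f3⟩ := T.exists_loop (K := closure (convexHull ℝ E))
    (convex_convexHull ℝ E).closure
    (by rw [hTE]; exact (subset_convexHull ℝ E).trans subset_closure) n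
  refine ⟨f, f1, f2, ?_⟩
  rw [hTnet, (hfin n).coe_toFinset, hTρ, ← hρdef] at f3
  rw [← hρdef, ← hB]
  refine f3.trans (image_mono (Icc_subset_Icc_right ?_))
  linarith

/-- A set with finite nets and finite beta sum lies on a Lipschitz curve. -/
lemma exists_curve_of_nets {X : Type u} [NormedAddCommGroup X] [NormedSpace ℝ X]
    [CompleteSpace X] [MeasurableSpace X] [BorelSpace X] [Nontrivial X] {E : Set X}
    {net : ℤ → Set X} {A c₀ : ℝ} {K : ℤ} (hA : 240 ≤ A) (hEne : E.Nonempty) (hE : IsBounded E)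
    (hnet : IsMultiresolution E net) (hdiam : Metric.diam E < (2 : ℝ) ^ (-K))
    (hK : 2 * A * (2 : ℝ) ^ (-K) ≤ c₀ * Metric.diam E)
    (hfin : ∀ i : ℕ, (net (K + 4 * i)).Finite) (hsum : truncBetaSum E net A c₀ ≠ ⊤) :
    ∃ Γ : Set X, E ⊆ Γ ∧
      (∃ f : ℝ → X, ContinuousOn f (Set.Icc (0 : ℝ) 1) ∧ Γ = f '' Set.Icc (0 : ℝ) 1) ∧
      μH[1] Γ ≤ ENNReal.ofReal (4000000 * (2 : ℝ) ^ (-K) +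
        6000000 * (truncBetaSum E net A c₀).toReal) := by
  obtain ⟨M, hM⟩ : ∃ M, M = 4000000 * (2 : ℝ) ^ (-K) +
      6000000 * (truncBetaSum E net A c₀).toReal := ⟨_, rfl⟩
  have hM0 : 0 ≤ M := by
    rw [hM]
    positivity
  have hcompact : IsCompact (closure (convexHull ℝ E)) :=
    isCompact_iff_totallyBounded_isComplete.2
      ⟨(totallyBounded_of_nets hnet hfin).convexHull.closure, isClosed_closure.isComplete⟩
  choose f f1 f2 f3 using exists_loop_of_nets hA hEne hE hnet hdiam hK hfin hsum
  simp only [← hM] at f3 ⊢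
  have hmono : Monotone fun n : ℕ => net (K + 4 * n) := by
    refine monotone_nat_of_le_succ fun n x hx => ?_
    have h := hnet.1.2.1 _ (hnet.1.2.1 _ (hnet.1.2.1 _ (hnet.1.2.1 _ hx)))
    convert h using 2
    push_cast
    ring
  obtain ⟨F, hF, hFnet⟩ := exists_lipschitz_limit hcompact hmono f f1 f2 f3
  have hΓ : IsCompact (F '' Icc 0 M) := isCompact_Icc.image hF.continuous
  refine ⟨F '' Icc 0 M, ?_, ⟨fun t => F (M * t), ?_, ?_⟩, ?_⟩
  · exact (subset_closure_nets hnet).trans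
      (closure_minimal (iUnion_subset hFnet) hΓ.isClosed)
  · exact (hF.continuous.comp (continuous_const.mul continuous_id)).continuousOn
  · ext y
    constructor
    · rintro ⟨t, ⟨ht0, htM⟩, rfl⟩
      rcases hM0.eq_or_lt with h | h
      · refine ⟨0, by simp, ?_⟩
        have : t = 0 := by linarith
        simp [this]
      · refine ⟨t / M, ⟨by positivity, (div_le_one h).2 htM⟩, ?_⟩
        simp only [mul_div_cancel₀ t h.ne']
    · rintro ⟨t, ⟨ht0, ht1⟩, rfl⟩
      exact ⟨M * t, ⟨by positivity, mul_le_of_le_one_right hM0 ht1⟩, rfl⟩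
  · refine (hF.hausdorffMeasure_image_le zero_le_one _).trans ?_
    rw [hausdorffMeasure_real, Real.volume_Icc, sub_zero]
    simp

/-- Theorem 1.1(i) of Badger–McCurdy: sufficient condition for containment in a
rectifiable curve, valid in an arbitrary Banach space, with exponent `p = 1` and
the sum restricted to balls `Q` with `diam Q ≤ c₀ · diam E`. -/
theorem statement0 (A : ℝ) (hA : 240 ≤ A) :
    ∃ c₀ C : ℝ, 1 ≤ c₀ ∧ 0 < C ∧
      ∀ (X : Type u) [NormedAddCommGroup X] [NormedSpace ℝ X] [CompleteSpace X]
        [MeasurableSpace X] [BorelSpace X] (E : Set X) (net : ℤ → Set X),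
        E.Nonempty → IsBounded E → IsMultiresolution E net →
        ENNReal.ofReal (Metric.diam E) + truncBetaSum E net A c₀ < ⊤ →
        ∃ Γ : Set X, E ⊆ Γ ∧ IsRectifiableCurve Γ ∧
          μH[1] Γ ≤ ENNReal.ofReal C *
            (ENNReal.ofReal (Metric.diam E) + truncBetaSum E net A c₀) := by
  refine ⟨4 * A, 10000000, by linarith, by norm_num, ?_⟩
  intro X _ _ _ _ _ E net hEne hE hnet hfinite
  rcases Metric.diam_nonneg.eq_or_lt (a := 0) (b := Metric.diam E) with h0 | hpos
  · obtain ⟨x, hx⟩ := hEne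
    have hEx : E = {x} := by
      refine Set.eq_singleton_iff_unique_mem.2 ⟨hx, fun y hy => ?_⟩
      have := dist_le_diam_of_mem hE hy hx
      rw [← h0] at this
      exact dist_le_zero.1 this
    have hμ : μH[1] ({x} : Set X) = 0 :=
      (Measure.nullSingletonClass_hausdorff X one_pos).measure_singleton x
    refine ⟨{x}, hEx.subset, ⟨⟨fun _ => x, continuousOn_const, ?_⟩, ?_⟩, ?_⟩
    · rw [Set.Nonempty.image_const ⟨0, by simp⟩]
    · rw [hμ]
      exact ENNReal.zero_lt_top
    · rw [hμ]
      exact bot_le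
  · have hnontriv : Nontrivial X := by
      by_contra h
      rw [not_nontrivial_iff_subsingleton] at h
      rw [Metric.diam_subsingleton (Set.subsingleton_of_subsingleton)] at hpos
      exact lt_irrefl _ hpos
    obtain ⟨m, hm1, hm2⟩ := exists_mem_Ico_zpow hpos (one_lt_two (α := ℝ))
    obtain ⟨K, rfl⟩ : ∃ K : ℤ, m = -K - 1 := ⟨-m - 1, by ring⟩
    rw [sub_add_cancel] at hm2
    have hρ : (2 : ℝ) ^ (-K) ≤ 2 * Metric.diam E := by
      rw [zpow_sub_one₀ (by norm_num)] at hm1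
      linarith
    have hK : 2 * A * (2 : ℝ) ^ (-K) ≤ 4 * A * Metric.diam E := by
      have := mul_le_mul_of_nonneg_left hρ (show 0 ≤ 2 * A by linarith)
      linarith
    have hsum := (ENNReal.add_lt_top.1 hfinite).2.ne
    have hfin := finite_net hA hE hnet hm2 hK hsum
    obtain ⟨Γ, h1, h2, h3⟩ := exists_curve_of_nets hA hEne hE hnet hm2 hK hfin hsum
    refine ⟨Γ, h1, ⟨h2, h3.trans_lt ENNReal.ofReal_lt_top⟩, h3.trans ?_⟩
    have hadd : ENNReal.ofReal (Metric.diam E) + truncBetaSum E net A (4 * A) =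
        ENNReal.ofReal (Metric.diam E + (truncBetaSum E net A (4 * A)).toReal) := by
      rw [ENNReal.ofReal_add hpos.le ENNReal.toReal_nonneg, ENNReal.ofReal_toReal hsum]
    rw [hadd, ← ENNReal.ofReal_mul (by norm_num)]
    refine ENNReal.ofReal_le_ofReal ?_
    linarith [ENNReal.toReal_nonneg (a := truncBetaSum E net A (4 * A))]

end
end

section
/- Let 1 < p ≤ 2, let C_s > 0, and let A ≥ 240. There exists a constant C > 0, depending only on A, p and C_s, with the following property. Let X be a real Banach space that is uniformly smooth of power type p with constant C_s, let E ⊆ X be nonempty with diam E < ∞, and let G be a multiresolution family for E with inflation factor A. If S_{E,p}(G) := diam E + Σ_{Q ∈ G} β_E(Q)^p·diam Q < ∞, then E is contained in a rectifiable curve Γ ⊆ X with H^1(Γ) ≤ C·S_{E,p}(G). -/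
open Metric MeasureTheory Set Bornology
open scoped ENNReal NNReal Classical

universe u

noncomputable section

/-- `q` lies metrically between `p` and `r`: among the three distances, `dist p r` is maximal. -/
def MetricBtw {X : Type u} [MetricSpace X] (p q r : X) : Prop :=
  dist p q ≤ dist p r ∧ dist q r ≤ dist p r

/-- `v` is joined to `z` by an edge of `G` which is short at scale `h`. -/
def ShortNbr {X : Type u} [MetricSpace X] (h : ℝ) (G : Finset (X × X)) (z v : X) : Prop :=
  (z, v) ∈ G ∧ dist z v ≤ 8 * h

/-- The number of sides of `z` on which the graph `G` has no short edge. -/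
def openness {X : Type u} [MetricSpace X] (h : ℝ) (G : Finset (X × X)) (z : X) : ℝ :=
  if ∃ u v, ShortNbr h G z u ∧ ShortNbr h G z v ∧ MetricBtw u z v then 0
  else if ∃ u, ShortNbr h G z u then 1 else 2

/-- Short edges count twice, long ones once. -/
def edgeWeight {X : Type u} [MetricSpace X] (h : ℝ) (e : X × X) : ℝ :=
  dist e.1 e.2 + if dist e.1 e.2 ≤ 8 * h then dist e.1 e.2 else 0

/-- Weighted length of the edges plus a penalty `κ z` for every open side of a vertex `z`. -/
def energy {X : Type u} [MetricSpace X] (κ : X → ℝ) (h : ℝ) (F : Finset X)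
    (G : Finset (X × X)) : ℝ :=
  ∑ e ∈ G, edgeWeight h e + ∑ z ∈ F, κ z * openness h G z

/-- `G` is the set of oriented edges of a connected loopless graph with vertex set `F`. -/
structure IsNetwork {X : Type u} (F : Finset X) (G : Finset (X × X)) : Prop where
  mem_left : ∀ a b, (a, b) ∈ G → a ∈ F
  symm : ∀ a b, (a, b) ∈ G → (b, a) ∈ G
  ne : ∀ a b, (a, b) ∈ G → a ≠ b
  conn : ∀ a ∈ F, ∀ b ∈ F, Relation.ReflTransGen (fun a b => (a, b) ∈ G) a b

section Network

variable {X : Type u}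

lemma IsNetwork.mem_right {F : Finset X} {G : Finset (X × X)} (hG : IsNetwork F G) {a b : X}
    (h : (a, b) ∈ G) : b ∈ F := hG.mem_left _ _ (hG.symm _ _ h)

lemma isNetwork_singleton (x : X) : IsNetwork {x} (∅ : Finset (X × X)) := by
  refine ⟨by simp, by simp, by simp, ?_⟩
  intro a ha b hb
  rw [Finset.mem_singleton] at ha hb
  rw [ha, hb]

/-- Adding a vertex keeps a network connected once all old edges survive as paths. -/
lemma IsNetwork.of_insert {F : Finset X} {G G' : Finset (X × X)} (hG : IsNetwork F G)
    {x y : X} (hx : x ∈ F)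
    (hleft : ∀ a b, (a, b) ∈ G' → a ∈ insert y F)
    (hsymm : ∀ a b, (a, b) ∈ G' → (b, a) ∈ G') (hne : ∀ a b, (a, b) ∈ G' → a ≠ b)
    (hxy : (x, y) ∈ G')
    (hpath : ∀ a b, (a, b) ∈ G → Relation.ReflTransGen (fun a b => (a, b) ∈ G') a b) :
    IsNetwork (insert y F) G' := by
  refine ⟨hleft, hsymm, hne, ?_⟩
  have hold : ∀ a ∈ F, ∀ b ∈ F, Relation.ReflTransGen (fun a b => (a, b) ∈ G') a b := by
    intro a ha b hb
    have := hG.conn a ha b hb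
    induction this using Relation.ReflTransGen.trans_induction_on with
    | refl => exact Relation.ReflTransGen.refl
    | single h => exact hpath _ _ h
    | trans _ _ h1 h2 => 
      rename_i a b c h3 h4 
      have hbF : b ∈ F := by
        rcases Relation.ReflTransGen.cases_head h4 with h | ⟨d, h, -⟩
        · exact h ▸ hb
        · exact hG.mem_left _ _ h
      exact (h1 ha hbF).trans (h2 hbF hb)
  have h1 : ∀ a ∈ insert y F, Relation.ReflTransGen (fun a b => (a, b) ∈ G') a x := by
    intro a ha
    rcases Finset.mem_insert.1 ha with rfl | ha
    · exact Relation.ReflTransGen.single (hsymm _ _ hxy)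
    · exact hold a ha x hx
  have h2 : ∀ a ∈ insert y F, Relation.ReflTransGen (fun a b => (a, b) ∈ G') x a := by
    intro a ha
    rcases Finset.mem_insert.1 ha with rfl | ha
    · exact Relation.ReflTransGen.single hxy
    · exact hold x hx a ha
  exact fun a ha b hb => (h1 a ha).trans (h2 b hb)

/-- Join the new vertex `y` to `x`. -/
def attach (G : Finset (X × X)) (x y : X) : Finset (X × X) :=
  insert (x, y) (insert (y, x) G)

lemma mem_attach {G : Finset (X × X)} {x y a b : X} :
    (a, b) ∈ attach G x y ↔ (a = x ∧ b = y) ∨ (a = y ∧ b = x) ∨ (a, b) ∈ G := by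
  simp [attach]

/-- Replace the edge between `x` and `v` by a path through the new vertex `y`. -/
def subdivide (G : Finset (X × X)) (x y v : X) : Finset (X × X) :=
  attach (attach ((G.erase (x, v)).erase (v, x)) x y) v y

lemma mem_subdivide {G : Finset (X × X)} {x y v a b : X} :
    (a, b) ∈ subdivide G x y v ↔ (a = v ∧ b = y) ∨ (a = y ∧ b = v) ∨ (a = x ∧ b = y) ∨
      (a = y ∧ b = x) ∨ (¬ (a = v ∧ b = x) ∧ ¬ (a = x ∧ b = v) ∧ (a, b) ∈ G) := by
  simp [subdivide, mem_attach]

lemma IsNetwork.attach {F : Finset X} {G : Finset (X × X)} (hG : IsNetwork F G) {x y : X}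
    (hx : x ∈ F) (hy : y ∉ F) : IsNetwork (insert y F) (attach G x y) := by
  have hxy : x ≠ y := fun h => hy (h ▸ hx)
  refine hG.of_insert hx ?_ ?_ ?_ (mem_attach.2 (Or.inl ⟨rfl, rfl⟩)) ?_
  · intro a b h
    rcases mem_attach.1 h with ⟨rfl, -⟩ | ⟨rfl, -⟩ | h
    · simp [hx]
    · simp
    · exact Finset.mem_insert_of_mem (hG.mem_left _ _ h)
  · intro a b h
    rcases mem_attach.1 h with ⟨rfl, rfl⟩ | ⟨rfl, rfl⟩ | h
    · exact mem_attach.2 (by simp)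
    · exact mem_attach.2 (by simp)
    · exact mem_attach.2 (Or.inr (Or.inr (hG.symm _ _ h)))
  · intro a b h
    rcases mem_attach.1 h with ⟨rfl, rfl⟩ | ⟨rfl, rfl⟩ | h
    · exact hxy
    · exact hxy.symm
    · exact hG.ne _ _ h
  · exact fun a b h => Relation.ReflTransGen.single (mem_attach.2 (Or.inr (Or.inr h)))

lemma IsNetwork.subdivide {F : Finset X} {G : Finset (X × X)} (hG : IsNetwork F G) {x y v : X}
    (hxv : (x, v) ∈ G) (hy : y ∉ F) : IsNetwork (insert y F) (subdivide G x y v) := by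
  have hx : x ∈ F := hG.mem_left _ _ hxv
  have hv : v ∈ F := hG.mem_right hxv
  have hxy : x ≠ y := fun h => hy (h ▸ hx)
  have hvy : v ≠ y := fun h => hy (h ▸ hv)
  have hsymm : ∀ a b, (a, b) ∈ _root_.subdivide G x y v → (b, a) ∈ _root_.subdivide G x y v := by
    intro a b h
    rw [mem_subdivide] at h ⊢
    have := hG.symm a b
    tauto
  refine hG.of_insert hx ?_ hsymm ?_ (mem_subdivide.2 (by simp)) ?_
  · intro a b h
    rcases mem_subdivide.1 h with ⟨rfl, -⟩ | ⟨rfl, -⟩ | ⟨rfl, -⟩ | ⟨rfl, -⟩ | ⟨-, -, h⟩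
    · simp [hv]
    · simp
    · simp [hx]
    · simp
    · exact Finset.mem_insert_of_mem (hG.mem_left _ _ h)
  · intro a b h
    rcases mem_subdivide.1 h with ⟨rfl, rfl⟩ | ⟨rfl, rfl⟩ | ⟨rfl, rfl⟩ | ⟨rfl, rfl⟩ | ⟨-, -, h⟩
    · exact hvy
    · exact hvy.symm
    · exact hxy
    · exact hxy.symm
    · exact hG.ne _ _ h
  · intro a b h
    have h1 : (x, y) ∈ _root_.subdivide G x y v := mem_subdivide.2 (by simp)
    have h2 : (v, y) ∈ _root_.subdivide G x y v := mem_subdivide.2 (by simp)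
    by_cases h3 : a = x ∧ b = v
    · obtain ⟨rfl, rfl⟩ := h3
      exact (Relation.ReflTransGen.single h1).tail (hsymm _ _ h2)
    by_cases h4 : a = v ∧ b = x
    · obtain ⟨rfl, rfl⟩ := h4
      exact (Relation.ReflTransGen.single h2).tail (hsymm _ _ h1)
    exact Relation.ReflTransGen.single (mem_subdivide.2 (by tauto))

end Network

section Openness

variable {X : Type u} [MetricSpace X] {h : ℝ} {G G' : Finset (X × X)} {z : X}

lemma MetricBtw.symm {p q r : X} (hb : MetricBtw p q r) : MetricBtw r q p := by
  obtain ⟨h1, h2⟩ := hb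
  exact ⟨by rwa [dist_comm r q, dist_comm r p], by rwa [dist_comm q p, dist_comm r p]⟩

lemma openness_nonneg : 0 ≤ openness h G z := by
  unfold openness; split_ifs <;> norm_num

lemma openness_le_two : openness h G z ≤ 2 := by
  unfold openness; split_ifs <;> norm_num

lemma openness_le_one {u : X} (hu : ShortNbr h G z u) : openness h G z ≤ 1 := by
  unfold openness
  rw [if_pos (⟨u, hu⟩ : ∃ u, ShortNbr h G z u)]
  split_ifs <;> norm_num

lemma openness_eq_zero {u v : X} (hu : ShortNbr h G z u) (hv : ShortNbr h G z v)
    (hb : MetricBtw u z v) : openness h G z = 0 := by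
  unfold openness
  rw [if_pos ⟨u, v, hu, hv, hb⟩]

lemma openness_eq_two (hz : ¬ ∃ u, ShortNbr h G z u) : openness h G z = 2 := by
  unfold openness
  rw [if_neg (fun ⟨u, v, hu, _⟩ => hz ⟨u, hu⟩), if_neg hz]

lemma one_le_openness (hz : ∀ u v, ShortNbr h G z u → ShortNbr h G z v → ¬ MetricBtw u z v) :
    1 ≤ openness h G z := by
  unfold openness
  rw [if_neg (fun ⟨u, v, hu, hv, hb⟩ => hz u v hu hv hb)]
  split_ifs <;> norm_num

lemma openness_mono (h1 : ∀ u, ShortNbr h G z u → ∃ u', ShortNbr h G' z u')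
    (h2 : ∀ u v, ShortNbr h G z u → ShortNbr h G z v → MetricBtw u z v →
      ∃ u' v', ShortNbr h G' z u' ∧ ShortNbr h G' z v' ∧ MetricBtw u' z v') :
    openness h G' z ≤ openness h G z := by
  by_cases hp : ∃ u v, ShortNbr h G z u ∧ ShortNbr h G z v ∧ MetricBtw u z v
  · obtain ⟨u, v, hu, hv, hb⟩ := hp
    obtain ⟨u', v', hu', hv', hb'⟩ := h2 u v hu hv hb
    rw [openness_eq_zero hu' hv' hb']
    exact openness_nonneg
  by_cases hs : ∃ u, ShortNbr h G z u
  · obtain ⟨u, hu⟩ := hs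
    obtain ⟨u', hu'⟩ := h1 u hu
    exact (openness_le_one hu').trans
      (one_le_openness fun a b ha hb hab => hp ⟨a, b, ha, hb, hab⟩)
  · rw [openness_eq_two hs]
    exact openness_le_two

lemma openness_mono_of_subset (hGG : G ⊆ G') : openness h G' z ≤ openness h G z :=
  openness_mono (fun u hu => ⟨u, hGG hu.1, hu.2⟩)
    fun u v hu hv hb => ⟨u, v, ⟨hGG hu.1, hu.2⟩, ⟨hGG hv.1, hv.2⟩, hb⟩

/-- Passing from scale `h` to `h / 2` opens at most one side per edge that becomes long. -/
lemma openness_half_le (hne : ∀ a b, (a, b) ∈ G → a ≠ b) :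
    openness (h / 2) G z ≤ openness h G z +
      (G.filter fun e => e.1 = z ∧ dist e.1 e.2 ≤ 8 * h ∧ ¬ dist e.1 e.2 ≤ 8 * (h / 2)).card := by
  set S := G.filter fun e => e.1 = z ∧ dist e.1 e.2 ≤ 8 * h ∧ ¬ dist e.1 e.2 ≤ 8 * (h / 2)
  have key : ∀ u, ShortNbr h G z u → ShortNbr (h / 2) G z u ∨ (z, u) ∈ S := by
    intro u hu
    by_cases hd : dist z u ≤ 8 * (h / 2)
    · exact Or.inl ⟨hu.1, hd⟩
    · exact Or.inr (Finset.mem_filter.2 ⟨hu.1, rfl, hu.2, hd⟩)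
  have hn := openness_nonneg (h := h) (G := G) (z := z)
  rcases Nat.lt_or_ge S.card 2 with hc | hc
  swap
  · have : (2 : ℝ) ≤ S.card := by exact_mod_cast hc
    linarith [openness_le_two (h := h / 2) (G := G) (z := z)]
  rcases Nat.lt_or_ge S.card 1 with hc0 | hc1
  · have hS : S = ∅ := Finset.card_eq_zero.1 (by omega)
    have key' : ∀ u, ShortNbr h G z u → ShortNbr (h / 2) G z u := by
      intro u hu
      simpa [hS] using key u hu
    rw [hS]
    simp only [Finset.card_empty, Nat.cast_zero, add_zero]
    by_cases hp : ∃ u v, ShortNbr h G z u ∧ ShortNbr h G z v ∧ MetricBtw u z v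
    · obtain ⟨u, v, hu, hv, hb⟩ := hp
      rw [openness_eq_zero (key' u hu) (key' v hv) hb]
      exact hn
    by_cases hs : ∃ u, ShortNbr h G z u
    · obtain ⟨u, hu⟩ := hs
      exact (openness_le_one (key' u hu)).trans
        (one_le_openness fun a b ha hb hab => hp ⟨a, b, ha, hb, hab⟩)
    · rw [openness_eq_two hs]
      exact openness_le_two
  · have h1 : S.card = 1 := by omega
    obtain ⟨e, he⟩ := Finset.card_eq_one.1 h1
    rw [h1, Nat.cast_one]
    by_cases hp : ∃ u v, ShortNbr h G z u ∧ ShortNbr h G z v ∧ MetricBtw u z v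
    · obtain ⟨u, v, hu, hv, hb⟩ := hp
      suffices ∃ w, ShortNbr (h / 2) G z w by
        obtain ⟨w, hw⟩ := this
        linarith [openness_le_one hw]
      rcases key u hu with h3 | h3
      · exact ⟨u, h3⟩
      rcases key v hv with h4 | h4
      · exact ⟨v, h4⟩
      exfalso
      rw [he, Finset.mem_singleton] at h3 h4
      have huv : u = v := congrArg Prod.snd (h3.trans h4.symm)
      subst huv
      have := hb.1
      rw [dist_self] at this
      exact hne _ _ hu.1 (dist_le_zero.1 this).symm
    · have := one_le_openness (h := h) (G := G) (z := z)
        fun a b ha hb hab => hp ⟨a, b, ha, hb, hab⟩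
      linarith [openness_le_two (h := h / 2) (G := G) (z := z)]

lemma edgeWeight_nonneg (e : X × X) : 0 ≤ edgeWeight h e := by
  unfold edgeWeight; split_ifs <;> positivity

lemma dist_le_edgeWeight (e : X × X) : dist e.1 e.2 ≤ edgeWeight h e := by
  unfold edgeWeight; split_ifs <;> simp

lemma edgeWeight_le (e : X × X) : edgeWeight h e ≤ 2 * dist e.1 e.2 := by
  unfold edgeWeight
  have : 0 ≤ dist e.1 e.2 := dist_nonneg
  split_ifs <;> linarith

lemma edgeWeight_of_short {e : X × X} (he : dist e.1 e.2 ≤ 8 * h) :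
    edgeWeight h e = 2 * dist e.1 e.2 := by
  unfold edgeWeight
  rw [if_pos he]; ring

/-- Edges that become long release enough weight to pay for the sides they open. -/
lemma energy_half_le (hh : 0 ≤ h) {F : Finset X} (hG : IsNetwork F G) :
    energy (fun _ => 4 * h) (h / 2) F G ≤ energy (fun _ => 4 * h) h F G := by
  set P : X × X → Prop := fun e => dist e.1 e.2 ≤ 8 * h ∧ ¬ dist e.1 e.2 ≤ 8 * (h / 2) with hP
  have h1 : ∀ z ∈ F, 4 * h * openness (h / 2) G z ≤
      4 * h * openness h G z + ∑ e ∈ G, if e.1 = z then (if P e then 4 * h else 0) else 0 := by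
    intro z _
    have := openness_half_le (h := h) (z := z) hG.ne
    have h2 : (∑ e ∈ G, if e.1 = z then (if P e then 4 * h else 0) else 0) =
        4 * h * (G.filter fun e => e.1 = z ∧ dist e.1 e.2 ≤ 8 * h ∧
          ¬ dist e.1 e.2 ≤ 8 * (h / 2)).card := by
      rw [Finset.card_filter, Nat.cast_sum, Finset.mul_sum]
      refine Finset.sum_congr rfl fun e _ => ?_
      by_cases h3 : e.1 = z <;> by_cases h4 : P e <;> simp [h3] <;> simp_all
    rw [h2, ← mul_add]
    exact mul_le_mul_of_nonneg_left this (by positivity)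
  have h2 : ∑ z ∈ F, ∑ e ∈ G, (if e.1 = z then (if P e then 4 * h else 0) else 0) =
      ∑ e ∈ G, if P e then 4 * h else 0 := by
    rw [Finset.sum_comm]
    refine Finset.sum_congr rfl fun e he => ?_
    rw [Finset.sum_ite_eq, if_pos (hG.mem_left e.1 e.2 he)]
  have h3 : ∀ e ∈ G, edgeWeight (h / 2) e + (if P e then 4 * h else 0) ≤ edgeWeight h e := by
    intro e _
    unfold edgeWeight
    have h0 : 0 ≤ dist e.1 e.2 := dist_nonneg
    by_cases ha : dist e.1 e.2 ≤ 8 * h <;> by_cases hb : dist e.1 e.2 ≤ 8 * (h / 2) <;>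
      simp only [hP, ha, hb, if_true, if_false, not_true, not_false_eq_true, and_self, and_true,
        and_false] <;> linarith
  have h4 := Finset.sum_le_sum h1
  have h5 := Finset.sum_le_sum h3
  rw [Finset.sum_add_distrib] at h4 h5
  rw [h2] at h4
  unfold energy
  linarith

end Openness

section AlmostLinear

variable {X : Type u} [MetricSpace X]

/-- On the `h / 2`-separated set `S` the coordinate `t` is an isometry up to an error `h / 50`. -/
structure IsAlmostLinear (h : ℝ) (S : Set X) (t : X → ℝ) : Prop where
  sep : ∀ p ∈ S, ∀ q ∈ S, p ≠ q → h / 2 ≤ dist p q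
  approx : ∀ p ∈ S, ∀ q ∈ S, |dist p q - (|t p - t q|)| ≤ h / 50

variable {h : ℝ} {S : Set X} {t : X → ℝ}

lemma IsAlmostLinear.ne (hS : IsAlmostLinear h S t) (hh : 0 < h) {p q : X} (hp : p ∈ S)
    (hq : q ∈ S) (hpq : p ≠ q) : t p ≠ t q := by
  intro he
  have h1 := hS.sep p hp q hq hpq
  have h2 := abs_le.1 (hS.approx p hp q hq)
  rw [he, sub_self, abs_zero] at h2
  linarith [h2.2]

lemma IsAlmostLinear.metricBtw_iff (hS : IsAlmostLinear h S t) (hh : 0 < h) {p q r : X}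
    (hp : p ∈ S) (hq : q ∈ S) (hr : r ∈ S) (hpq : p ≠ q) (hqr : q ≠ r) (hpr : p ≠ r) :
    MetricBtw p q r ↔ (t p < t q ∧ t q < t r) ∨ (t r < t q ∧ t q < t p) := by
  have a1 := hS.sep p hp q hq hpq
  have a2 := hS.sep q hq r hr hqr
  have a3 := hS.sep p hp r hr hpr
  obtain ⟨b1, b1'⟩ := abs_le.1 (hS.approx p hp q hq)
  obtain ⟨b2, b2'⟩ := abs_le.1 (hS.approx q hq r hr)
  obtain ⟨b3, b3'⟩ := abs_le.1 (hS.approx p hp r hr)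
  unfold MetricBtw
  rcases abs_cases (t p - t q) with ⟨c1, d1⟩ | ⟨c1, d1⟩ <;>
  rcases abs_cases (t q - t r) with ⟨c2, d2⟩ | ⟨c2, d2⟩ <;>
  rcases abs_cases (t p - t r) with ⟨c3, d3⟩ | ⟨c3, d3⟩ <;>
  rw [c1] at b1 b1' <;> rw [c2] at b2 b2' <;> rw [c3] at b3 b3' <;>
  constructor <;> intro hyp <;>
  first
  | (left; constructor <;> linarith [hyp.1, hyp.2])
  | (right; constructor <;> linarith [hyp.1, hyp.2])
  | (rcases hyp with hyp | hyp <;> constructor <;> linarith [hyp.1, hyp.2])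

lemma IsAlmostLinear.trichotomy (hS : IsAlmostLinear h S t) (hh : 0 < h) {x y v : X}
    (hx : x ∈ S) (hy : y ∈ S) (hv : v ∈ S) (hxy : x ≠ y) (hyv : y ≠ v) (hxv : x ≠ v) :
    MetricBtw x y v ∨ MetricBtw x v y ∨ MetricBtw y x v := by
  rw [hS.metricBtw_iff hh hx hy hv hxy hyv hxv, hS.metricBtw_iff hh hx hv hy hxv hyv.symm hxy,
    hS.metricBtw_iff hh hy hx hv hxy.symm hxv hyv]
  rcases lt_or_gt_of_ne (hS.ne hh hx hy hxy) with h1 | h1 <;>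
  rcases lt_or_gt_of_ne (hS.ne hh hx hv hxv) with h2 | h2 <;>
  rcases lt_or_gt_of_ne (hS.ne hh hy hv hyv) with h3 | h3 <;> simp_all

lemma IsAlmostLinear.metricBtw_replace (hS : IsAlmostLinear h S t) (hh : 0 < h) {z y w u : X}
    (hz : z ∈ S) (hy : y ∈ S) (hw : w ∈ S) (hu : u ∈ S) (hzy : z ≠ y) (hyw : y ≠ w)
    (hzw : z ≠ w) (huz : u ≠ z) (huw : u ≠ w) (huy : u ≠ y)
    (h1 : MetricBtw z y w) (h2 : MetricBtw w z u) : MetricBtw y z u := by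
  rw [hS.metricBtw_iff hh hz hy hw hzy hyw hzw] at h1
  rw [hS.metricBtw_iff hh hw hz hu hzw.symm huz.symm huw.symm] at h2
  rw [hS.metricBtw_iff hh hy hz hu hzy.symm huz.symm huy.symm]
  rcases h1 with h1 | h1 <;> rcases h2 with h2 | h2
  · linarith [h1.1, h1.2, h2.1, h2.2]
  · exact Or.inr ⟨h2.1, h1.1⟩
  · exact Or.inl ⟨h1.2, h2.2⟩
  · linarith [h1.1, h1.2, h2.1, h2.2]

lemma IsAlmostLinear.not_metricBtw (hS : IsAlmostLinear h S t) (hh : 0 < h) {x y u v : X}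
    (hx : x ∈ S) (hy : y ∈ S) (hu : u ∈ S) (hv : v ∈ S) (hxy : x ≠ y) (hyu : y ≠ u)
    (hyv : y ≠ v) (hxu : x ≠ u) (hxv : x ≠ v) (h1 : MetricBtw y x u) (h2 : MetricBtw y x v) :
    ¬ MetricBtw u x v := by
  intro h3
  have huv : u ≠ v := by
    rintro rfl
    have := h3.1
    rw [dist_self] at this
    exact hxu (dist_le_zero.1 this).symm
  rw [hS.metricBtw_iff hh hy hx hu hxy.symm hxu hyu] at h1
  rw [hS.metricBtw_iff hh hy hx hv hxy.symm hxv hyv] at h2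
  rw [hS.metricBtw_iff hh hu hx hv hxu.symm hxv huv] at h3
  rcases h1 with h1 | h1 <;> rcases h2 with h2 | h2 <;> rcases h3 with h3 | h3 <;>
    linarith [h1.1, h1.2, h2.1, h2.2, h3.1, h3.2]

lemma IsAlmostLinear.dist_lt (hS : IsAlmostLinear h S t) (hh : 0 < h) {x y v : X}
    (hx : x ∈ S) (hy : y ∈ S) (hv : v ∈ S) (hxy : x ≠ y) (hyv : y ≠ v) (hxv : x ≠ v)
    (h1 : MetricBtw x v y) : dist v x < dist x y ∧ dist v y < dist x y := by
  rw [hS.metricBtw_iff hh hx hv hy hxv hyv.symm hxy] at h1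
  rw [dist_comm v x]
  have a1 := hS.sep x hx y hy hxy
  have a2 := hS.sep y hy v hv hyv
  have a3 := hS.sep x hx v hv hxv
  obtain ⟨b1, b1'⟩ := abs_le.1 (hS.approx x hx y hy)
  obtain ⟨b2, b2'⟩ := abs_le.1 (hS.approx v hv y hy)
  obtain ⟨b3, b3'⟩ := abs_le.1 (hS.approx x hx v hv)
  rw [dist_comm y v] at a2
  rcases h1 with ⟨h1, h2⟩ | ⟨h1, h2⟩
  · rw [abs_of_neg (by linarith)] at b1 b1' b2 b2' b3 b3'
    constructor <;> linarith
  · rw [abs_of_pos (by linarith)] at b1 b1' b2 b2' b3 b3'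
    constructor <;> linarith

end AlmostLinear

/-- The penalty per open side while refining `X₀` from scale `h` to scale `h / 2`. -/
def sidePenalty {X : Type u} (h : ℝ) (X₀ : Finset X) (z : X) : ℝ :=
  if z ∈ X₀ then 8 * h else 4 * h

lemma sidePenalty_nonneg {X : Type u} {h : ℝ} (hh : 0 ≤ h) (X₀ : Finset X) (z : X) :
    0 ≤ sidePenalty h X₀ z := by
  unfold sidePenalty; split_ifs <;> positivity

section Insertion

variable {X : Type u} [MetricSpace X] {h : ℝ}

lemma sum_insert_le_add {ι : Type*} [DecidableEq ι] {s : Finset ι} {f : ι → ℝ} (hf : ∀ i, 0 ≤ f i) (a : ι) :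
    ∑ i ∈ insert a s, f i ≤ f a + ∑ i ∈ s, f i := by
  by_cases ha : a ∈ s
  · rw [Finset.insert_eq_of_mem ha]
    linarith [hf a]
  · rw [Finset.sum_insert ha]

lemma sum_edgeWeight_attach_le (G : Finset (X × X)) (x y : X) :
    ∑ e ∈ attach G x y, edgeWeight h e ≤ 4 * dist x y + ∑ e ∈ G, edgeWeight h e := by
  have h1 := sum_insert_le_add (s := insert (y, x) G) (edgeWeight_nonneg (h := h)) (x, y)
  have h2 := sum_insert_le_add (s := G) (edgeWeight_nonneg (h := h)) (y, x)
  have h3 := edgeWeight_le (h := h) (x, y)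
  have h4 := edgeWeight_le (h := h) (y, x)
  simp only [dist_comm y x] at h3 h4
  unfold attach
  linarith

lemma sum_edgeWeight_subdivide_le {F : Finset X} {G : Finset (X × X)} (hG : IsNetwork F G)
    {x y v : X} (hxv : ShortNbr h G x v) :
    ∑ e ∈ subdivide G x y v, edgeWeight h e ≤
      4 * (dist x y + dist y v - dist x v) + ∑ e ∈ G, edgeWeight h e := by
  have h1 := sum_edgeWeight_attach_le (h := h) (attach ((G.erase (x, v)).erase (v, x)) x y) v y
  have h2 := sum_edgeWeight_attach_le (h := h) ((G.erase (x, v)).erase (v, x)) x y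
  have hne : (v, x) ≠ (x, v) := fun he => hG.ne _ _ hxv.1 (congrArg Prod.fst he).symm
  have h3 := Finset.add_sum_erase G (edgeWeight h) hxv.1
  have h4 := Finset.add_sum_erase (G.erase (x, v)) (edgeWeight h)
    (Finset.mem_erase.2 ⟨hne, hG.symm _ _ hxv.1⟩)
  have h5 : edgeWeight h (x, v) = 2 * dist x v := edgeWeight_of_short hxv.2
  have h6 : edgeWeight h (v, x) = 2 * dist x v := by
    rw [dist_comm x v]
    exact edgeWeight_of_short (by simpa [dist_comm v x] using hxv.2)
  rw [dist_comm v y] at h1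
  unfold subdivide
  linarith

lemma openness_le_of_replace {G G' : Finset (X × X)} {z w y : X} (hzw : z ≠ w)
    (hG' : ∀ u, (z, u) ∈ G → u ≠ w → (z, u) ∈ G') (hy : ShortNbr h G' z y)
    (hb : ∀ u, ShortNbr h G z u → u ≠ w → MetricBtw w z u → MetricBtw y z u) :
    openness h G' z ≤ openness h G z := by
  have hnot : ¬ MetricBtw w z w := by
    intro hw
    have := hw.1
    rw [dist_self] at this
    exact hzw (dist_le_zero.1 this).symm
  refine openness_mono (fun u _ => ⟨y, hy⟩) ?_
  intro u v hu hv huv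
  by_cases h1 : u = w
  · subst h1
    have h2 : v ≠ u := by rintro rfl; exact hnot huv
    exact ⟨y, v, hy, ⟨hG' v hv.1 h2, hv.2⟩, hb v hv h2 huv⟩
  by_cases h2 : v = w
  · subst h2
    exact ⟨u, y, ⟨hG' u hu.1 h1, hu.2⟩, hy, (hb u hu h1 huv.symm).symm⟩
  · exact ⟨u, v, ⟨hG' u hu.1 h1, hu.2⟩, ⟨hG' v hv.1 h2, hv.2⟩, huv⟩

lemma exists_insert (hh : 0 < h) {X₀ F : Finset X} {G : Finset (X × X)} (hG : IsNetwork F G)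
    {x y : X} (hx : x ∈ F) (hX₀ : X₀ ⊆ F) (hy : y ∉ F) (hxy : dist x y ≤ h) :
    ∃ G', IsNetwork (insert y F) G' ∧
      energy (sidePenalty h X₀) h (insert y F) G' ≤ energy (sidePenalty h X₀) h F G + 8 * h := by
  refine ⟨attach G x y, hG.attach hx hy, ?_⟩
  unfold energy
  rw [Finset.sum_insert hy]
  have h1 := sum_edgeWeight_attach_le (h := h) G x y
  have h2 : sidePenalty h X₀ y = 4 * h := if_neg fun h => hy (hX₀ h)
  have h3 : openness h (attach G x y) y ≤ 1 :=
    openness_le_one (u := x) ⟨mem_attach.2 (by simp), by rw [dist_comm]; linarith⟩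
  have h4 : ∑ z ∈ F, sidePenalty h X₀ z * openness h (attach G x y) z ≤
      ∑ z ∈ F, sidePenalty h X₀ z * openness h G z :=
    Finset.sum_le_sum fun z _ => mul_le_mul_of_nonneg_left
      (openness_mono_of_subset fun e he => mem_attach.2 (Or.inr (Or.inr he)))
      (sidePenalty_nonneg hh.le _ _)
  rw [h2]
  have h5 : 4 * h * openness h (attach G x y) y ≤ 4 * h * 1 :=
    mul_le_mul_of_nonneg_left h3 (by positivity)
  linarith

lemma exists_insert_of_almostLinear (hh : 0 < h) {X₀ F : Finset X} {G : Finset (X × X)}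
    (hG : IsNetwork F G) {x y : X} (hx : x ∈ X₀) (hX₀ : X₀ ⊆ F) (hy : y ∉ F)
    (hxy : dist x y ≤ h) (hnear : ∀ v ∈ X₀, dist x y ≤ dist v y)
    (hord : ∀ v ∈ F, v ∉ X₀ → dist x y ≤ dist v x) {t : X → ℝ}
    (ht : IsAlmostLinear h {p | p ∈ insert y F ∧ dist p y ≤ 18 * h} t) {ε : ℝ} (hε0 : 0 ≤ ε)
    (hε : ∀ v ∈ F, dist x v ≤ 8 * h → MetricBtw x y v → dist x y + dist y v - dist x v ≤ ε) :
    ∃ G', IsNetwork (insert y F) G' ∧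
      energy (sidePenalty h X₀) h (insert y F) G' ≤
        energy (sidePenalty h X₀) h F G + 4 * ε := by
  have hxF : x ∈ F := hX₀ hx
  have hnexy : x ≠ y := fun h => hy (h ▸ hxF)
  have hney : ∀ u ∈ F, u ≠ y := fun u hu h => hy (h ▸ hu)
  have hyS : y ∈ {p | p ∈ insert y F ∧ dist p y ≤ 18 * h} :=
    ⟨Finset.mem_insert_self _ _, by rw [dist_self]; positivity⟩
  have hS : ∀ u ∈ F, dist u y ≤ 18 * h → u ∈ {p | p ∈ insert y F ∧ dist p y ≤ 18 * h} :=
    fun u hu h => ⟨Finset.mem_insert_of_mem hu, h⟩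
  have hxS := hS x hxF (by linarith)
  by_cases hc : ∃ v, ShortNbr h G x v ∧ MetricBtw x y v
  · obtain ⟨v, hxv, hb⟩ := hc
    have hvF : v ∈ F := hG.mem_right hxv.1
    have hnexv : x ≠ v := hG.ne _ _ hxv.1
    have hyv : dist y v ≤ 8 * h := hb.2.trans hxv.2
    have hvx : ShortNbr h G v x := ⟨hG.symm _ _ hxv.1, by rw [dist_comm]; exact hxv.2⟩
    have hvS := hS v hvF (by rw [dist_comm]; linarith)
    refine ⟨subdivide G x y v, hG.subdivide hxv.1 hy, ?_⟩
    have hsx : ShortNbr h (subdivide G x y v) x y := ⟨mem_subdivide.2 (by simp), by linarith⟩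
    have hsv : ShortNbr h (subdivide G x y v) v y :=
      ⟨mem_subdivide.2 (by simp), by rw [dist_comm]; exact hyv⟩
    have hsx' : ShortNbr h (subdivide G x y v) y x :=
      ⟨mem_subdivide.2 (by simp), by rw [dist_comm]; linarith⟩
    have hsv' : ShortNbr h (subdivide G x y v) y v := ⟨mem_subdivide.2 (by simp), hyv⟩
    have hoy : openness h (subdivide G x y v) y = 0 := openness_eq_zero hsx' hsv' hb
    have ho : ∀ z ∈ F, openness h (subdivide G x y v) z ≤ openness h G z := by
      intro z hz
      by_cases hzx : z = x
      · subst hzx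
        refine openness_le_of_replace hnexv (fun u hu huv => mem_subdivide.2 ?_) hsx ?_
        · simp [hu, huv, hnexv]
        · intro u hu huv hbu
          have huF := hG.mem_right hu.1
          refine ht.metricBtw_replace hh hxS hyS hvS (hS u huF ?_) hnexy (hney v hvF).symm hnexv
            (hG.ne _ _ hu.1).symm huv (hney u huF) hb hbu
          linarith [dist_triangle u z y, dist_comm u z, hu.2]
      by_cases hzv : z = v
      · subst hzv
        refine openness_le_of_replace hnexv.symm (fun u hu huv => mem_subdivide.2 ?_) hsv ?_
        · simp [hu, huv, hnexv.symm]
        · intro u hu huv hbu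
          have huF := hG.mem_right hu.1
          refine ht.metricBtw_replace hh hvS hyS hxS (hS u huF ?_) (hney z hvF) hnexy.symm
            hnexv.symm (hG.ne _ _ hu.1).symm huv (hney u huF) hb.symm hbu
          linarith [dist_triangle u z y, dist_comm u z, hu.2, dist_comm y z]
      · have hkeep : ∀ u, ShortNbr h G z u → ShortNbr h (subdivide G x y v) z u :=
          fun u hu => ⟨mem_subdivide.2 (by simp [hzx, hzv, hu.1]), hu.2⟩
        exact openness_mono (fun u hu => ⟨u, hkeep u hu⟩)
          fun u w hu hw hb => ⟨u, w, hkeep u hu, hkeep w hw, hb⟩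
    have h1 := sum_edgeWeight_subdivide_le (y := y) hG hxv
    have h2 := Finset.sum_le_sum fun z hz =>
      mul_le_mul_of_nonneg_left (ho z hz) (sidePenalty_nonneg hh.le X₀ z)
    have h3 := hε v hvF hxv.2 hb
    unfold energy
    rw [Finset.sum_insert hy, hoy, mul_zero, zero_add]
    linarith
  · push Not at hc
    refine ⟨attach G x y, hG.attach hxF hy, ?_⟩
    have hsub : G ⊆ attach G x y := fun e he => mem_attach.2 (Or.inr (Or.inr he))
    have hsy : ShortNbr h (attach G x y) x y := ⟨mem_attach.2 (by simp), by linarith⟩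
    have hoy : openness h (attach G x y) y ≤ 1 :=
      openness_le_one (u := x) ⟨mem_attach.2 (by simp), by rw [dist_comm]; linarith⟩
    have hopp : ∀ v, ShortNbr h G x v →
        v ∈ {p | p ∈ insert y F ∧ dist p y ≤ 18 * h} ∧ MetricBtw y x v := by
      intro v hv
      have hvF : v ∈ F := hG.mem_right hv.1
      have hvS := hS v hvF (by linarith [dist_triangle v x y, dist_comm v x, hv.2])
      refine ⟨hvS, ?_⟩
      have hnexv := hG.ne _ _ hv.1
      have hneyv := (hney v hvF).symm
      rcases ht.trichotomy hh hxS hyS hvS hnexy hneyv hnexv with h1 | h1 | h1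
      · exact absurd h1 (hc v hv)
      · exfalso
        obtain ⟨h2, h3⟩ := ht.dist_lt hh hxS hyS hvS hnexy hneyv hnexv h1
        by_cases hv0 : v ∈ X₀
        · linarith [hnear v hv0]
        · linarith [hord v hvF hv0]
      · exact h1
    have hox : openness h (attach G x y) x + 1 ≤ openness h G x := by
      by_cases hs : ∃ v, ShortNbr h G x v
      · obtain ⟨v, hv⟩ := hs
        rw [openness_eq_zero hsy ⟨hsub hv.1, hv.2⟩ (hopp v hv).2, zero_add]
        refine one_le_openness fun u w hu hw => ?_
        exact ht.not_metricBtw hh hxS hyS (hopp u hu).1 (hopp w hw).1 hnexy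
          (hney u (hG.mem_right hu.1)).symm (hney w (hG.mem_right hw.1)).symm
          (hG.ne _ _ hu.1) (hG.ne _ _ hw.1) (hopp u hu).2 (hopp w hw).2
      · rw [openness_eq_two hs]
        linarith [openness_le_one hsy]
    have h1 := sum_edgeWeight_attach_le (h := h) G x y
    have hpx : sidePenalty h X₀ x = 8 * h := if_pos hx
    have hpy : sidePenalty h X₀ y = 4 * h := if_neg fun h => hy (hX₀ h)
    have h2 : ∑ z ∈ F.erase x, sidePenalty h X₀ z * openness h (attach G x y) z ≤
        ∑ z ∈ F.erase x, sidePenalty h X₀ z * openness h G z :=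
      Finset.sum_le_sum fun z _ => mul_le_mul_of_nonneg_left
        (openness_mono_of_subset hsub) (sidePenalty_nonneg hh.le _ _)
    have h3 := Finset.add_sum_erase F (fun z => sidePenalty h X₀ z * openness h G z) hxF
    have h4 := Finset.add_sum_erase F
      (fun z => sidePenalty h X₀ z * openness h (attach G x y) z) hxF
    simp only [hpx] at h3 h4
    have h5 : 4 * h * openness h (attach G x y) y ≤ 4 * h * 1 :=
      mul_le_mul_of_nonneg_left hoy (by positivity)
    have h6 : 8 * h * (openness h (attach G x y) x + 1) ≤ 8 * h * openness h G x :=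
      mul_le_mul_of_nonneg_left hox (by positivity)
    unfold energy
    rw [Finset.sum_insert hy, hpy]
    linarith

end Insertion

section Smoothness

variable {X : Type u} [NormedAddCommGroup X] [NormedSpace ℝ X] {Cs p : ℝ}

/-- In a uniformly smooth space the norm has a first-order expansion with `p`-power error. -/
lemma exists_norm_add_le (hs : ∀ x y : X, ‖x‖ = 1 → ‖x + y‖ + ‖x - y‖ ≤ 2 + Cs * ‖y‖ ^ p)
    {e : X} (he : ‖e‖ = 1) :
    ∃ g : X → ℝ, (∀ u v, g (u + v) = g u + g v) ∧
      (∀ (s : ℝ) (u : X), 0 < s → s + g u ≤ ‖s • e + u‖) ∧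
      ∀ (s : ℝ) (u : X), 0 < s → ‖s • e + u‖ ≤ s + g u + s * (Cs * (‖u‖ / s) ^ p) := by
  obtain ⟨g, hg1, hge⟩ := exists_dual_vector'' ℝ e
  have hge : g e = 1 := by simpa [he] using hge
  have hle : ∀ w, g w ≤ ‖w‖ := fun w =>
    (le_abs_self _).trans ((g.le_opNorm w).trans (by
      simpa using mul_le_mul_of_nonneg_right hg1 (norm_nonneg w)))
  refine ⟨g, fun u v => map_add g u v, ?_, ?_⟩
  · intro s u _
    have := hle (s • e + u)
    rwa [map_add, map_smul, hge, smul_eq_mul, mul_one] at this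
  · intro s u hs0
    have h1 := hs e (s⁻¹ • u) he
    have h2 := hle (e - s⁻¹ • u)
    rw [map_sub, hge, map_smul, smul_eq_mul] at h2
    have h3 : ‖s⁻¹ • u‖ = ‖u‖ / s := by
      rw [norm_smul, norm_inv, Real.norm_of_nonneg hs0.le]; ring
    rw [h3] at h1
    have h4 : s • e + u = s • (e + s⁻¹ • u) := by
      rw [smul_add, smul_inv_smul₀ hs0.ne']
    rw [h4, norm_smul, Real.norm_of_nonneg hs0.le]
    have h5 : ‖e + s⁻¹ • u‖ ≤ 1 + s⁻¹ * g u + Cs * (‖u‖ / s) ^ p := by linarith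
    have h6 := mul_le_mul_of_nonneg_left h5 hs0.le
    have h7 : s * (s⁻¹ * g u) = g u := mul_inv_cancel_left₀ hs0.ne' _
    linarith

lemma dist_add_dist_sub_dist_le (hs : ∀ x y : X, ‖x‖ = 1 → ‖x + y‖ + ‖x - y‖ ≤ 2 + Cs * ‖y‖ ^ p)
    (hp : 0 ≤ p) (hCs : 0 ≤ Cs) {a e : X} (he : ‖e‖ = 1) {x y v : X} {tx ty tv η : ℝ}
    (hx : dist x (a + tx • e) ≤ η) (hy : dist y (a + ty • e) ≤ η)
    (hv : dist v (a + tv • e) ≤ η) (hxy : tx < ty) (hyv : ty < tv) :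
    dist x y + dist y v - dist x v ≤
      Cs * ((ty - tx) * (2 * η / (ty - tx)) ^ p + (tv - ty) * (2 * η / (tv - ty)) ^ p) := by
  obtain ⟨g, hgadd, hglow, hgup⟩ := exists_norm_add_le hs he
  set x' := x - (a + tx • e) with hx'
  set y' := y - (a + ty • e) with hy'
  set v' := v - (a + tv • e) with hv'
  rw [dist_eq_norm] at hx hy hv
  have e1 : dist x y = ‖(ty - tx) • e + (y' - x')‖ := by
    rw [dist_comm, dist_eq_norm]; congr 1; rw [hx', hy', sub_smul]; abel
  have e2 : dist y v = ‖(tv - ty) • e + (v' - y')‖ := by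
    rw [dist_comm, dist_eq_norm]; congr 1; rw [hv', hy', sub_smul]; abel
  have e3 : dist x v = ‖(tv - tx) • e + (v' - x')‖ := by
    rw [dist_comm, dist_eq_norm]; congr 1; rw [hx', hv', sub_smul]; abel
  have h1 := hgup (ty - tx) (y' - x') (by linarith)
  have h2 := hgup (tv - ty) (v' - y') (by linarith)
  have h3 := hglow (tv - tx) (v' - x') (by linarith)
  have h4 : g (v' - x') = g (v' - y') + g (y' - x') := by rw [← hgadd]; congr 1; abel
  have aux : ∀ (s : ℝ) (u : X), 0 < s → ‖u‖ ≤ 2 * η →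
      s * (Cs * (‖u‖ / s) ^ p) ≤ Cs * (s * (2 * η / s) ^ p) := by
    intro s u hs0 hu
    have : (‖u‖ / s) ^ p ≤ (2 * η / s) ^ p :=
      Real.rpow_le_rpow (by positivity) (by gcongr) hp
    calc s * (Cs * (‖u‖ / s) ^ p) = Cs * (s * (‖u‖ / s) ^ p) := by ring
      _ ≤ _ := by gcongr
  have h5 := aux (ty - tx) (y' - x') (by linarith) ((norm_sub_le _ _).trans (by linarith))
  have h6 := aux (tv - ty) (v' - y') (by linarith) ((norm_sub_le _ _).trans (by linarith))
  rw [e1, e2, e3]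
  linarith

lemma abs_dist_sub_abs_le {a e : X} (he : ‖e‖ = 1) {x y : X} {tx ty η : ℝ}
    (hx : dist x (a + tx • e) ≤ η) (hy : dist y (a + ty • e) ≤ η) :
    |dist x y - (|tx - ty|)| ≤ 2 * η := by
  have h1 : dist (a + tx • e) (a + ty • e) = |tx - ty| := by
    rw [dist_add_left, dist_eq_norm, ← sub_smul, norm_smul, he, mul_one, Real.norm_eq_abs]
  rw [← h1, ← Real.dist_eq]
  calc dist (dist x y) (dist (a + tx • e) (a + ty • e))
      ≤ dist x (a + tx • e) + dist y (a + ty • e) := dist_dist_dist_le x y _ _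
    _ ≤ 2 * η := by linarith

/-- Three points ordered metrically along an almost straight piece have small excess. -/
lemma excess_le_of_metricBtw
    (hs : ∀ x y : X, ‖x‖ = 1 → ‖x + y‖ + ‖x - y‖ ≤ 2 + Cs * ‖y‖ ^ p)
    (hp : 0 ≤ p) (hCs : 0 ≤ Cs) {a e : X} (he : ‖e‖ = 1) {S : Set X} {t : X → ℝ} {h η : ℝ}
    (hh : 0 < h) (hη : 0 ≤ η) (hηh : η ≤ h / 100)
    (hsep : ∀ p ∈ S, ∀ q ∈ S, p ≠ q → h / 2 ≤ dist p q)
    (ht : ∀ z ∈ S, dist z (a + t z • e) ≤ η) {x y v : X} (hx : x ∈ S) (hy : y ∈ S) (hv : v ∈ S)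
    (hxy : x ≠ y) (hyv : y ≠ v) (hxv : x ≠ v) (hd : dist x v ≤ 8 * h) (hb : MetricBtw x y v) :
    dist x y + dist y v - dist x v ≤ 20 * Cs * h * (8 * (η / h)) ^ p := by
  have hS : IsAlmostLinear h S t :=
    ⟨hsep, fun p hp q hq => (abs_dist_sub_abs_le he (ht p hp) (ht q hq)).trans (by linarith)⟩
  have aux : ∀ s : ℝ, h / 4 ≤ s → s ≤ 10 * h →
      s * (2 * η / s) ^ p ≤ 10 * h * (8 * (η / h)) ^ p := by
    intro s h1 h2
    have hs0 : 0 < s := by linarith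
    have : 2 * η / s ≤ 8 * (η / h) := by
      rw [div_le_iff₀ hs0]
      have h3 : 8 * (η / h) * (h / 4) = 2 * η := by field_simp; ring
      have h4 : 0 ≤ 8 * (η / h) := by positivity
      nlinarith
    exact mul_le_mul h2 (Real.rpow_le_rpow (by positivity) this hp) (by positivity) (by positivity)
  have a1 := hsep x hx y hy hxy
  have a2 := hsep y hy v hv hyv
  obtain ⟨b1, b1'⟩ := abs_le.1 (hS.approx x hx y hy)
  obtain ⟨b2, b2'⟩ := abs_le.1 (hS.approx y hy v hv)
  have d1 := hb.1
  have d2 := hb.2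
  rcases (hS.metricBtw_iff hh hx hy hv hxy hyv hxv).1 hb with ⟨c1, c2⟩ | ⟨c1, c2⟩
  · have h1 := dist_add_dist_sub_dist_le hs hp hCs he (ht x hx) (ht y hy) (ht v hv) c1 c2
    rw [abs_of_neg (by linarith)] at b1 b1' b2 b2'
    have h2 := aux (t y - t x) (by linarith) (by linarith)
    have h3 := aux (t v - t y) (by linarith) (by linarith)
    have := mul_le_mul_of_nonneg_left (add_le_add h2 h3) hCs
    linarith
  · have h1 := dist_add_dist_sub_dist_le hs hp hCs he (ht v hv) (ht y hy) (ht x hx) c1 c2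
    rw [abs_of_pos (by linarith)] at b1 b1' b2 b2'
    have h2 := aux (t y - t v) (by linarith) (by linarith)
    have h3 := aux (t x - t y) (by linarith) (by linarith)
    have := mul_le_mul_of_nonneg_left (add_le_add h2 h3) hCs
    rw [dist_comm v y, dist_comm y x, dist_comm v x] at h1
    linarith

end Smoothness

section Beta

variable {X : Type u} [NormedAddCommGroup X] [NormedSpace ℝ X]

lemma exists_line_of_jonesBeta_lt [Nontrivial X] {E : Set X} {y : X}
    (hy : y ∈ E) {R θ : ℝ} (hR : 0 < R) (hθ : jonesBeta E (closedBall y R) < θ) :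
    ∃ (a e : X) (t : X → ℝ), ‖e‖ = 1 ∧
      ∀ z ∈ E, dist z y ≤ R → dist z (a + t z • e) ≤ θ * (2 * R) := by
  have hne : ¬ E ∩ closedBall y R = ∅ := by
    rw [← Ne, ← nonempty_iff_ne_empty]
    exact ⟨y, hy, mem_closedBall_self hR.le⟩
  unfold jonesBeta at hθ
  rw [if_neg hne] at hθ
  obtain ⟨w, hw⟩ := exists_ne (0 : X)
  have hnon : {r : ℝ | ∃ a v : X, v ≠ 0 ∧ r = sSup ((fun x => infDist x (lineThrough a v) /
      Metric.diam (closedBall y R)) '' (E ∩ closedBall y R))}.Nonempty := ⟨_, 0, w, hw, rfl⟩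
  obtain ⟨r, ⟨a, v, hv, rfl⟩, hr⟩ := exists_lt_of_csInf_lt hnon hθ
  rw [diam_closedBall_eq y hR.le] at hr
  have hlt : ∀ z ∈ E, dist z y ≤ R → ∃ s : ℝ, dist z (a + s • v) < θ * (2 * R) := by
    intro z hz hzy
    have hbdd : BddAbove ((fun x => infDist x (lineThrough a v) / (2 * R)) ''
        (E ∩ closedBall y R)) := by
      refine ⟨(dist y a + R) / (2 * R), ?_⟩
      rintro _ ⟨x, ⟨-, hx⟩, rfl⟩
      have h1 : infDist x (lineThrough a v) ≤ dist x a :=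
        infDist_le_dist_of_mem ⟨0, by simp⟩
      have h2 := dist_triangle x y a
      have h3 : dist x y ≤ R := hx
      simp only
      gcongr
      linarith
    have h1 := (le_csSup hbdd ⟨z, ⟨hz, hzy⟩, rfl⟩).trans_lt hr
    simp only at h1
    rw [div_lt_iff₀ (by positivity)] at h1
    have hL : (lineThrough a v).Nonempty := ⟨a, 0, by simp⟩
    obtain ⟨_, ⟨s, rfl⟩, hs⟩ := (infDist_lt_iff hL).1 h1
    exact ⟨s, hs⟩
  choose! s hs using hlt
  refine ⟨a, ‖v‖⁻¹ • v, fun z => s z * ‖v‖, norm_smul_inv_norm hv, ?_⟩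
  intro z hz hzy
  rw [smul_smul, mul_inv_cancel_right₀ (norm_ne_zero_iff.2 hv)]
  exact (hs z hz hzy).le

/-- Refinement cost factor: `refineConst p Cs A * β ^ p * h` pays for one new vertex. -/
def refineConst (p Cs A : ℝ) : ℝ := 80 * Cs * (8 * A) ^ p + 8 * (100 * A) ^ p

lemma exists_insert_of_jonesBeta [Nontrivial X] {p Cs A : ℝ} (hp : 0 < p) (hCs : 0 ≤ Cs)
    (hA : 240 ≤ A)
    (hs : ∀ x y : X, ‖x‖ = 1 → ‖x + y‖ + ‖x - y‖ ≤ 2 + Cs * ‖y‖ ^ p)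
    {E : Set X} {h : ℝ} (hh : 0 < h)
    {X₀ F : Finset X} {G : Finset (X × X)} (hG : IsNetwork F G) {x y : X} (hx : x ∈ X₀)
    (hX₀ : X₀ ⊆ F) (hy : y ∉ F) (hFE : ∀ z ∈ insert y F, z ∈ E)
    (hsep : ∀ p ∈ insert y F, ∀ q ∈ insert y F, p ≠ q → h / 2 ≤ dist p q)
    (hxy : dist x y ≤ h) (hnear : ∀ v ∈ X₀, dist x y ≤ dist v y)
    (hord : ∀ v ∈ F, v ∉ X₀ → dist x y ≤ dist v x) :
    ∃ G', IsNetwork (insert y F) G' ∧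
      energy (sidePenalty h X₀) h (insert y F) G' ≤ energy (sidePenalty h X₀) h F G +
        refineConst p Cs A * jonesBeta E (closedBall y (A * (h / 2))) ^ p * h := by
  set β := jonesBeta E (closedBall y (A * (h / 2))) with hβ
  have hβ0 : 0 ≤ β := jonesBeta_nonneg _ _
  have hA0 : 0 < A := by linarith
  have hAh : 0 < A * (h / 2) := by positivity
  have hyE : y ∈ E := hFE y (Finset.mem_insert_self _ _)
  have hrad : 18 * h ≤ A * (h / 2) := by nlinarith
  rcases lt_or_ge β (1 / (100 * A)) with hflat | hbad
  · set S : Set X := {p | p ∈ insert y F ∧ dist p y ≤ 18 * h} with hSdef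
    have hSsep : ∀ p ∈ S, ∀ q ∈ S, p ≠ q → h / 2 ≤ dist p q :=
      fun p hp q hq => hsep p hp.1 q hq.1
    have hxF : x ∈ F := hX₀ hx
    obtain ⟨G', hG', hle⟩ : ∃ G', IsNetwork (insert y F) G' ∧
        energy (sidePenalty h X₀) h (insert y F) G' ≤ energy (sidePenalty h X₀) h F G +
          4 * (20 * Cs * h * (8 * (A * β)) ^ p) := by
      obtain ⟨a, e, t, he, ht⟩ := exists_line_of_jonesBeta_lt hyE hAh hflat
      have hη : 1 / (100 * A) * (2 * (A * (h / 2))) = h / 100 := by field_simp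
      rw [hη] at ht
      have hS : IsAlmostLinear h S t := by
        refine ⟨hSsep, fun p hp q hq => ?_⟩
        refine (abs_dist_sub_abs_le he (ht p (hFE p hp.1) (hp.2.trans hrad))
          (ht q (hFE q hq.1) (hq.2.trans hrad))).trans (by linarith)
      refine exists_insert_of_almostLinear hh hG hx hX₀ hy hxy hnear hord hS (by positivity) ?_
      intro v hv hxv hb
      have hyv : dist v y ≤ 18 * h := by rw [dist_comm]; linarith [hb.2]
      have hyS : y ∈ S := ⟨Finset.mem_insert_self _ _, by rw [dist_self]; positivity⟩
      have hxS : x ∈ S := ⟨Finset.mem_insert_of_mem hxF, by linarith⟩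
      have hvS : v ∈ S := ⟨Finset.mem_insert_of_mem hv, hyv⟩
      have hxney : x ≠ y := fun h => hy (h ▸ hxF)
      have hynev : y ≠ v := fun h => hy (h ▸ hv)
      have hxnev : x ≠ v := by
        rintro rfl
        have := hb.1
        rw [dist_self] at this
        exact hxney (dist_le_zero.1 this)
      have hlim : ∀ θ, β < θ → θ ≤ 1 / (100 * A) →
          dist x y + dist y v - dist x v ≤ 20 * Cs * h * (8 * (A * θ)) ^ p := by
        intro θ h1 h2
        obtain ⟨a, e, t, he, ht⟩ := exists_line_of_jonesBeta_lt hyE hAh h1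
        have hθh : θ * (2 * (A * (h / 2))) / h = A * θ := by field_simp
        rw [← hθh]
        refine excess_le_of_metricBtw hs hp.le hCs he hh ?_ ?_ hSsep
          (fun z hz => ht z (hFE z hz.1) (hz.2.trans hrad)) hxS hyS hvS hxney hynev hxnev hxv hb
        · have : 0 ≤ θ := hβ0.trans h1.le
          positivity
        · rw [← hη]; gcongr
      have hcont : Continuous fun θ : ℝ => 20 * Cs * h * (8 * (A * θ)) ^ p :=
        continuous_const.mul ((continuous_const.mul (continuous_const.mul continuous_id)).rpow_const
          fun _ => Or.inr hp.le)
      refine ge_of_tendsto (hcont.continuousWithinAt (s := Ioi β) (x := β)) ?_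
      filter_upwards [Ioc_mem_nhdsGT hflat] with θ hθ
      exact hlim θ hθ.1 hθ.2
    refine ⟨G', hG', hle.trans ?_⟩
    have h1 : (8 * (A * β)) ^ p = (8 * A) ^ p * β ^ p := by
      rw [← mul_assoc, Real.mul_rpow (by positivity) hβ0]
    have h2 : 0 ≤ 8 * (100 * A) ^ p * β ^ p * h := by positivity
    rw [h1]
    unfold refineConst
    linarith
  · obtain ⟨G', hG', hle⟩ := exists_insert hh hG (hX₀ hx) hX₀ hy hxy
    refine ⟨G', hG', hle.trans ?_⟩
    have h1 : 1 ≤ (100 * A) ^ p * β ^ p := by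
      rw [← Real.mul_rpow (by positivity) hβ0]
      refine Real.one_le_rpow ?_ hp.le
      rw [div_le_iff₀ (by positivity)] at hbad
      linarith
    have h2 : 0 ≤ 80 * Cs * (8 * A) ^ p * β ^ p * h := by positivity
    have h3 := mul_le_mul_of_nonneg_right h1 (by positivity : 0 ≤ 8 * h)
    unfold refineConst
    linarith

end Beta

lemma energy_mono {X : Type u} [MetricSpace X] {κ κ' : X → ℝ} {h : ℝ} {F : Finset X} {G : Finset (X × X)}
    (hκ : ∀ z ∈ F, κ z ≤ κ' z) : energy κ h F G ≤ energy κ' h F G := by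
  unfold energy
  gcongr with z hz
  · exact openness_nonneg
  · exact hκ z hz

section Refinement

variable {X : Type u} [NormedAddCommGroup X] [NormedSpace ℝ X]

lemma refineConst_nonneg {p Cs A : ℝ} (hCs : 0 ≤ Cs) (hA : 0 ≤ A) : 0 ≤ refineConst p Cs A := by
  unfold refineConst; positivity

/-- Passing to a finer net, by inserting the new points in order of decreasing distance to the
old ones. -/
lemma exists_refinement [Nontrivial X] {p Cs A : ℝ} (hp : 0 < p) (hCs : 0 ≤ Cs) (hA : 240 ≤ A)
    (hs : ∀ x y : X, ‖x‖ = 1 → ‖x + y‖ + ‖x - y‖ ≤ 2 + Cs * ‖y‖ ^ p)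
    {E : Set X} {h : ℝ} (hh : 0 < h) {X₀ X₁ : Finset X} (h01 : X₀ ⊆ X₁)
    (hE : ∀ z ∈ X₁, z ∈ E) (hsep : ∀ p ∈ X₁, ∀ q ∈ X₁, p ≠ q → h / 2 ≤ dist p q)
    (hcov : ∀ y ∈ X₁, ∃ x ∈ X₀, dist x y ≤ h) {G : Finset (X × X)} (hG : IsNetwork X₀ G) :
    ∃ G', IsNetwork X₁ G' ∧
      energy (fun _ => 4 * h) (h / 2) X₁ G' ≤ energy (fun _ => 8 * h) h X₀ G +
        ∑ y ∈ X₁, refineConst p Cs A * jonesBeta E (closedBall y (A * (h / 2))) ^ p * h := by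
  set b : X → ℝ := fun y => refineConst p Cs A * jonesBeta E (closedBall y (A * (h / 2))) ^ p * h
    with hb
  have hb0 : ∀ y, 0 ≤ b y := fun y => by
    have := refineConst_nonneg (p := p) hCs (by linarith : 0 ≤ A)
    have := jonesBeta_nonneg E (closedBall y (A * (h / 2)))
    positivity
  have key : ∀ S : Finset X, S ⊆ X₁ \ X₀ → ∃ G', IsNetwork (X₀ ∪ S) G' ∧
      energy (sidePenalty h X₀) h (X₀ ∪ S) G' ≤ energy (sidePenalty h X₀) h X₀ G +
        ∑ y ∈ S, b y := by
    intro S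
    induction S using Finset.induction_on_min_value (fun y => infDist y (X₀ : Set X)) with
    | empty => exact fun _ => ⟨G, by simpa using hG, by simp⟩
    | insert y S hyS hmin ih =>
      intro hsub
      obtain ⟨hy, hS⟩ := Finset.insert_subset_iff.1 hsub
      obtain ⟨G₁, hG₁, hle₁⟩ := ih hS
      obtain ⟨hy1, hy0⟩ := Finset.mem_sdiff.1 hy
      obtain ⟨w, hw, hwy⟩ := hcov y hy1
      obtain ⟨x, hx, hxmin⟩ := X₀.exists_min_image (fun x => dist x y) ⟨w, hw⟩
      have hne : (X₀ : Set X).Nonempty := ⟨w, hw⟩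
      have hins : insert y (X₀ ∪ S) ⊆ X₁ := by
        refine Finset.insert_subset hy1 (Finset.union_subset h01 ?_)
        exact hS.trans Finset.sdiff_subset
      obtain ⟨G₂, hG₂, hle₂⟩ := exists_insert_of_jonesBeta hp hCs hA hs hh hG₁ hx
        Finset.subset_union_left (by simp [hy0, hyS]) (fun z hz => hE z (hins hz))
        (fun p hp q hq => hsep p (hins hp) q (hins hq)) ((hxmin w hw).trans hwy) hxmin
        (by
          intro v hv hv0
          have hvS : v ∈ S := (Finset.mem_union.1 hv).resolve_left hv0
          have h1 : dist x y ≤ infDist y (X₀ : Set X) := by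
            refine (le_infDist hne).2 fun z hz => ?_
            rw [dist_comm y z]
            exact hxmin z hz
          exact h1.trans ((hmin v hvS).trans (infDist_le_dist_of_mem hx)))
      refine ⟨G₂, by rwa [Finset.union_insert], ?_⟩
      rw [Finset.union_insert, Finset.sum_insert hyS]
      have : energy (sidePenalty h X₀) h (insert y (X₀ ∪ S)) G₂ ≤
        energy (sidePenalty h X₀) h (X₀ ∪ S) G₁ + b y := hle₂
      linarith
  obtain ⟨G', hG', hle⟩ := key _ subset_rfl
  rw [Finset.union_sdiff_of_subset h01] at hG' hle
  refine ⟨G', hG', (energy_half_le hh.le hG').trans ?_⟩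
  have h1 : energy (fun _ => 4 * h) h X₁ G' ≤ energy (sidePenalty h X₀) h X₁ G' :=
    energy_mono fun z _ => by unfold sidePenalty; split_ifs <;> linarith
  have h2 : energy (sidePenalty h X₀) h X₀ G ≤ energy (fun _ => 8 * h) h X₀ G :=
    energy_mono fun z hz => by rw [sidePenalty, if_pos hz]
  have h3 : ∑ y ∈ X₁ \ X₀, b y ≤ ∑ y ∈ X₁, b y :=
    Finset.sum_le_sum_of_subset_of_nonneg Finset.sdiff_subset fun y _ _ => hb0 y
  linarith

end Refinement

section Finiteness

variable {X : Type u} [NormedAddCommGroup X] [NormedSpace ℝ X]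

/-- A separated set close to a line segment is finite. -/
lemma finite_of_near_line {S : Set X} {a e x : X} {t : X → ℝ} {h : ℝ} (he : ‖e‖ = 1)
    (hh : 0 < h) (hsep : ∀ p ∈ S, ∀ q ∈ S, p ≠ q → h / 2 ≤ dist p q)
    (ht : ∀ z ∈ S, dist z (a + t z • e) ≤ h / 100) (hx : ∀ z ∈ S, dist z x ≤ h) : S.Finite := by
  have happ : ∀ p ∈ S, ∀ q ∈ S, |dist p q - (|t p - t q|)| ≤ 2 * (h / 100) := fun p hp q hq =>
    (abs_dist_sub_abs_le he (ht p hp) (ht q hq)).trans (by linarith)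
  rcases S.eq_empty_or_nonempty with rfl | ⟨w, hw⟩
  · exact finite_empty
  refine Set.Finite.of_injOn (f := fun z => ⌊(t z - t w) / (h / 4)⌋) (t := Icc (-20 : ℤ) 20)
    ?_ ?_ (finite_Icc _ _)
  · intro z hz
    have h1 := abs_le.1 (happ z hz w hw)
    have h2 := dist_triangle_right z w x
    have h3 := hx z hz
    have h4 := hx w hw
    have h5 : |t z - t w| ≤ 5 * h := by linarith [h1.1]
    obtain ⟨h6, h7⟩ := abs_le.1 h5
    constructor
    · rw [Int.le_floor, le_div_iff₀ (by positivity)]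
      push_cast
      linarith
    · have : ((⌊(t z - t w) / (h / 4)⌋ : ℤ) : ℝ) ≤ 20 := by
        refine (Int.floor_le _).trans ?_
        rw [div_le_iff₀ (by positivity)]
        linarith
      exact_mod_cast this
  · intro p hp q hq hpq
    by_contra hne
    have h1 := hsep p hp q hq hne
    have h2 := abs_le.1 (happ p hp q hq)
    have h3 := Int.abs_sub_lt_one_of_floor_eq_floor hpq
    rw [← sub_div, abs_div, abs_of_pos (by positivity : 0 < h / 4), div_lt_one (by positivity)] at h3
    rw [sub_sub_sub_cancel_right] at h3
    linarith [h2.2]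

lemma finite_net_succ [Nontrivial X] {p A : ℝ} (hp : 0 < p) (hA : 240 ≤ A) {E : Set X} {h : ℝ}
    (hh : 0 < h) {X₀ X₁ : Set X} (h0 : X₀.Finite) (hE : X₁ ⊆ E)
    (hsep : ∀ p ∈ X₁, ∀ q ∈ X₁, p ≠ q → h / 2 ≤ dist p q)
    (hcov : ∀ y ∈ X₁, ∃ x ∈ X₀, dist x y ≤ h)
    (hsum : ∑' x : X₁, ENNReal.ofReal (jonesBeta E (closedBall (x : X) (A * (h / 2))) ^ p *
      Metric.diam (closedBall (x : X) (A * (h / 2)))) ≠ ∞) : X₁.Finite := by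
  set β : X → ℝ := fun y => jonesBeta E (closedBall y (A * (h / 2))) with hβ
  have hAh : 0 < A * (h / 2) := by positivity
  have hrad : 18 * h ≤ A * (h / 2) := by nlinarith
  have hbad : {y ∈ X₁ | 1 / (100 * A) ≤ β y}.Finite := by
    have hc : 0 < (1 / (100 * A)) ^ p * (2 * (A * (h / 2))) := by positivity
    have h1 := ENNReal.finite_const_le_of_tsum_ne_top hsum (ENNReal.ofReal_pos.2 hc).ne'
    refine (h1.image Subtype.val).subset ?_
    rintro y ⟨hy, hby⟩
    refine ⟨⟨y, hy⟩, ?_, rfl⟩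
    refine ENNReal.ofReal_le_ofReal ?_
    rw [diam_closedBall_eq y hAh.le]
    gcongr
  have hflat : {y ∈ X₁ | β y < 1 / (100 * A)}.Finite := by
    refine (h0.biUnion (t := fun x => {y ∈ X₁ | β y < 1 / (100 * A) ∧ dist y x ≤ h}) ?_).subset ?_
    · intro x hx
      rcases Set.eq_empty_or_nonempty {y ∈ X₁ | β y < 1 / (100 * A) ∧ dist y x ≤ h} with h1 | ⟨w, hw⟩
      · rw [h1]; exact finite_empty
      obtain ⟨a, e, t, he, ht⟩ := exists_line_of_jonesBeta_lt (hE hw.1) hAh hw.2.1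
      have hη : 1 / (100 * A) * (2 * (A * (h / 2))) = h / 100 := by field_simp
      rw [hη] at ht
      refine finite_of_near_line he hh (fun p hp q hq => hsep p hp.1 q hq.1)
        (fun z hz => ht z (hE hz.1) ?_) (fun z hz => hz.2.2)
      linarith [dist_triangle_right z w x, hz.2.2, hw.2.2]
    · rintro y ⟨hy, hby⟩
      obtain ⟨x, hx, hxy⟩ := hcov y hy
      exact mem_biUnion hx ⟨hy, hby, by rwa [dist_comm]⟩
  refine (hbad.union hflat).subset fun y hy => ?_
  rcases le_or_gt (1 / (100 * A)) (β y) with h1 | h1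
  · exact Or.inl ⟨hy, h1⟩
  · exact Or.inr ⟨hy, h1⟩

end Finiteness

section Levels

variable {X : Type u} [NormedAddCommGroup X] [NormedSpace ℝ X]

lemma toReal_tsum_ofReal {α : Type*} (F : Finset α) {f : α → ℝ} (hf : ∀ x, 0 ≤ f x) :
    (∑' x : (F : Set α), ENNReal.ofReal (f x)).toReal = ∑ x ∈ F, f x := by
  rw [Finset.tsum_subtype' F fun x => ENNReal.ofReal (f x),
    ← ENNReal.ofReal_sum_of_nonneg fun x _ => hf x,
    ENNReal.toReal_ofReal (Finset.sum_nonneg fun x _ => hf x)]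

/-- The contribution of level `k` to `betaSum`. -/
def levelSum (E : Set X) (net : ℤ → Set X) (A p : ℝ) (k : ℤ) : ℝ≥0∞ :=
  ∑' x : net k, ENNReal.ofReal (jonesBeta E (closedBall (x : X) (A * (2 : ℝ) ^ (-k))) ^ p *
      Metric.diam (closedBall (x : X) (A * (2 : ℝ) ^ (-k))))

lemma sum_toReal_levelSum_le {E : Set X} {net : ℤ → Set X} {A p : ℝ}
    (hb : betaSum E net A p ≠ ∞) (S : Finset ℤ) :
    ∑ k ∈ S, (levelSum E net A p k).toReal ≤ (betaSum E net A p).toReal := by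
  have h1 : ∑ k ∈ S, levelSum E net A p k ≤ betaSum E net A p := ENNReal.sum_le_tsum S
  have h2 : ∀ k ∈ S, levelSum E net A p k ≠ ∞ := fun k _ => ENNReal.ne_top_of_tsum_ne_top hb k
  rw [← ENNReal.toReal_sum h2]
  exact ENNReal.toReal_mono hb h1

lemma exists_network_of_level [Nontrivial X] {p Cs A : ℝ} (hp : 0 < p) (hCs : 0 ≤ Cs)
    (hA : 240 ≤ A) (hs : ∀ x y : X, ‖x‖ = 1 → ‖x + y‖ + ‖x - y‖ ≤ 2 + Cs * ‖y‖ ^ p)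
    {E : Set X} {net : ℤ → Set X} (hne : E.Nonempty) (hE : IsBounded E)
    (hnet : IsMultiresolution E net) (hb : betaSum E net A p ≠ ∞) {k₀ : ℤ}
    (hk : Metric.diam E < 2 ^ (-k₀)) (n : ℕ) :
    ∃ (F : Finset X) (G : Finset (X × X)), (F : Set X) = net (k₀ + n) ∧ IsNetwork F G ∧
      energy (fun _ => 8 * 2 ^ (-(k₀ + n))) (2 ^ (-(k₀ + n))) F G ≤ 16 * 2 ^ (-k₀) +
        refineConst p Cs A *
          ∑ i ∈ Finset.range n, (levelSum E net A p (k₀ + (i + 1 : ℕ))).toReal := by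
  obtain ⟨⟨hsub, hmono, hsep⟩, hcov⟩ := hnet
  induction n with
  | zero =>
    obtain ⟨e, he⟩ := hne
    obtain ⟨x, hx, -⟩ := hcov k₀ e he
    refine ⟨{x}, ∅, ?_, isNetwork_singleton x, ?_⟩
    · rw [Finset.coe_singleton, Nat.cast_zero, add_zero]
      refine (eq_singleton_iff_unique_mem.2 ⟨hx, fun y hy => ?_⟩).symm
      by_contra hyx
      exact absurd ((hsep k₀ y hy x hx hyx).trans
        (dist_le_diam_of_mem hE (hsub _ hy) (hsub _ hx))) (not_le.2 hk)
    · have h1 : openness (2 ^ (-k₀)) (∅ : Finset (X × X)) x ≤ 2 := openness_le_two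
      have h2 : (0 : ℝ) < 2 ^ (-k₀) := by positivity
      simp only [energy, Finset.sum_empty, Finset.sum_singleton, Finset.range_zero, mul_zero,
        Nat.cast_zero, add_zero, zero_add]
      nlinarith
  | succ n ih =>
    obtain ⟨F, G, hF, hG, hle⟩ := ih
    set h : ℝ := 2 ^ (-(k₀ + n)) with hh
    have hh0 : 0 < h := by positivity
    have hhalf : (2 : ℝ) ^ (-(k₀ + (n + 1 : ℕ))) = h / 2 := by
      rw [hh, show -(k₀ + ((n + 1 : ℕ) : ℤ)) = -(k₀ + n) - 1 by push_cast; ring,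
        zpow_sub₀ two_ne_zero, zpow_one]
    have hcov' : ∀ y ∈ net (k₀ + (n + 1 : ℕ)), ∃ x ∈ net (k₀ + n), dist x y ≤ h := by
      intro y hy
      obtain ⟨x, hx, hyx⟩ := hcov (k₀ + n) y (hsub _ hy)
      exact ⟨x, hx, by rwa [dist_comm]⟩
    have hlev : levelSum E net A p (k₀ + (n + 1 : ℕ)) ≠ ∞ :=
      ENNReal.ne_top_of_tsum_ne_top hb _
    have hsep' := hsep (k₀ + (n + 1 : ℕ))
    unfold levelSum at hlev
    rw [hhalf] at hlev hsep' ⊢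
    have hfin : (net (k₀ + (n + 1 : ℕ))).Finite :=
      finite_net_succ hp hA hh0 (hF ▸ F.finite_toSet) (hsub _) hsep' hcov' hlev
    obtain ⟨F', hF'⟩ := hfin.exists_finset_coe
    have hmem : ∀ z, z ∈ F' ↔ z ∈ net (k₀ + (n + 1 : ℕ)) := fun z => by
      rw [← hF', Finset.mem_coe]
    have hmem0 : ∀ z, z ∈ F ↔ z ∈ net (k₀ + n) := fun z => by rw [← hF, Finset.mem_coe]
    have hFF : F ⊆ F' := by
      intro z hz
      rw [hmem, Nat.cast_succ, ← add_assoc]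
      exact hmono _ ((hmem0 z).1 hz)
    obtain ⟨G', hG', hle'⟩ := exists_refinement hp hCs hA hs hh0 hFF
      (fun z hz => hsub _ ((hmem z).1 hz))
      (fun p hp q hq => hsep' p ((hmem p).1 hp) q ((hmem q).1 hq))
      (fun y hy => by
        obtain ⟨x, hx, hxy⟩ := hcov' y ((hmem y).1 hy)
        exact ⟨x, (hmem0 x).2 hx, hxy⟩) hG
    refine ⟨F', G', hF', hG', ?_⟩
    have hR := refineConst_nonneg (p := p) hCs (by linarith : 0 ≤ A)
    have hT : (levelSum E net A p (k₀ + (n + 1 : ℕ))).toReal =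
        ∑ y ∈ F', jonesBeta E (closedBall y (A * (h / 2))) ^ p *
          Metric.diam (closedBall y (A * (h / 2))) := by
      unfold levelSum
      rw [hhalf, ← hF']
      exact toReal_tsum_ofReal F' (f := fun y =>
        jonesBeta E (closedBall y (A * (h / 2))) ^ p * Metric.diam (closedBall y (A * (h / 2))))
        fun x => mul_nonneg (Real.rpow_nonneg (jonesBeta_nonneg _ _) _) diam_nonneg
    have hsum : ∑ y ∈ F', refineConst p Cs A * jonesBeta E (closedBall y (A * (h / 2))) ^ p * h ≤
        refineConst p Cs A * (levelSum E net A p (k₀ + (n + 1 : ℕ))).toReal := by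
      rw [hT, Finset.mul_sum]
      refine Finset.sum_le_sum fun y _ => ?_
      rw [mul_assoc]
      have hβ := Real.rpow_nonneg (jonesBeta_nonneg E (closedBall y (A * (h / 2)))) p
      have hdiam : h ≤ Metric.diam (closedBall y (A * (h / 2))) := by
        rw [diam_closedBall_eq y (by positivity)]
        nlinarith
      gcongr
    rw [Finset.sum_range_succ, mul_add, show 8 * (h / 2) = 4 * h by ring]
    linarith

lemma exists_network_length_le [Nontrivial X] {p Cs A : ℝ} (hp : 0 < p) (hCs : 0 ≤ Cs)
    (hA : 240 ≤ A) (hs : ∀ x y : X, ‖x‖ = 1 → ‖x + y‖ + ‖x - y‖ ≤ 2 + Cs * ‖y‖ ^ p)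
    {E : Set X} {net : ℤ → Set X} (hne : E.Nonempty) (hE : IsBounded E)
    (hnet : IsMultiresolution E net) (hb : betaSum E net A p ≠ ∞) {k₀ : ℤ}
    (hk : Metric.diam E < 2 ^ (-k₀)) (n : ℕ) :
    ∃ (F : Finset X) (G : Finset (X × X)), (F : Set X) = net (k₀ + n) ∧ IsNetwork F G ∧
      ∑ e ∈ G, dist e.1 e.2 ≤ 16 * 2 ^ (-k₀) +
        refineConst p Cs A * (betaSum E net A p).toReal := by
  obtain ⟨F, G, hF, hG, hle⟩ := exists_network_of_level hp hCs hA hs hne hE hnet hb hk n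
  refine ⟨F, G, hF, hG, ?_⟩
  have h1 : ∑ e ∈ G, dist e.1 e.2 ≤ ∑ e ∈ G, edgeWeight (2 ^ (-(k₀ + n))) e :=
    Finset.sum_le_sum fun e _ => dist_le_edgeWeight e
  have h2 : 0 ≤ ∑ z ∈ F, 8 * (2 : ℝ) ^ (-(k₀ + n)) * openness (2 ^ (-(k₀ + n))) G z :=
    Finset.sum_nonneg fun z _ => mul_nonneg (by positivity) openness_nonneg
  have h3 : ∑ i ∈ Finset.range n, (levelSum E net A p (k₀ + (i + 1 : ℕ))).toReal ≤
      (betaSum E net A p).toReal := by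
    refine le_trans (le_of_eq ?_) (sum_toReal_levelSum_le hb
      ((Finset.range n).image fun i : ℕ => k₀ + (i + 1 : ℕ)))
    rw [Finset.sum_image]
    intro a _ b _ hab
    simpa using hab
  have h4 := mul_le_mul_of_nonneg_left h3
    (refineConst_nonneg (p := p) hCs (by linarith : 0 ≤ A))
  unfold energy at hle
  linarith

end Levels

/-- In a connected graph some edge leaves any proper nonempty set of vertices. -/
lemma IsNetwork.exists_exit {X : Type u} {F : Finset X} {G : Finset (X × X)} (hG : IsNetwork F G)
    {S : Finset X} (hS : S ⊆ F) (hne : S.Nonempty) (hSF : S ≠ F) :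
    ∃ s ∈ S, ∃ t, t ∉ S ∧ (s, t) ∈ G := by
  obtain ⟨a, ha⟩ := hne
  obtain ⟨b, hb, hbS⟩ : ∃ b ∈ F, b ∉ S := by
    by_contra! hcon
    exact hSF (hS.antisymm hcon)
  by_contra! hcon
  have : ∀ c, Relation.ReflTransGen (fun a b => (a, b) ∈ G) a c → c ∈ S := by
    intro c hc
    induction hc with
    | refl => exact ha
    | tail _ hbc ih =>
      by_contra h
      exact hcon _ ih _ h hbc
  exact hbS (this b (hG.conn a (hS ha) b hb))

lemma hausdorffMeasure_image_Icc_le {X : Type u} [NormedAddCommGroup X] [MeasurableSpace X] [BorelSpace X] {M : ℝ≥0} {f : ℝ → X}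
    (hf : LipschitzWith M f) : μH[1] (f '' Icc 0 1) ≤ M := by
  have h1 := hf.hausdorffMeasure_image_le zero_le_one (Icc (0 : ℝ) 1)
  rw [hausdorffMeasure_real, Real.volume_Icc] at h1
  simpa using h1

/-- Compactness: a bound for paths through every set of an increasing sequence passes to
a single path through all of them. -/
lemma exists_limit_path {X : Type u} [NormedAddCommGroup X] {K : Set X} (hK : IsCompact K) {M : ℝ≥0} {V : ℕ → Set X}
    (hV : Monotone V)
    (hpath : ∀ n, ∃ f : ℝ → X, LipschitzWith M f ∧ (∀ u, f u ∈ K) ∧ V n ⊆ f '' Icc 0 1) :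
    ∃ f : ℝ → X, LipschitzWith M f ∧ ∀ n, V n ⊆ f '' Icc 0 1 := by
  choose f hf hfK hfV using hpath
  set U : Ultrafilter ℕ := Ultrafilter.of Filter.atTop with hU
  have hUtop : (U : Filter ℕ) ≤ Filter.atTop := Ultrafilter.of_le _
  have hlim : ∀ u, ∃ y ∈ K, Filter.Tendsto (fun n => f n u) U (nhds y) := by
    intro u
    refine hK.ultrafilter_le_nhds' (U.map fun n => f n u) ?_
    exact (Filter.Eventually.of_forall fun n => hfK n u : ∀ᶠ n in (U : Filter ℕ), f n u ∈ K)
  choose φ _ hφ using hlim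
  refine ⟨φ, LipschitzWith.of_dist_le_mul fun u v => ?_, ?_⟩
  · exact le_of_tendsto ((hφ u).dist (hφ v))
      (Filter.Eventually.of_forall fun n => (hf n).dist_le_mul u v)
  · intro n x hx
    have hev : ∀ m, ∃ t ∈ Icc (0 : ℝ) 1, n ≤ m → f m t = x := by
      intro m
      by_cases hnm : n ≤ m
      · obtain ⟨t, ht, he⟩ := hfV m (hV hnm hx)
        exact ⟨t, ht, fun _ => he⟩
      · exact ⟨0, by simp, fun h => absurd h hnm⟩
    choose t ht hte using hev
    obtain ⟨τ, hτ, hτlim⟩ := isCompact_Icc.ultrafilter_le_nhds' (U.map t)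
      (Filter.Eventually.of_forall ht : ∀ᶠ m in (U : Filter ℕ), t m ∈ Icc (0 : ℝ) 1)
    have hτlim : Filter.Tendsto t U (nhds τ) := hτlim
    refine ⟨τ, hτ, ?_⟩
    have h1 : Filter.Tendsto (fun m => dist (f m τ) (f m (t m))) U (nhds 0) := by
      have h2 : Filter.Tendsto (fun m => M * dist τ (t m)) U (nhds (M * dist τ τ)) :=
        (tendsto_const_nhds.dist hτlim).const_mul _
      rw [dist_self, mul_zero] at h2
      exact squeeze_zero (fun _ => dist_nonneg) (fun m => (hf m).dist_le_mul _ _) h2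
    have h3 : Filter.Tendsto (fun m => dist (f m τ) (f m (t m))) U (nhds (dist (φ τ) x)) := by
      refine ((hφ τ).dist tendsto_const_nhds).congr' ?_
      filter_upwards [hUtop (Filter.eventually_ge_atTop n)] with m hm
      rw [hte m hm]
    exact dist_eq_zero.1 (tendsto_nhds_unique h3 h1)

section Paths

variable {X : Type u} [NormedAddCommGroup X] [NormedSpace ℝ X]

/-- A path may be lengthened by a detour along a segment and back. -/
lemma exists_path_detour {K : Set X} (hK : Convex ℝ K) {g : ℝ → X}
    (hg : ∀ u v, dist (g u) (g v) ≤ |u - v|) (hgK : ∀ u, g u ∈ K) {L τ : ℝ} (hτ : τ ∈ Icc 0 L)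
    {t : X} (ht : t ∈ K) (hne : g τ ≠ t) :
    ∃ g' : ℝ → X, (∀ u v, dist (g' u) (g' v) ≤ |u - v|) ∧ (∀ u, g' u ∈ K) ∧
      insert t (g '' Icc 0 L) ⊆ g' '' Icc 0 (L + 2 * dist (g τ) t) := by
  set d := dist (g τ) t with hd
  have hd0 : 0 < d := dist_pos.2 hne
  set c : ℝ → ℝ := fun u => max 0 (min (u - τ) (2 * d)) with hc
  have c1 : ∀ u, u ≤ τ → c u = 0 := fun u hu => by
    simp only [hc]
    exact max_eq_left ((min_le_left _ _).trans (by linarith))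
  have c2 : ∀ u, τ ≤ u → u ≤ τ + 2 * d → c u = u - τ := fun u h1 h2 => by
    simp only [hc]
    rw [min_eq_left (by linarith), max_eq_right (by linarith)]
  have c3 : ∀ u, τ + 2 * d ≤ u → c u = 2 * d := fun u hu => by
    simp only [hc]
    rw [min_eq_right (by linarith), max_eq_right (by linarith)]
  have hcmono : ∀ u v, u ≤ v → c u ≤ c v ∧ c v ≤ c u + (v - u) := by
    intro u v huv
    refine ⟨max_le_max le_rfl (min_le_min (by linarith) le_rfl), ?_⟩
    refine max_le (by linarith [le_max_left 0 (min (u - τ) (2 * d))]) ?_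
    have h1 : min (u - τ) (2 * d) ≤ c u := le_max_right _ _
    rcases min_cases (u - τ) (2 * d) with ⟨h2, h3⟩ | ⟨h2, h3⟩
    · linarith [min_le_left (v - τ) (2 * d)]
    · linarith [min_le_right (v - τ) (2 * d)]
  set g' : ℝ → X := fun u => g (u - c u) + ((d - |c u - d|) / d) • (t - g τ) with hg'
  have hlip : ∀ u v, u ≤ v → dist (g' u) (g' v) ≤ v - u := by
    intro u v huv
    obtain ⟨h1, h2⟩ := hcmono u v huv
    have h3 : dist (g (u - c u)) (g (v - c v)) ≤ (v - u) - (c v - c u) := by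
      refine (hg _ _).trans (le_of_eq ?_)
      rw [abs_of_nonpos (by linarith)]
      ring
    have h4 : dist (((d - |c u - d|) / d) • (t - g τ)) (((d - |c v - d|) / d) • (t - g τ)) ≤
        c v - c u := by
      rw [dist_eq_norm, ← sub_smul, norm_smul, norm_sub_rev t, ← dist_eq_norm (g τ), ← hd, ← sub_div,
        norm_div, Real.norm_of_nonneg hd0.le, div_mul_cancel₀ _ hd0.ne', Real.norm_eq_abs,
        sub_sub_sub_cancel_left]
      refine (abs_abs_sub_abs_le _ _).trans (le_of_eq ?_)
      rw [sub_sub_sub_cancel_right, abs_of_nonneg (by linarith)]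
    exact (dist_add_add_le _ _ _ _).trans (by linarith)
  refine ⟨g', ?_, ?_, ?_⟩
  · intro u v
    rcases le_total u v with h | h
    · rw [abs_sub_comm]
      exact (hlip u v h).trans (le_abs_self _)
    · rw [dist_comm]
      exact (hlip v u h).trans (le_abs_self _)
  · intro u
    rcases le_total u τ with h1 | h1
    · simp only [hg', c1 u h1]
      simpa [abs_of_pos hd0] using hgK u
    rcases le_total u (τ + 2 * d) with h2 | h2
    · simp only [hg', c2 u h1 h2, sub_sub_cancel]
      refine hK.add_smul_sub_mem (hgK τ) ht ⟨div_nonneg ?_ hd0.le, (div_le_one hd0).2 ?_⟩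
      · have : |u - τ - d| ≤ d := abs_le.2 ⟨by linarith, by linarith⟩
        linarith
      · linarith [abs_nonneg (u - τ - d)]
    · simp only [hg', c3 u h2]
      rw [show 2 * d - d = d by ring, abs_of_pos hd0, sub_self, zero_div, zero_smul, add_zero]
      exact hgK _
  · obtain ⟨h0, h1⟩ := hτ
    refine insert_subset ⟨τ + d, ⟨by linarith, by linarith⟩, ?_⟩ ?_
    · simp only [hg', c2 (τ + d) (by linarith) (by linarith)]
      rw [show τ + d - (τ + d - τ) = τ by ring, show τ + d - τ - d = 0 by ring, abs_zero, sub_zero,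
        div_self hd0.ne', one_smul, add_sub_cancel]
    · rintro _ ⟨u, ⟨hu0, hu1⟩, rfl⟩
      rcases le_total u τ with h2 | h2
      · refine ⟨u, ⟨hu0, by linarith⟩, ?_⟩
        simp only [hg', c1 u h2]
        simp [abs_of_pos hd0]
      · refine ⟨u + 2 * d, ⟨by linarith, by linarith⟩, ?_⟩
        simp only [hg', c3 (u + 2 * d) (by linarith)]
        rw [show 2 * d - d = d by ring, abs_of_pos hd0, sub_self, zero_div, zero_smul, add_zero,
          add_sub_cancel_right]

/-- A connected graph is covered by a closed walk using every edge once in each direction. -/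
lemma IsNetwork.exists_path {F : Finset X} {G : Finset (X × X)} (hG : IsNetwork F G)
    (hne : F.Nonempty) {K : Set X} (hK : Convex ℝ K) (hFK : (F : Set X) ⊆ K) :
    ∃ g : ℝ → X, (∀ u v, dist (g u) (g v) ≤ |u - v|) ∧ (∀ u, g u ∈ K) ∧
      (F : Set X) ⊆ g '' Icc 0 (∑ e ∈ G, dist e.1 e.2) := by
  set innerEdges : Finset X → Finset (X × X) := fun S => G.filter fun e => e.1 ∈ S ∧ e.2 ∈ S with hin
  have key : ∀ n : ℕ, n + 1 ≤ F.card → ∃ S ⊆ F, n + 1 ≤ S.card ∧ ∃ g : ℝ → X,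
      (∀ u v, dist (g u) (g v) ≤ |u - v|) ∧ (∀ u, g u ∈ K) ∧
      (S : Set X) ⊆ g '' Icc 0 (∑ e ∈ innerEdges S, dist e.1 e.2) := by
    intro n
    induction n with
    | zero =>
      intro _
      obtain ⟨x, hx⟩ := hne
      refine ⟨{x}, by simpa using hx, by simp, fun _ => x, by simp, fun _ => hFK hx, ?_⟩
      rw [Finset.coe_singleton, singleton_subset_iff]
      exact ⟨0, ⟨le_rfl, Finset.sum_nonneg fun e _ => dist_nonneg⟩, rfl⟩
    | succ n ih =>
      intro hn
      obtain ⟨S, hSF, hcard, g, hg, hgK, hgS⟩ := ih (by omega)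
      by_cases hS : n + 1 + 1 ≤ S.card
      · exact ⟨S, hSF, hS, g, hg, hgK, hgS⟩
      obtain ⟨s, hs, t, ht, hst⟩ := hG.exists_exit hSF (Finset.card_pos.1 (by omega))
        (by rintro rfl; exact hS hn)
      obtain ⟨τ, hτ, rfl⟩ := hgS hs
      have htF := hG.mem_right hst
      obtain ⟨g', h1, h2, h3⟩ := exists_path_detour hK hg hgK hτ (hFK htF) (hG.ne _ _ hst)
      refine ⟨insert t S, Finset.insert_subset htF hSF, ?_, g', h1, h2, ?_⟩
      · rw [Finset.card_insert_of_notMem ht]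
        omega
      · rw [Finset.coe_insert]
        refine (insert_subset_insert hgS).trans (h3.trans (image_mono (Icc_subset_Icc le_rfl ?_)))
        have hsub : insert (g τ, t) (insert (t, g τ) (innerEdges S)) ⊆ innerEdges (insert t S) := by
          intro e he
          rw [Finset.mem_insert, Finset.mem_insert] at he
          rcases he with rfl | rfl | he
          · exact Finset.mem_filter.2 ⟨hst, by simp [hs], by simp⟩
          · exact Finset.mem_filter.2 ⟨hG.symm _ _ hst, by simp, by simp [hs]⟩
          · obtain ⟨he, he1, he2⟩ := Finset.mem_filter.1 he
            exact Finset.mem_filter.2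
              ⟨he, Finset.mem_insert_of_mem he1, Finset.mem_insert_of_mem he2⟩
        refine le_trans (le_of_eq ?_) (Finset.sum_le_sum_of_subset_of_nonneg hsub
          fun e _ _ => dist_nonneg)
        rw [Finset.sum_insert, Finset.sum_insert]
        · rw [dist_comm t (g τ)]
          ring
        · simp [hin, ht]
        · simp [hin, ht, hG.ne _ _ hst]
  have hpos := Finset.card_pos.2 hne
  obtain ⟨S, hSF, hcard, g, hg, hgK, hgS⟩ := key (F.card - 1) (by omega)
  obtain rfl := Finset.eq_of_subset_of_card_le hSF (by omega)
  refine ⟨g, hg, hgK, hgS.trans (image_mono (Icc_subset_Icc le_rfl ?_))⟩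
  exact Finset.sum_le_sum_of_subset_of_nonneg (Finset.filter_subset _ _) fun e _ _ => dist_nonneg

end Paths

lemma exists_two_zpow_lt {ε : ℝ} (hε : 0 < ε) (k₀ : ℤ) : ∃ n : ℕ, (2 : ℝ) ^ (-(k₀ + n)) < ε := by
  obtain ⟨n, hn⟩ := exists_pow_lt_of_lt_one (div_pos hε (by positivity : (0 : ℝ) < 2 ^ (-k₀)))
    (by norm_num : (1 / 2 : ℝ) < 1)
  refine ⟨n, ?_⟩
  rw [lt_div_iff₀ (by positivity), one_div, inv_pow] at hn
  rwa [neg_add, zpow_add₀ two_ne_zero, zpow_neg _ (n : ℤ), zpow_natCast, mul_comm]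

lemma IsRectifiableCurve.image {X : Type u} [NormedAddCommGroup X] [MeasurableSpace X] [BorelSpace X] {M : ℝ≥0} {f : ℝ → X}
    (hf : LipschitzWith M f) : IsRectifiableCurve (f '' Icc 0 1) :=
  ⟨⟨f, hf.continuous.continuousOn, rfl⟩,
    (hausdorffMeasure_image_Icc_le hf).trans_lt ENNReal.coe_lt_top⟩

section Assembly

variable {X : Type u} [NormedAddCommGroup X] [NormedSpace ℝ X]

lemma exists_lipschitz_path [CompleteSpace X] {p Cs A : ℝ} (hp : 0 < p) (hCs : 0 ≤ Cs)
    (hA : 240 ≤ A) (hs : ∀ x y : X, ‖x‖ = 1 → ‖x + y‖ + ‖x - y‖ ≤ 2 + Cs * ‖y‖ ^ p)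
    {E : Set X} {net : ℤ → Set X} (hE : IsBounded E) (hdiam : 0 < Metric.diam E)
    (hnet : IsMultiresolution E net) (hb : betaSum E net A p ≠ ∞) :
    ∃ f : ℝ → X, LipschitzWith (Real.toNNReal
      (32 * Metric.diam E + refineConst p Cs A * (betaSum E net A p).toReal)) f ∧
      E ⊆ f '' Icc 0 1 := by
  have hnontriv : E.Nontrivial := by
    by_contra h
    rw [not_nontrivial_iff] at h
    exact hdiam.ne' (diam_subsingleton h)
  have hne := hnontriv.nonempty
  obtain ⟨x, -, y, -, hxy⟩ := hnontriv
  have : Nontrivial X := ⟨x, y, hxy⟩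
  obtain ⟨m, hm1, hm2⟩ := exists_mem_Ico_zpow hdiam (one_lt_two : (1 : ℝ) < 2)
  set k₀ : ℤ := -(m + 1) with hk₀
  have hk : Metric.diam E < 2 ^ (-k₀) := by rwa [hk₀, neg_neg]
  have hk' : (2 : ℝ) ^ (-k₀) ≤ 2 * Metric.diam E := by
    rw [hk₀, neg_neg, zpow_add₀ two_ne_zero, zpow_one]
    linarith
  set B : ℝ := 32 * Metric.diam E + refineConst p Cs A * (betaSum E net A p).toReal with hB
  have hB0 : 0 ≤ B := by
    have := refineConst_nonneg (p := p) hCs (by linarith : 0 ≤ A)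
    positivity
  have hlev : ∀ n : ℕ, ∃ (F : Finset X) (G : Finset (X × X)), (F : Set X) = net (k₀ + n) ∧
      IsNetwork F G ∧ ∑ e ∈ G, dist e.1 e.2 ≤ B := by
    intro n
    obtain ⟨F, G, hF, hG, hle⟩ :=
      exists_network_length_le hp hCs hA hs hne hE hnet hb hk n
    exact ⟨F, G, hF, hG, hle.trans (by linarith)⟩
  obtain ⟨⟨hsub, hmono, -⟩, hcov⟩ := hnet
  have htb : TotallyBounded E := by
    rw [Metric.totallyBounded_iff]
    intro ε hε
    obtain ⟨n, hn⟩ := exists_two_zpow_lt hε k₀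
    obtain ⟨F, -, hF, -⟩ := hlev n
    refine ⟨F, F.finite_toSet, fun e he => ?_⟩
    obtain ⟨z, hz, hez⟩ := hcov (k₀ + n) e he
    rw [← hF] at hz
    exact mem_biUnion hz (hez.trans_lt hn)
  have hK : IsCompact (closure (convexHull ℝ E)) :=
    htb.convexHull.closure.isCompact_of_isClosed isClosed_closure
  have hKc : Convex ℝ (closure (convexHull ℝ E)) := (convex_convexHull ℝ E).closure
  have hEK : E ⊆ closure (convexHull ℝ E) := (subset_convexHull ℝ E).trans subset_closure
  have hV : Monotone fun n : ℕ => net (k₀ + n) :=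
    monotone_nat_of_le_succ fun n => by
      have := hmono (k₀ + n)
      rwa [add_assoc, ← Nat.cast_succ] at this
  obtain ⟨f, hf, hfV⟩ := exists_limit_path (M := B.toNNReal) hK hV (by
    intro n
    obtain ⟨F, G, hF, hG, hle⟩ := hlev n
    have hFne : F.Nonempty := by
      obtain ⟨e, he⟩ := hne
      obtain ⟨z, hz, -⟩ := hcov (k₀ + n) e he
      exact ⟨z, by rwa [← Finset.mem_coe, hF]⟩
    obtain ⟨g, hg, hgK, hFg⟩ := hG.exists_path hFne hKc (hF ▸ (hsub _).trans hEK)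
    refine ⟨fun u => g (B * u), LipschitzWith.of_dist_le_mul fun u v => ?_,
      fun u => hgK _, fun z hz => ?_⟩
    · refine (hg _ _).trans (le_of_eq ?_)
      rw [← mul_sub, abs_mul, abs_of_nonneg hB0, Real.coe_toNNReal _ hB0, Real.dist_eq]
    · rw [← hF] at hz
      obtain ⟨τ, ⟨hτ0, hτ1⟩, rfl⟩ := hFg hz
      have hτB := hτ1.trans hle
      refine ⟨τ / B, ⟨div_nonneg hτ0 hB0, div_le_one_of_le₀ hτB hB0⟩, ?_⟩
      simp only
      rw [mul_div_cancel_of_imp']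
      intro hB'
      linarith)
  refine ⟨f, hf, fun e he => ?_⟩
  have hclosed : IsClosed (f '' Icc 0 1) := (isCompact_Icc.image hf.continuous).isClosed
  rw [← hclosed.closure_eq, Metric.mem_closure_iff]
  intro ε hε
  obtain ⟨n, hn⟩ := exists_two_zpow_lt hε k₀
  obtain ⟨z, hz, hez⟩ := hcov (k₀ + n) e he
  exact ⟨z, hfV n hz, hez.trans_lt hn⟩

end Assembly

/-- Theorem 1.1(ii): sufficient condition in uniformly smooth Banach spaces of power
type `p` with smoothness constant `Cs`. -/
theorem statement1 (p Cs A : ℝ) (hp1 : 1 < p) (hp2 : p ≤ 2) (hCs : 0 < Cs)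
    (hA : 240 ≤ A) :
    ∃ C : ℝ, 0 < C ∧
      ∀ (X : Type u) [NormedAddCommGroup X] [NormedSpace ℝ X] [CompleteSpace X]
        [MeasurableSpace X] [BorelSpace X],
        (∀ x y : X, ‖x‖ = 1 → ‖x + y‖ + ‖x - y‖ ≤ 2 + Cs * ‖y‖ ^ p) →
        ∀ (E : Set X) (net : ℤ → Set X),
          E.Nonempty → IsBounded E → IsMultiresolution E net → SEp E net A p < ⊤ →
          ∃ Γ : Set X, E ⊆ Γ ∧ IsRectifiableCurve Γ ∧
            μH[1] Γ ≤ ENNReal.ofReal C * SEp E net A p := by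
  have hR := refineConst_nonneg (p := p) hCs.le (by linarith : 0 ≤ A)
  refine ⟨32 + refineConst p Cs A, by linarith, ?_⟩
  intro X _ _ _ _ _ hs E net hne hE hnet hS
  have hb : betaSum E net A p ≠ ∞ := (ENNReal.add_lt_top.1 hS).2.ne
  rcases (diam_nonneg : 0 ≤ Metric.diam E).eq_or_lt with hd | hd
  · obtain ⟨x, hx⟩ := hne
    have hf : LipschitzWith 0 fun _ : ℝ => x := LipschitzWith.const x
    refine ⟨(fun _ : ℝ => x) '' Icc 0 1, fun y hy => ⟨0, by simp, ?_⟩, IsRectifiableCurve.image hf,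
      ?_⟩
    · have := dist_le_diam_of_mem hE hx hy
      exact dist_le_zero.1 (this.trans hd.ge)
    · refine (hausdorffMeasure_image_Icc_le hf).trans ?_
      simp
  · obtain ⟨f, hf, hEf⟩ := exists_lipschitz_path (by linarith) hCs.le hA hs hE hd hnet hb
    refine ⟨f '' Icc 0 1, hEf, IsRectifiableCurve.image hf,
      (hausdorffMeasure_image_Icc_le hf).trans ?_⟩
    have hSr : SEp E net A p =
        ENNReal.ofReal (Metric.diam E + (betaSum E net A p).toReal) := by
      rw [SEp, ENNReal.ofReal_add diam_nonneg ENNReal.toReal_nonneg, ENNReal.ofReal_toReal hb]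
    rw [hSr, ← ENNReal.ofReal_mul (by linarith)]
    refine ENNReal.ofReal_le_ofReal ?_
    have h1 := mul_nonneg hR hd.le
    have h2 : 0 ≤ (betaSum E net A p).toReal := ENNReal.toReal_nonneg
    linarith

end
end
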